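/- Let V be a continuous function on ℝⁿ such that V(x) − a|x|^θ is bounded for some a > 0 and θ ≥ 2, and let μ(dx) = e^{−V(x)} dx / Z. Then there exists a constant C > 0 such that C · W₂(ν,μ)^{2(θ−1)} ≤ I(ν|μ) for every probability measure ν on ℝⁿ. -/

import Mathlib

open MeasureTheory ENNReal NNReal Classical

/-- A coupling of `ν` and `μ`. -/
def IsCoupling {n : ℕ}
    (π : Measure (EuclideanSpace ℝ (Fin n) × EuclideanSpace ℝ (Fin n)))
    (ν μ : Measure (EuclideanSpace ℝ (Fin n))) : Prop :=
  π.map Prod.fst = ν ∧ π.map Prod.snd = μ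

/-- The `L^p`-Wasserstein distance for the Euclidean distance. -/
noncomputable def wassersteinDist {n : ℕ} (p : ℝ)
    (ν μ : Measure (EuclideanSpace ℝ (Fin n))) : ℝ≥0∞ :=
  (⨅ (π : Measure (EuclideanSpace ℝ (Fin n) × EuclideanSpace ℝ (Fin n)))
      (_ : IsCoupling π ν μ), ∫⁻ q, edist q.1 q.2 ^ p ∂π) ^ (1 / p)

/-- The relative entropy (Kullback information) `H(ν|μ)`. -/
noncomputable def relEntropy {n : ℕ}
    (ν μ : Measure (EuclideanSpace ℝ (Fin n))) : ℝ≥0∞ :=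
  if ν ≪ μ ∧ Integrable (llr ν μ) ν then ENNReal.ofReal (∫ x, llr ν μ x ∂ν) else ⊤

/-- The Fisher information `I(ν|μ) = ∫ |∇√f|² dμ` for `ν = fμ` with `√f ∈ H¹(μ)`,
and `+∞` otherwise. -/
noncomputable def fisherInfo {n : ℕ}
    (ν μ : Measure (EuclideanSpace ℝ (Fin n))) : ℝ≥0∞ :=
  ⨅ (f : EuclideanSpace ℝ (Fin n) → ℝ) (_ : ∀ x, 0 ≤ f x)
    (_ : ν = μ.withDensity fun x => ENNReal.ofReal (f x))
    (_ : Differentiable ℝ fun x => Real.sqrt (f x)),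
    ∫⁻ x, (‖gradient (fun y => Real.sqrt (f y)) x‖₊ : ℝ≥0∞) ^ 2 ∂μ

theorem lintegral_mul_sq_le {X : Type*} [MeasurableSpace X] {α : Measure X} {f g : X → ℝ≥0∞}
    (hf : Measurable f) (hg : Measurable g) :
    (∫⁻ x, f x * g x ∂α) ^ 2 ≤ (∫⁻ x, f x ^ 2 ∂α) * ∫⁻ x, g x ^ 2 ∂α := by
  have h := ENNReal.lintegral_mul_le_Lp_mul_Lq α (p := 2) (q := 2)
    Real.HolderConjugate.two_two hf.aemeasurable hg.aemeasurable
  have h2 : ∀ a : ℝ≥0∞, (a ^ (1 / (2 : ℝ))) ^ 2 = a := fun a => by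
    rw [← ENNReal.rpow_natCast, ← ENNReal.rpow_mul]; norm_num
  calc _ ≤ _ := pow_le_pow_left' h 2
    _ = _ := by rw [mul_pow, h2, h2]; simp

theorem lintegral_rpow_neg_half_Ioc {c : ℝ} (hc : 0 ≤ c) :
    ∫⁻ u in Set.Ioc 0 c, ENNReal.ofReal (u ^ (-(1 / 2) : ℝ)) = ENNReal.ofReal (2 * c ^ (1 / 2 : ℝ)) := by
  rw [← ofReal_integral_eq_lintegral_ofReal]
  · rw [← intervalIntegral.integral_of_le hc, integral_rpow (Or.inl (by norm_num))]
    congr 1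
    norm_num
    ring_nf
  · rw [← IntegrableOn, ← intervalIntegrable_iff_integrableOn_Ioc_of_le hc]
    exact intervalIntegral.intervalIntegrable_rpow' (by norm_num)
  · filter_upwards [ae_restrict_mem measurableSet_Ioc] with u hu
    exact Real.rpow_nonneg hu.1.le _

theorem lintegral_rpow_neg_three_halves_Ici {c : ℝ} (hc : 0 < c) :
    ∫⁻ u in Set.Ici c, ENNReal.ofReal (2 * u ^ (-(3 / 2) : ℝ)) =
      ENNReal.ofReal (4 * c ^ (-(1 / 2) : ℝ)) := by
  rw [setLIntegral_congr Ioi_ae_eq_Ici.symm, ← ofReal_integral_eq_lintegral_ofReal]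
  · rw [integral_const_mul, integral_Ioi_rpow_of_lt (by norm_num) hc]
    congr 1
    norm_num
    ring_nf
  · exact (integrableOn_Ioi_rpow_of_lt (by norm_num) hc).const_mul 2
  · filter_upwards [ae_restrict_mem measurableSet_Ioi] with u hu
    have : 0 < u := hc.trans hu
    positivity

/-- The Hardy inequality on a measure space parametrized by a function with uniform law. -/
theorem hardy_of_map_eq {X : Type*} [MeasurableSpace X] {α : Measure X} [SFinite α] {F : X → ℝ}
    {M : ℝ} (hFm : Measurable F) (hF : α.map F = volume.restrict (Set.Ioc 0 M)) {k : X → ℝ≥0∞}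
    (hk : Measurable k) :
    ∫⁻ x, ((∫⁻ y in {y | F y ≤ F x}, k y ∂α) / ENNReal.ofReal (F x)) ^ 2 ∂α ≤
      4 * ∫⁻ x, k x ^ 2 ∂α := by
  have hpos : ∀ᵐ x ∂α, F x ∈ Set.Ioc 0 M := by
    have : ∀ᵐ u ∂(α.map F), u ∈ Set.Ioc 0 M := by
      rw [hF]; exact ae_restrict_mem measurableSet_Ioc
    exact ae_of_ae_map hFm.aemeasurable this
  have hA : ∀ c, MeasurableSet {y | F y ≤ c} := fun c => measurableSet_le hFm measurable_const
  have hjoint : MeasurableSet {p : X × X | F p.2 ≤ F p.1} :=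
    measurableSet_le (hFm.comp measurable_snd) (hFm.comp measurable_fst)
  have hF_mem : ∀ x, F x ∈ Set.Ioc 0 M →
      ((∫⁻ y in {y | F y ≤ F x}, k y ∂α) / ENNReal.ofReal (F x)) ^ 2 ≤
      ∫⁻ y, Set.indicator {p : X × X | F p.2 ≤ F p.1}
        (fun p => k p.2 ^ 2 * ENNReal.ofReal (F p.2 ^ (1 / 2 : ℝ)) *
          ENNReal.ofReal (2 * F p.1 ^ (-(3 / 2) : ℝ))) (x, y) ∂α := by
    intro x hx
    have e1 : ∫⁻ y in {y | F y ≤ F x}, ENNReal.ofReal (F y ^ (-(1 / 4) : ℝ)) ^ 2 ∂α =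
        ENNReal.ofReal (2 * F x ^ (1 / 2 : ℝ)) := by
      have : ∫⁻ y in {y | F y ≤ F x}, ENNReal.ofReal (F y ^ (-(1 / 4) : ℝ)) ^ 2 ∂α =
          ∫⁻ u in Set.Iic (F x), ENNReal.ofReal (u ^ (-(1 / 4) : ℝ)) ^ 2 ∂(α.map F) := by
        rw [setLIntegral_map measurableSet_Iic (by fun_prop) hFm]
        rfl
      rw [this, hF, Measure.restrict_restrict measurableSet_Iic,
        show Set.Iic (F x) ∩ Set.Ioc 0 M = Set.Ioc 0 (F x) by
          ext u; simp only [Set.mem_inter_iff, Set.mem_Iic, Set.mem_Ioc]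
          constructor
          · rintro ⟨a, b, c⟩; exact ⟨b, a⟩
          · rintro ⟨a, b⟩; exact ⟨b, a, b.trans hx.2⟩,
        ← lintegral_rpow_neg_half_Ioc hx.1.le]
      refine setLIntegral_congr_fun measurableSet_Ioc fun u hu => ?_
      rw [← ENNReal.ofReal_pow (Real.rpow_nonneg hu.1.le _), ← Real.rpow_natCast,
        ← Real.rpow_mul hu.1.le]
      norm_num
    have e2 : (∫⁻ y in {y | F y ≤ F x}, k y ∂α) ^ 2 ≤
        (∫⁻ y in {y | F y ≤ F x}, k y ^ 2 * ENNReal.ofReal (F y ^ (1 / 2 : ℝ)) ∂α) *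
          ENNReal.ofReal (2 * F x ^ (1 / 2 : ℝ)) := by
      rw [← e1]
      have : ∫⁻ y in {y | F y ≤ F x}, k y ∂α = ∫⁻ y in {y | F y ≤ F x},
          (k y * ENNReal.ofReal (F y ^ (1 / 4 : ℝ))) * ENNReal.ofReal (F y ^ (-(1 / 4) : ℝ)) ∂α := by
        refine lintegral_congr_ae (ae_restrict_of_ae ?_)
        filter_upwards [hpos] with y hy
        rw [mul_assoc, ← ENNReal.ofReal_mul (Real.rpow_nonneg hy.1.le _),
          ← Real.rpow_add hy.1]
        norm_num
      rw [this]
      refine (lintegral_mul_sq_le (by fun_prop) (by fun_prop)).trans ?_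
      gcongr ?_ * _
      refine (lintegral_congr_ae (ae_restrict_of_ae ?_)).le
      filter_upwards [hpos] with y hy
      rw [mul_pow, ← ENNReal.ofReal_pow (Real.rpow_nonneg hy.1.le _), ← Real.rpow_natCast,
        ← Real.rpow_mul hy.1.le]
      norm_num
    have hx0 := hx.1
    have e3 : ENNReal.ofReal (2 * F x ^ (1 / 2 : ℝ)) / ENNReal.ofReal (F x) ^ 2 =
        ENNReal.ofReal (2 * F x ^ (-(3 / 2) : ℝ)) := by
      rw [← ENNReal.ofReal_pow hx0.le, ← ENNReal.ofReal_div_of_pos (by positivity), mul_div_assoc,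
        ← Real.rpow_natCast, ← Real.rpow_sub hx0]
      norm_num
    calc _ = (∫⁻ y in {y | F y ≤ F x}, k y ∂α) ^ 2 / ENNReal.ofReal (F x) ^ 2 := by
          rw [ENNReal.div_eq_inv_mul, mul_pow, ENNReal.div_eq_inv_mul, ENNReal.inv_pow]
      _ ≤ _ := ENNReal.div_le_div_right e2 _
      _ = (∫⁻ y in {y | F y ≤ F x}, k y ^ 2 * ENNReal.ofReal (F y ^ (1 / 2 : ℝ)) ∂α) *
          ENNReal.ofReal (2 * F x ^ (-(3 / 2) : ℝ)) := by rw [mul_div_assoc, e3]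
      _ = _ := by
          rw [← lintegral_mul_const _ (by fun_prop), ← lintegral_indicator (hA _)]
          rfl
  calc _ ≤ ∫⁻ x, ∫⁻ y, Set.indicator {p : X × X | F p.2 ≤ F p.1}
        (fun p => k p.2 ^ 2 * ENNReal.ofReal (F p.2 ^ (1 / 2 : ℝ)) *
          ENNReal.ofReal (2 * F p.1 ^ (-(3 / 2) : ℝ))) (x, y) ∂α ∂α := by
        refine lintegral_mono_ae ?_
        filter_upwards [hpos] with x hx using hF_mem x hx
    _ = ∫⁻ y, ∫⁻ x, Set.indicator {p : X × X | F p.2 ≤ F p.1}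
        (fun p => k p.2 ^ 2 * ENNReal.ofReal (F p.2 ^ (1 / 2 : ℝ)) *
          ENNReal.ofReal (2 * F p.1 ^ (-(3 / 2) : ℝ))) (x, y) ∂α ∂α := by
        refine lintegral_lintegral_swap ?_
        exact (Measurable.indicator (by fun_prop) hjoint).aemeasurable
    _ ≤ ∫⁻ y, 4 * k y ^ 2 ∂α := by
        refine lintegral_mono_ae ?_
        filter_upwards [hpos] with y hy
        have hy0 := hy.1
        have : ∀ x, Set.indicator {p : X × X | F p.2 ≤ F p.1}
            (fun p => k p.2 ^ 2 * ENNReal.ofReal (F p.2 ^ (1 / 2 : ℝ)) *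
              ENNReal.ofReal (2 * F p.1 ^ (-(3 / 2) : ℝ))) (x, y) =
            k y ^ 2 * ENNReal.ofReal (F y ^ (1 / 2 : ℝ)) *
              Set.indicator (Set.Ici (F y)) (fun u => ENNReal.ofReal (2 * u ^ (-(3 / 2) : ℝ))) (F x) := by
          intro x
          by_cases h : F y ≤ F x <;> simp [Set.indicator, h]
        simp_rw [this]
        rw [lintegral_const_mul]
        swap
        · exact (Measurable.indicator (by fun_prop) measurableSet_Ici).comp hFm
        rw [← lintegral_map (g := F) (f := Set.indicator (Set.Ici (F y))
          (fun u => ENNReal.ofReal (2 * u ^ (-(3 / 2) : ℝ))))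
          (Measurable.indicator (by fun_prop) measurableSet_Ici) hFm, hF]
        calc _ ≤ k y ^ 2 * ENNReal.ofReal (F y ^ (1 / 2 : ℝ)) *
              ∫⁻ u, Set.indicator (Set.Ici (F y)) (fun u => ENNReal.ofReal (2 * u ^ (-(3 / 2) : ℝ))) u := by
              gcongr; exact Measure.restrict_le_self
          _ = k y ^ 2 * (ENNReal.ofReal (F y ^ (1 / 2 : ℝ)) * ENNReal.ofReal (4 * F y ^ (-(1 / 2) : ℝ))) := by
              rw [lintegral_indicator measurableSet_Ici, lintegral_rpow_neg_three_halves_Ici hy0, mul_assoc]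
          _ = 4 * k y ^ 2 := by
              rw [← ENNReal.ofReal_mul (by positivity), mul_left_comm, ← Real.rpow_add hy0]
              norm_num [mul_comm]
    _ = _ := lintegral_const_mul _ (by fun_prop)

theorem strictMono_real_Iic (α : Measure ℝ) [IsFiniteMeasure α] [α.IsOpenPosMeasure] :
    StrictMono fun t => α.real (Set.Iic t) := by
  intro s t hst
  have h : α.real (Set.Iic t) = α.real (Set.Iic s) + α.real (Set.Ioc s t) := by
    rw [← measureReal_union (Set.Iic_disjoint_Ioc le_rfl) measurableSet_Ioc,
      Set.Iic_union_Ioc_eq_Iic hst.le]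
  have h2 : 0 < α.real (Set.Ioc s t) := by
    have : 0 < α (Set.Ioc s t) :=
      (isOpen_Ioo.measure_pos α (Set.nonempty_Ioo.2 hst)).trans_le
        (measure_mono Set.Ioo_subset_Ioc_self)
    exact ENNReal.toReal_pos this.ne' (measure_ne_top _ _)
  linarith

theorem real_Iic_mem (α : Measure ℝ) [IsFiniteMeasure α] [α.IsOpenPosMeasure]
    (t : ℝ) : α.real (Set.Iic t) ∈ Set.Ioo 0 (α.real Set.univ) := by
  have h := strictMono_real_Iic α (sub_one_lt t)
  have h' := strictMono_real_Iic α (lt_add_one t)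
  exact ⟨measureReal_nonneg.trans_lt h, h'.trans_le (measureReal_mono (Set.subset_univ _))⟩

theorem continuous_real_Iic (α : Measure ℝ) [IsFiniteMeasure α] [NullSingletonClass α] :
    Continuous fun t => α.real (Set.Iic t) := by
  have h : ∀ t, α.real (Set.Iic t) = α.real (Set.Iic 0) + ∫ _ in (0 : ℝ)..t, (1 : ℝ) ∂α := by
    intro t
    rw [← intervalIntegral.integral_Iic_sub_Iic (integrable_const 1).integrableOn
      (integrable_const 1).integrableOn, setIntegral_const, setIntegral_const, smul_eq_mul,
      smul_eq_mul]
    ring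
  rw [funext h]
  refine continuous_const.add (intervalIntegral.continuous_primitive (fun a b => ?_) 0)
  exact intervalIntegrable_const

theorem exists_real_Iic_eq (α : Measure ℝ) [IsFiniteMeasure α] [NullSingletonClass α] {v : ℝ}
    (hv : v ∈ Set.Ioo 0 (α.real Set.univ)) :
    ∃ t, α.real (Set.Iic t) = v := by
  have hb : Filter.Tendsto (fun t => α.real (Set.Iic t)) Filter.atBot (nhds 0) := by
    have := tendsto_measure_iInter_atBot (μ := α) (s := fun t : ℝ => Set.Iic t)
      (fun t => measurableSet_Iic.nullMeasurableSet) (fun _ _ h => Set.Iic_subset_Iic.2 h)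
      ⟨0, measure_ne_top _ _⟩
    rw [show ⋂ t : ℝ, Set.Iic t = ∅ from iInter_Iic_eq_empty_iff.2 (by simp [not_bddBelow_univ]),
      measure_empty] at this
    rw [← ENNReal.toReal_zero]
    exact (ENNReal.tendsto_toReal ENNReal.zero_ne_top).comp this
  have ht : Filter.Tendsto (fun t => α.real (Set.Iic t)) Filter.atTop (nhds (α.real Set.univ)) :=
    (ENNReal.tendsto_toReal (measure_ne_top _ _)).comp (tendsto_measure_Iic_atTop α)
  obtain ⟨a, ha⟩ := (hb.eventually_lt_const hv.1).exists
  obtain ⟨b, hb⟩ := (ht.eventually_const_lt hv.2).exists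
  exact mem_range_of_exists_le_of_exists_ge (continuous_real_Iic α) ⟨a, ha.le⟩ ⟨b, hb.le⟩

section DistributionFunction

variable (α : Measure ℝ) [IsFiniteMeasure α] [NullSingletonClass α] [α.IsOpenPosMeasure]

theorem map_real_Iic :
    α.map (fun t => α.real (Set.Iic t)) = volume.restrict (Set.Ioc 0 (α.real Set.univ)) := by
  have hm : Measurable fun t => α.real (Set.Iic t) := (continuous_real_Iic α).measurable
  refine Measure.ext_of_Iic _ _ fun u => ?_
  rw [Measure.map_apply hm measurableSet_Iic, Measure.restrict_apply measurableSet_Iic]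
  rcases le_or_gt u 0 with hu | hu
  · rw [show (fun t => α.real (Set.Iic t)) ⁻¹' Set.Iic u = ∅ from ?_,
      show Set.Iic u ∩ Set.Ioc 0 (α.real Set.univ) = ∅ from ?_]
    · simp
    · refine Set.eq_empty_of_forall_notMem fun v => ?_
      rintro ⟨h1, h2, -⟩
      exact absurd (h2.trans_le h1) hu.not_gt
    · ext v; simp only [Set.mem_preimage, Set.mem_Iic, Set.mem_empty_iff_false, iff_false, not_le]
      exact hu.trans_lt (real_Iic_mem α v).1
  rcases lt_or_ge u (α.real Set.univ) with hu' | hu'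
  · obtain ⟨t, ht⟩ := exists_real_Iic_eq α ⟨hu, hu'⟩
    rw [show (fun t => α.real (Set.Iic t)) ⁻¹' Set.Iic u = Set.Iic t from ?_,
      show Set.Iic u ∩ Set.Ioc 0 (α.real Set.univ) = Set.Ioc 0 u from ?_]
    · rw [Real.volume_Ioc, sub_zero, ← ht, ofReal_measureReal]
    · ext v; simp only [Set.mem_inter_iff, Set.mem_Iic, Set.mem_Ioc]
      exact ⟨fun h => ⟨h.2.1, h.1⟩, fun h => ⟨h.2, h.1, h.2.trans hu'.le⟩⟩
    · ext v
      rw [← ht]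
      exact (strictMono_real_Iic α).le_iff_le
  · rw [show (fun t => α.real (Set.Iic t)) ⁻¹' Set.Iic u = Set.univ from ?_,
      show Set.Iic u ∩ Set.Ioc 0 (α.real Set.univ) = Set.Ioc 0 (α.real Set.univ) from ?_]
    · rw [Real.volume_Ioc, sub_zero, ofReal_measureReal]
    · ext v; simp only [Set.mem_inter_iff, Set.mem_Iic, Set.mem_Ioc]
      exact ⟨fun h => h.2, fun h => ⟨h.2.trans hu', h⟩⟩
    · ext v; simp only [Set.mem_preimage, Set.mem_Iic, Set.mem_univ, iff_true]
      exact (real_Iic_mem α v).2.le.trans hu'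

theorem map_real_Ici :
    α.map (fun t => α.real (Set.Ici t)) = volume.restrict (Set.Ioc 0 (α.real Set.univ)) := by
  have hN : ∀ t, (α.map Neg.neg).real (Set.Iic t) = α.real (Set.Ici (-t)) := fun t => by
    rw [map_measureReal_apply measurable_neg measurableSet_Iic]; simp
  have : NullSingletonClass (α.map Neg.neg) := ⟨fun x => by
    rw [Measure.map_apply measurable_neg (measurableSet_singleton x)]; simp⟩
  have : (α.map Neg.neg).IsOpenPosMeasure :=
    (Homeomorph.neg ℝ).continuous.isOpenPosMeasure_map (Homeomorph.neg ℝ).surjective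
  have h := map_real_Iic (α.map Neg.neg)
  have hm := (continuous_real_Iic (α.map Neg.neg)).measurable
  rw [Measure.map_map hm measurable_neg] at h
  simp only [hN, Function.comp_def, neg_neg] at h
  rw [h, map_measureReal_apply measurable_neg MeasurableSet.univ, Set.preimage_univ]

end DistributionFunction

/-- The increasing rearrangement of `α` onto `β`. -/
noncomputable def rearrangement (α β : Measure ℝ) (s : ℝ) : ℝ :=
  sInf {t | α (Set.Iic s) ≤ β (Set.Iic t)}

section Rearrangement

variable {α β : Measure ℝ} [IsFiniteMeasure α] [α.IsOpenPosMeasure]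
  [IsFiniteMeasure β] [NullSingletonClass β] [β.IsOpenPosMeasure]

theorem rearrangement_le_iff (h : α Set.univ = β Set.univ) (s c : ℝ) :
    rearrangement α β s ≤ c ↔ α (Set.Iic s) ≤ β (Set.Iic c) := by
  have h' : α.real Set.univ = β.real Set.univ := by simp [measureReal_def, h]
  obtain ⟨t, ht⟩ := exists_real_Iic_eq β (h' ▸ real_Iic_mem α s)
  have key : ∀ c, α (Set.Iic s) ≤ β (Set.Iic c) ↔ t ≤ c := fun c => by
    rw [← (strictMono_real_Iic β).le_iff_le, ht, measureReal_def, measureReal_def,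
      ENNReal.toReal_le_toReal (measure_ne_top _ _) (measure_ne_top _ _)]
  rw [key, rearrangement]
  simp_rw [key]
  rw [show {c | t ≤ c} = Set.Ici t from rfl, csInf_Ici]

theorem apply_Iic_rearrangement (h : α Set.univ = β Set.univ) (s : ℝ) :
    β (Set.Iic (rearrangement α β s)) = α (Set.Iic s) := by
  refine le_antisymm ?_ ((rearrangement_le_iff h s _).1 le_rfl)
  have h' : α.real Set.univ = β.real Set.univ := by simp [measureReal_def, h]
  obtain ⟨t, ht⟩ := exists_real_Iic_eq β (h' ▸ real_Iic_mem α s)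
  have ht' : β (Set.Iic t) = α (Set.Iic s) := by
    rw [← ofReal_measureReal (μ := β), ht, ofReal_measureReal]
  rw [← ht']
  exact measure_mono (Set.Iic_subset_Iic.2 ((rearrangement_le_iff h s t).2 ht'.ge))

theorem monotone_rearrangement (h : α Set.univ = β Set.univ) : Monotone (rearrangement α β) :=
  fun s t hst => (rearrangement_le_iff h s _).2
    ((measure_mono (Set.Iic_subset_Iic.2 hst)).trans (apply_Iic_rearrangement h t).ge)

theorem map_rearrangement [NullSingletonClass α] (h : α Set.univ = β Set.univ) :
    α.map (rearrangement α β) = β := by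
  have h' : β.real Set.univ = α.real Set.univ := by simp [measureReal_def, h]
  refine Measure.ext_of_Iic _ _ fun c => ?_
  rw [Measure.map_apply (monotone_rearrangement h).measurable measurableSet_Iic]
  obtain ⟨t, ht⟩ := exists_real_Iic_eq α (h' ▸ real_Iic_mem β c)
  have ht' : α (Set.Iic t) = β (Set.Iic c) := by
    rw [← ofReal_measureReal (μ := α), ht, ofReal_measureReal]
  rw [← ht']
  congr 1
  ext s
  rw [Set.mem_preimage, Set.mem_Iic, rearrangement_le_iff h, ← ht',
    ← ENNReal.toReal_le_toReal (measure_ne_top _ _) (measure_ne_top _ _)]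
  exact (strictMono_real_Iic α).le_iff_le

end Rearrangement

theorem ENNReal_add_sq_le (x y : ℝ≥0∞) : (x + y) ^ 2 ≤ 2 * (x ^ 2 + y ^ 2) := by
  rcases eq_or_ne x ∞ with rfl | hx
  · simp
  rcases eq_or_ne y ∞ with rfl | hy
  · simp
  lift x to ℝ≥0 using hx
  lift y to ℝ≥0 using hy
  exact_mod_cast add_sq_le (a := x) (b := y)

theorem lintegral_sq_rearrangement_sub_le {c C K : ℝ} (hc : 0 < c) (hC : 0 < C) (hK : 0 < K)
    {ω p q : ℝ → ℝ} (hp : Measurable p) (hq : Measurable q)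
    (hω0 : ∀ s, 0 < ω s) (hωfin : ∫⁻ s, ENNReal.ofReal (ω s) ≠ ∞)
    (hcp : ∀ s, c * ω s ≤ p s) (hpC : ∀ s, p s ≤ C * ω s)
    (hcq : ∀ s, c * ω s ≤ q s) (hqC : ∀ s, q s ≤ C * ω s)
    (hpq : ∫⁻ s, ENNReal.ofReal (p s) = ∫⁻ s, ENNReal.ofReal (q s))
    (hcheeger : ∀ t, min (∫⁻ s in Set.Iic t, ENNReal.ofReal (ω s))
      (∫⁻ s in Set.Ici t, ENNReal.ofReal (ω s)) ≤ ENNReal.ofReal (K * ω t)) :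
    ∫⁻ s, ENNReal.ofReal ((rearrangement (volume.withDensity fun s => ENNReal.ofReal (p s))
        (volume.withDensity fun s => ENNReal.ofReal (q s)) s - s) ^ 2) * ENNReal.ofReal (p s) ≤
      ENNReal.ofReal (16 * (K * C / c) ^ 2 / c) *
        ∫⁻ s, ENNReal.ofReal ((p s - q s) ^ 2 / ω s) := by
  have hp0 : ∀ s, 0 < p s := fun s => (mul_pos hc (hω0 s)).trans_le (hcp s)
  have hq0 : ∀ s, 0 < q s := fun s => (mul_pos hc (hω0 s)).trans_le (hcq s)
  set α := volume.withDensity fun s => ENNReal.ofReal (p s) with hα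
  set β := volume.withDensity fun s => ENNReal.ofReal (q s) with hβ
  set Ω := volume.withDensity fun s => ENNReal.ofReal (ω s) with hΩ
  have hle : ∀ {r : ℝ → ℝ}, (∀ s, r s ≤ C * ω s) → ∀ S, MeasurableSet S →
      volume.withDensity (fun s => ENNReal.ofReal (r s)) S ≤ ENNReal.ofReal C * Ω S := by
    intro r hr S hS
    rw [hΩ, withDensity_apply _ hS, withDensity_apply _ hS,
      ← lintegral_const_mul' _ _ ENNReal.ofReal_ne_top]
    refine lintegral_mono fun s => ?_
    rw [← ENNReal.ofReal_mul hC.le]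
    exact ENNReal.ofReal_le_ofReal (hr s)
  have hΩfin : Ω Set.univ ≠ ∞ := by rwa [hΩ, withDensity_apply _ MeasurableSet.univ, setLIntegral_univ]
  have hfin : ∀ {r : ℝ → ℝ}, (∀ s, r s ≤ C * ω s) →
      IsFiniteMeasure (volume.withDensity (fun s => ENNReal.ofReal (r s))) := fun hr =>
    ⟨(hle hr _ MeasurableSet.univ).trans_lt
      (ENNReal.mul_lt_top ENNReal.ofReal_lt_top hΩfin.lt_top)⟩
  have hopen : ∀ {r : ℝ → ℝ}, Measurable r → (∀ s, 0 < r s) →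
      (volume.withDensity (fun s => ENNReal.ofReal (r s))).IsOpenPosMeasure := fun hr hr0 =>
    (withDensity_absolutelyContinuous' hr.ennreal_ofReal.aemeasurable
      (ae_of_all _ fun s => (ENNReal.ofReal_pos.2 (hr0 s)).ne')).isOpenPosMeasure
  have : IsFiniteMeasure α := hfin hpC
  have : IsFiniteMeasure β := hfin hqC
  have : α.IsOpenPosMeasure := hopen hp hp0
  have : β.IsOpenPosMeasure := hopen hq hq0
  have : NullSingletonClass α := inferInstanceAs (NullSingletonClass (volume.withDensity _))
  have : NullSingletonClass β := inferInstanceAs (NullSingletonClass (volume.withDensity _))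
  have huniv : α Set.univ = β Set.univ := by
    rw [hα, hβ, withDensity_apply _ MeasurableSet.univ, withDensity_apply _ MeasurableSet.univ,
      setLIntegral_univ, setLIntegral_univ, hpq]
  set T := rearrangement α β with hT
  have hTs : ∀ s, β (Set.Iic (T s)) = α (Set.Iic s) := apply_Iic_rearrangement huniv
  have hTs' : ∀ s, β (Set.Ioi (T s)) = α (Set.Ioi s) := fun s => by
    rw [← Set.compl_Iic, ← Set.compl_Iic, measure_compl measurableSet_Iic (measure_ne_top _ _),
      measure_compl measurableSet_Iic (measure_ne_top _ _), hTs, huniv]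
  set k : ℝ → ℝ≥0∞ := fun s => ENNReal.ofReal (|p s - q s| / p s) with hk
  have hkm : Measurable k := by fun_prop
  have hN : ∀ S, MeasurableSet S →
      ∫⁻ s in S, k s ∂α = ∫⁻ s in S, ENNReal.ofReal |p s - q s| := by
    intro S hS
    rw [hα, restrict_withDensity hS, lintegral_withDensity_eq_lintegral_mul _ (by fun_prop) hkm]
    refine lintegral_congr fun s => ?_
    rw [Pi.mul_apply, ← ENNReal.ofReal_mul (hp0 s).le, mul_div_cancel₀ _ (hp0 s).ne']
  have hαβ : ∀ S, MeasurableSet S → α S ≤ β S + ∫⁻ s in S, k s ∂α := by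
    intro S hS
    rw [hN S hS, hα, hβ, withDensity_apply _ hS, withDensity_apply _ hS,
      ← lintegral_add_left (by fun_prop)]
    refine lintegral_mono fun s => ?_
    rw [← ENNReal.ofReal_add (hq0 s).le (abs_nonneg _)]
    exact ENNReal.ofReal_le_ofReal (by linarith [le_abs_self (p s - q s)])
  have hβα : ∀ S, MeasurableSet S → β S ≤ α S + ∫⁻ s in S, k s ∂α := by
    intro S hS
    rw [hN S hS, hα, hβ, withDensity_apply _ hS, withDensity_apply _ hS,
      ← lintegral_add_left (by fun_prop)]
    refine lintegral_mono fun s => ?_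
    rw [← ENNReal.ofReal_add (hp0 s).le (abs_nonneg _)]
    exact ENNReal.ofReal_le_ofReal (by linarith [neg_abs_le (p s - q s)])
  have hAB : ∀ s, 0 < min (α.real (Set.Iic s)) (α.real (Set.Ici s)) := fun s =>
    lt_min (real_Iic_mem α s).1 (ENNReal.toReal_pos
      ((isOpen_Ioi.measure_pos α Set.nonempty_Ioi).trans_le
        (measure_mono Set.Ioi_subset_Ici_self)).ne' (measure_ne_top _ _))
  -- the density of `β` between `s` and `T s`
  have hdens : ∀ s t, α (Set.Iic s) ≤ ENNReal.ofReal C * Ω (Set.Iic t) →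
      α (Set.Ici s) ≤ ENNReal.ofReal C * Ω (Set.Ici t) →
      c / (K * C) * min (α.real (Set.Iic s)) (α.real (Set.Ici s)) ≤ q t := by
    intro s t h1 h2
    have h3 : ENNReal.ofReal (min (α.real (Set.Iic s)) (α.real (Set.Ici s))) ≤
        ENNReal.ofReal (C * (K * ω t)) := by
      rw [ENNReal.ofReal_mul hC.le, ENNReal.ofReal_min, ofReal_measureReal, ofReal_measureReal]
      refine (min_le_min h1 h2).trans ?_
      rw [← mul_min]
      gcongr
      have := hcheeger t
      rwa [hΩ, withDensity_apply _ measurableSet_Iic, withDensity_apply _ measurableSet_Ici]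
    have h4 : min (α.real (Set.Iic s)) (α.real (Set.Ici s)) ≤ C * (K * ω t) :=
      (ENNReal.ofReal_le_ofReal_iff (by have := hω0 t; positivity)).1 h3
    calc _ ≤ c / (K * C) * (C * (K * ω t)) := by gcongr
      _ = c * ω t := by field_simp
      _ ≤ q t := hcq t
  have hmain : ∀ s, ∃ D : ℝ≥0∞, D ≤ ∫⁻ y in Set.Iic s, k y ∂α ∧ D ≤ ∫⁻ y in Set.Ici s, k y ∂α ∧
      ENNReal.ofReal (c / (K * C) * min (α.real (Set.Iic s)) (α.real (Set.Ici s))) *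
        ENNReal.ofReal |T s - s| ≤ D := by
    intro s
    have hIoi : ∫⁻ y in Set.Ioi s, k y ∂α ≤ ∫⁻ y in Set.Ici s, k y ∂α :=
      lintegral_mono_set Set.Ioi_subset_Ici_self
    have hβint : ∀ a b, a ≤ b → (∀ t ∈ Set.Ioc a b,
        c / (K * C) * min (α.real (Set.Iic s)) (α.real (Set.Ici s)) ≤ q t) →
        ENNReal.ofReal (c / (K * C) * min (α.real (Set.Iic s)) (α.real (Set.Ici s))) *
          ENNReal.ofReal (b - a) ≤ β (Set.Ioc a b) := by
      intro a b _ h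
      rw [hβ, withDensity_apply _ measurableSet_Ioc, ← Real.volume_Ioc, ← setLIntegral_const]
      exact setLIntegral_mono' measurableSet_Ioc fun t ht => ENNReal.ofReal_le_ofReal (h t ht)
    rcases le_total s (T s) with hs | hs
    · refine ⟨β (Set.Ioc s (T s)), ?_, ?_, ?_⟩
      · have h := hαβ (Set.Iic s) measurableSet_Iic
        rw [← hTs, ← Set.Iic_union_Ioc_eq_Iic hs,
          measure_union (Set.Iic_disjoint_Ioc le_rfl) measurableSet_Ioc] at h
        exact (ENNReal.add_le_add_iff_left (measure_ne_top _ _)).1 h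
      · refine le_trans ?_ hIoi
        have h := hβα (Set.Ioi s) measurableSet_Ioi
        rw [← hTs', ← Set.Ioc_union_Ioi_eq_Ioi hs, measure_union
          (Set.Ioc_disjoint_Ioi le_rfl) measurableSet_Ioi,
          Set.Ioc_union_Ioi_eq_Ioi hs, add_comm] at h
        exact (ENNReal.add_le_add_iff_left (measure_ne_top _ _)).1 h
      · rw [abs_of_nonneg (sub_nonneg.2 hs)]
        refine hβint _ _ hs fun t ht => hdens s t ?_ ?_
        · exact (hle hpC _ measurableSet_Iic).trans (by gcongr; exact ht.1.le)
        · rw [measure_congr Ioi_ae_eq_Ici.symm, ← hTs']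
          refine (hle hqC _ measurableSet_Ioi).trans ?_
          gcongr
          exact Set.Ioi_subset_Ici ht.2
    · refine ⟨β (Set.Ioc (T s) s), ?_, ?_, ?_⟩
      · have h := hβα (Set.Iic s) measurableSet_Iic
        rw [← hTs, ← Set.Iic_union_Ioc_eq_Iic hs,
          measure_union (Set.Iic_disjoint_Ioc le_rfl) measurableSet_Ioc,
          Set.Iic_union_Ioc_eq_Iic hs] at h
        exact (ENNReal.add_le_add_iff_left (measure_ne_top _ _)).1 h
      · refine le_trans ?_ hIoi
        have h := hαβ (Set.Ioi s) measurableSet_Ioi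
        rw [← hTs', ← Set.Ioc_union_Ioi_eq_Ioi hs, measure_union
          (Set.Ioc_disjoint_Ioi le_rfl) measurableSet_Ioi, add_comm] at h
        exact (ENNReal.add_le_add_iff_left (measure_ne_top _ _)).1 h
      · rw [abs_sub_comm, abs_of_nonneg (sub_nonneg.2 hs)]
        refine hβint _ _ hs fun t ht => hdens s t ?_ ?_
        · rw [← hTs]
          exact (hle hqC _ measurableSet_Iic).trans (by gcongr; exact ht.1.le)
        · refine (hle hpC _ measurableSet_Ici).trans ?_
          gcongr
          exact ht.2
  have hpt : ∀ s, ENNReal.ofReal |T s - s| ≤ ENNReal.ofReal (K * C / c) *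
      ((∫⁻ y in Set.Iic s, k y ∂α) / ENNReal.ofReal (α.real (Set.Iic s)) +
        (∫⁻ y in Set.Ici s, k y ∂α) / ENNReal.ofReal (α.real (Set.Ici s))) := by
    intro s
    obtain ⟨D, h1, h2, h3⟩ := hmain s
    have h0 := hAB s
    have h4 : ENNReal.ofReal |T s - s| ≤ ENNReal.ofReal (K * C / c) *
        (D / ENNReal.ofReal (min (α.real (Set.Iic s)) (α.real (Set.Ici s)))) := by
      calc ENNReal.ofReal |T s - s| = ENNReal.ofReal (K * C / c) *
            ((ENNReal.ofReal (c / (K * C) * min (α.real (Set.Iic s)) (α.real (Set.Ici s))) *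
              ENNReal.ofReal |T s - s|) /
              ENNReal.ofReal (min (α.real (Set.Iic s)) (α.real (Set.Ici s)))) := by
            rw [← ENNReal.ofReal_mul (by positivity), ← ENNReal.ofReal_div_of_pos h0,
              ← ENNReal.ofReal_mul (by positivity)]
            congr 1
            field_simp
        _ ≤ _ := by gcongr
    refine h4.trans ?_
    gcongr
    rcases le_total (α.real (Set.Iic s)) (α.real (Set.Ici s)) with h | h
    · rw [min_eq_left h]
      exact (ENNReal.div_le_div_right h1 _).trans le_self_add
    · rw [min_eq_right h]
      exact (ENNReal.div_le_div_right h2 _).trans le_add_self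
  have hmI : Measurable fun t => α.real (Set.Iic t) := (continuous_real_Iic α).measurable
  have hanti : ∀ t s, α.real (Set.Ici t) ≤ α.real (Set.Ici s) ↔ s ≤ t := by
    intro t s
    have : ∀ t, α.real (Set.Ici t) = α.real Set.univ - α.real (Set.Iic t) := fun t => by
      rw [measureReal_congr Ioi_ae_eq_Ici.symm, ← Set.compl_Iic,
        measureReal_compl measurableSet_Iic]
    rw [this, this, ← (strictMono_real_Iic α).le_iff_le (a := s) (b := t)]
    constructor <;> intro h <;> linarith
  have hmA : Measurable fun t => α.real (Set.Ici t) := by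
    have : Antitone fun t => α.real (Set.Ici t) := fun s t h => (hanti t s).2 h
    exact this.measurable
  have hH1 := hardy_of_map_eq hmI (map_real_Iic α) hkm
  have hH2 := hardy_of_map_eq hmA (map_real_Ici α) hkm
  simp only [(strictMono_real_Iic α).le_iff_le, hanti] at hH1 hH2
  have hk2 : ∫⁻ s, k s ^ 2 ∂α ≤ ENNReal.ofReal (1 / c) * ∫⁻ s, ENNReal.ofReal ((p s - q s) ^ 2 / ω s) := by
    rw [hα, lintegral_withDensity_eq_lintegral_mul _ (by fun_prop) (by fun_prop),
      ← lintegral_const_mul' _ _ ENNReal.ofReal_ne_top]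
    refine lintegral_mono fun s => ?_
    have := hp0 s
    have := hω0 s
    rw [Pi.mul_apply, ← ENNReal.ofReal_pow (by positivity), ← ENNReal.ofReal_mul (by positivity),
      ← ENNReal.ofReal_mul (by positivity)]
    refine ENNReal.ofReal_le_ofReal ?_
    rw [div_pow, sq_abs]
    calc p s * ((p s - q s) ^ 2 / p s ^ 2) = (p s - q s) ^ 2 / p s := by field_simp
      _ ≤ (p s - q s) ^ 2 / (c * ω s) := by gcongr; exact hcp s
      _ = _ := by field_simp
  calc ∫⁻ s, ENNReal.ofReal ((T s - s) ^ 2) * ENNReal.ofReal (p s)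
      = ∫⁻ s, ENNReal.ofReal |T s - s| ^ 2 ∂α := by
        have hTm := (monotone_rearrangement huniv).measurable
        rw [hα, lintegral_withDensity_eq_lintegral_mul _ (by fun_prop) (by fun_prop)]
        refine lintegral_congr fun s => ?_
        rw [Pi.mul_apply, ← ENNReal.ofReal_pow (abs_nonneg _), sq_abs, mul_comm]
    _ ≤ ∫⁻ s, ENNReal.ofReal (K * C / c) ^ 2 *
          (2 * (((∫⁻ y in Set.Iic s, k y ∂α) / ENNReal.ofReal (α.real (Set.Iic s))) ^ 2 +
          ((∫⁻ y in Set.Ici s, k y ∂α) / ENNReal.ofReal (α.real (Set.Ici s))) ^ 2)) ∂α := by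
        refine lintegral_mono fun s => ?_
        refine (pow_le_pow_left' (hpt s) 2).trans ?_
        rw [mul_pow]
        gcongr
        exact ENNReal_add_sq_le _ _
    _ ≤ ENNReal.ofReal (K * C / c) ^ 2 * (2 * (4 * ∫⁻ s, k s ^ 2 ∂α + 4 * ∫⁻ s, k s ^ 2 ∂α)) := by
        rw [lintegral_const_mul' _ _ (by finiteness), lintegral_const_mul' _ _ (by finiteness)]
        gcongr
        have hmono : Monotone fun s => ∫⁻ y in Set.Iic s, k y ∂α := fun s t h =>
          lintegral_mono_set (Set.Iic_subset_Iic.2 h)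
        have hm : Measurable fun s =>
            ((∫⁻ y in Set.Iic s, k y ∂α) / ENNReal.ofReal (α.real (Set.Iic s))) ^ 2 :=
          (hmono.measurable.div hmI.ennreal_ofReal).pow_const 2
        rw [lintegral_add_left hm]
        exact add_le_add hH1 hH2
    _ ≤ ENNReal.ofReal (K * C / c) ^ 2 * (16 * (ENNReal.ofReal (1 / c) *
          ∫⁻ s, ENNReal.ofReal ((p s - q s) ^ 2 / ω s))) := by
        refine mul_le_mul_right ?_ _
        calc _ = 16 * ∫⁻ s, k s ^ 2 ∂α := by ring
          _ ≤ _ := by gcongr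
    _ = _ := by
        rw [← mul_assoc, ← mul_assoc]
        congr 1
        rw [← ENNReal.ofReal_pow (by positivity), show (16 : ℝ≥0∞) = ENNReal.ofReal 16 by norm_num,
          ← ENNReal.ofReal_mul (by positivity), ← ENNReal.ofReal_mul (by positivity)]
        congr 1
        ring

section Lines

variable {n : ℕ}

theorem lintegral_le_of_line_le (i : Fin n) {F G : (Fin n → ℝ) → ℝ≥0∞} (hF : Measurable F)
    (hG : Measurable G)
    (h : ∀ x, ∫⁻ s, F (Function.update x i s) ≤ ∫⁻ s, G (Function.update x i s)) :
    ∫⁻ x, F x ≤ ∫⁻ x, G x := by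
  refine lintegral_le_of_lmarginal_le {i} hF hG ?_
  rw [lmarginal_singleton, lmarginal_singleton]
  exact h

theorem lintegral_eq_of_line_eq (i : Fin n) {F G : (Fin n → ℝ) → ℝ≥0∞} (hF : Measurable F)
    (hG : Measurable G)
    (h : ∀ x, ∫⁻ s, F (Function.update x i s) = ∫⁻ s, G (Function.update x i s)) :
    ∫⁻ x, F x = ∫⁻ x, G x :=
  le_antisymm (lintegral_le_of_line_le i hF hG fun x => (h x).le)
    (lintegral_le_of_line_le i hG hF fun x => (h x).ge)

theorem measurable_update_prod (i : Fin n) :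
    Measurable fun z : (Fin n → ℝ) × ℝ => Function.update z.1 i z.2 :=
  measurable_update'

theorem measurable_line (i : Fin n) (x : Fin n → ℝ) :
    Measurable fun s : ℝ => Function.update x i s := measurable_update x

/-- The measure with density `ρ` restricted to the line through `x` in direction `i`. -/
noncomputable def lineMeasure (ρ : (Fin n → ℝ) → ℝ) (i : Fin n) (x : Fin n → ℝ) : Measure ℝ :=
  volume.withDensity fun s => ENNReal.ofReal (ρ (Function.update x i s))

theorem lineMeasure_update (ρ : (Fin n → ℝ) → ℝ) (i : Fin n) (x : Fin n → ℝ) (s : ℝ) :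
    lineMeasure ρ i (Function.update x i s) = lineMeasure ρ i x := by
  simp [lineMeasure]

/-- The monotone rearrangement of `ρ` onto `ρ'` along every line in direction `i`. -/
noncomputable def lineTransport (ρ ρ' : (Fin n → ℝ) → ℝ) (i : Fin n) (x : Fin n → ℝ) :
    Fin n → ℝ :=
  Function.update x i (rearrangement (lineMeasure ρ i x) (lineMeasure ρ' i x) (x i))

theorem lineTransport_update (ρ ρ' : (Fin n → ℝ) → ℝ) (i : Fin n) (x : Fin n → ℝ) (s : ℝ) :
    lineTransport ρ ρ' i (Function.update x i s) = Function.update x i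
      (rearrangement (lineMeasure ρ i x) (lineMeasure ρ' i x) s) := by
  simp [lineTransport, lineMeasure_update]

theorem sum_sq_lineTransport (ρ ρ' : (Fin n → ℝ) → ℝ) (i : Fin n) (x : Fin n → ℝ) :
    ∑ j, (lineTransport ρ ρ' i x j - x j) ^ 2 =
      (rearrangement (lineMeasure ρ i x) (lineMeasure ρ' i x) (x i) - x i) ^ 2 := by
  rw [Finset.sum_eq_single i]
  · simp [lineTransport]
  · intro j _ hj
    simp [lineTransport, hj]
  · simp

variable {ρ ρ' : (Fin n → ℝ) → ℝ} {i : Fin n}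

theorem isFiniteMeasure_lineMeasure {x : Fin n → ℝ}
    (h : ∫⁻ s, ENNReal.ofReal (ρ (Function.update x i s)) ≠ ∞) :
    IsFiniteMeasure (lineMeasure ρ i x) :=
  isFiniteMeasure_withDensity h

theorem isOpenPosMeasure_lineMeasure (hρ : Measurable ρ) (hρ0 : ∀ x, 0 < ρ x) (x : Fin n → ℝ) :
    (lineMeasure ρ i x).IsOpenPosMeasure :=
  (withDensity_absolutelyContinuous'
    (hρ.comp (measurable_line i x)).ennreal_ofReal.aemeasurable
    (ae_of_all _ fun _ => (ENNReal.ofReal_pos.2 (hρ0 _)).ne')).isOpenPosMeasure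

instance nullSingletonClass_lineMeasure (x : Fin n → ℝ) :
    NullSingletonClass (lineMeasure ρ i x) :=
  inferInstanceAs (NullSingletonClass (volume.withDensity _))

theorem lineMeasure_apply (x : Fin n → ℝ) {s : Set ℝ} (hs : MeasurableSet s) :
    lineMeasure ρ i x s = ∫⁻ t in s, ENNReal.ofReal (ρ (Function.update x i t)) :=
  withDensity_apply _ hs

theorem lineMeasure_univ (x : Fin n → ℝ) :
    lineMeasure ρ i x Set.univ = ∫⁻ t, ENNReal.ofReal (ρ (Function.update x i t)) := by
  rw [lineMeasure_apply x MeasurableSet.univ, setLIntegral_univ]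

theorem measurable_lineTransport (hρ : Measurable ρ) (hρ' : Measurable ρ')
    (hρ0 : ∀ x, 0 < ρ x) (hρ0' : ∀ x, 0 < ρ' x)
    (hfin : ∀ x, ∫⁻ s, ENNReal.ofReal (ρ (Function.update x i s)) ≠ ∞)
    (heq : ∀ x, ∫⁻ s, ENNReal.ofReal (ρ (Function.update x i s)) =
      ∫⁻ s, ENNReal.ofReal (ρ' (Function.update x i s))) :
    Measurable (lineTransport ρ ρ' i) := by
  have hr : Measurable fun x : Fin n → ℝ =>
      rearrangement (lineMeasure ρ i x) (lineMeasure ρ' i x) (x i) := by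
    refine measurable_of_Iic fun c => ?_
    have : (fun x : Fin n → ℝ => rearrangement (lineMeasure ρ i x) (lineMeasure ρ' i x) (x i)) ⁻¹'
        Set.Iic c = {x | ∫⁻ t, (Set.Iic (x i)).indicator
          (fun t => ENNReal.ofReal (ρ (Function.update x i t))) t ≤
          ∫⁻ t, (Set.Iic c).indicator
          (fun t => ENNReal.ofReal (ρ' (Function.update x i t))) t} := by
      ext x
      have := isFiniteMeasure_lineMeasure (hfin x)
      have := isFiniteMeasure_lineMeasure (ρ := ρ') (heq x ▸ hfin x)
      have := isOpenPosMeasure_lineMeasure (i := i) hρ hρ0 x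
      have := isOpenPosMeasure_lineMeasure (i := i) hρ' hρ0' x
      have hu : lineMeasure ρ i x Set.univ = lineMeasure ρ' i x Set.univ := by
        rw [lineMeasure_univ, lineMeasure_univ, heq]
      rw [Set.mem_preimage, Set.mem_Iic, rearrangement_le_iff hu,
        lineMeasure_apply x measurableSet_Iic, lineMeasure_apply x measurableSet_Iic,
        Set.mem_ofPred_eq, lintegral_indicator measurableSet_Iic,
        lintegral_indicator measurableSet_Iic]
    rw [this]
    refine measurableSet_le ?_ ?_
    · refine Measurable.lintegral_prod_right'
        (f := fun z : (Fin n → ℝ) × ℝ => (Set.Iic (z.1 i)).indicator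
          (fun t => ENNReal.ofReal (ρ (Function.update z.1 i t))) z.2) ?_
      exact Measurable.indicator (s := {z : (Fin n → ℝ) × ℝ | z.2 ≤ z.1 i})
        (hρ.comp (measurable_update_prod i)).ennreal_ofReal
        (measurableSet_le (by fun_prop) (by fun_prop))
    · refine Measurable.lintegral_prod_right'
        (f := fun z : (Fin n → ℝ) × ℝ => (Set.Iic c).indicator
          (fun t => ENNReal.ofReal (ρ' (Function.update z.1 i t))) z.2) ?_
      exact Measurable.indicator (s := {z : (Fin n → ℝ) × ℝ | z.2 ≤ c})
        (hρ'.comp (measurable_update_prod i)).ennreal_ofReal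
        (measurableSet_le (by fun_prop) (by fun_prop))
  exact (measurable_update_prod i).comp (measurable_id.prodMk hr)

theorem map_lineTransport (hρ : Measurable ρ) (hρ' : Measurable ρ')
    (hρ0 : ∀ x, 0 < ρ x) (hρ0' : ∀ x, 0 < ρ' x)
    (hfin : ∀ x, ∫⁻ s, ENNReal.ofReal (ρ (Function.update x i s)) ≠ ∞)
    (heq : ∀ x, ∫⁻ s, ENNReal.ofReal (ρ (Function.update x i s)) =
      ∫⁻ s, ENNReal.ofReal (ρ' (Function.update x i s))) :
    (volume.withDensity fun x => ENNReal.ofReal (ρ x)).map (lineTransport ρ ρ' i) =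
      volume.withDensity fun x => ENNReal.ofReal (ρ' x) := by
  have hT := measurable_lineTransport hρ hρ' hρ0 hρ0' hfin heq
  refine Measure.ext_of_lintegral _ fun G hG => ?_
  have hGT : Measurable fun x => G (lineTransport ρ ρ' i x) := hG.comp hT
  rw [lintegral_map hG hT, lintegral_withDensity_eq_lintegral_mul _ (by fun_prop) hGT,
    lintegral_withDensity_eq_lintegral_mul _ (by fun_prop) hG]
  refine lintegral_eq_of_line_eq i (hρ.ennreal_ofReal.mul hGT)
    (hρ'.ennreal_ofReal.mul hG) fun x => ?_
  have := isFiniteMeasure_lineMeasure (hfin x)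
  have := isFiniteMeasure_lineMeasure (ρ := ρ') (heq x ▸ hfin x)
  have := isOpenPosMeasure_lineMeasure (i := i) hρ hρ0 x
  have := isOpenPosMeasure_lineMeasure (i := i) hρ' hρ0' x
  have hu : lineMeasure ρ i x Set.univ = lineMeasure ρ' i x Set.univ := by
    rw [lineMeasure_univ, lineMeasure_univ, heq]
  have hl := measurable_line i x
  have hGl : Measurable fun s => G (Function.update x i s) := hG.comp hl
  have hr := (monotone_rearrangement hu).measurable
  have h1 : ∫⁻ s, G (Function.update x i s) ∂(lineMeasure ρ' i x) =
      ∫⁻ s, G (Function.update x i (rearrangement (lineMeasure ρ i x) (lineMeasure ρ' i x) s))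
        ∂(lineMeasure ρ i x) := by
    conv_lhs => rw [← map_rearrangement hu, lintegral_map hGl hr]
  have hρl : Measurable fun s => ENNReal.ofReal (ρ (Function.update x i s)) :=
    (hρ.comp hl).ennreal_ofReal
  have hρl' : Measurable fun s => ENNReal.ofReal (ρ' (Function.update x i s)) :=
    (hρ'.comp hl).ennreal_ofReal
  have hGr : Measurable fun s => G (Function.update x i
      (rearrangement (lineMeasure ρ i x) (lineMeasure ρ' i x) s)) := hGl.comp hr
  have e1 := lintegral_withDensity_eq_lintegral_mul volume hρl' hGl
  have e2 := lintegral_withDensity_eq_lintegral_mul volume hρl hGr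
  simp only [Pi.mul_apply, lineTransport_update] at e1 e2 ⊢
  rw [← e1, ← e2]
  exact h1.symm

theorem lintegral_sq_lineTransport_le {ω : (Fin n → ℝ) → ℝ} {c C K : ℝ} (hc : 0 < c) (hC : 0 < C)
    (hK : 0 < K) (hρ : Measurable ρ) (hρ' : Measurable ρ') (hω : Measurable ω)
    (hω0 : ∀ x, 0 < ω x)
    (hωfin : ∀ x, ∫⁻ s, ENNReal.ofReal (ω (Function.update x i s)) ≠ ∞)
    (hcρ : ∀ x, c * ω x ≤ ρ x) (hρC : ∀ x, ρ x ≤ C * ω x)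
    (hcρ' : ∀ x, c * ω x ≤ ρ' x) (hρC' : ∀ x, ρ' x ≤ C * ω x)
    (heq : ∀ x, ∫⁻ s, ENNReal.ofReal (ρ (Function.update x i s)) =
      ∫⁻ s, ENNReal.ofReal (ρ' (Function.update x i s)))
    (hT : Measurable (lineTransport ρ ρ' i))
    (hcheeger : ∀ x t, min (∫⁻ s in Set.Iic t, ENNReal.ofReal (ω (Function.update x i s)))
      (∫⁻ s in Set.Ici t, ENNReal.ofReal (ω (Function.update x i s))) ≤
        ENNReal.ofReal (K * ω (Function.update x i t))) :
    ∫⁻ x, ENNReal.ofReal (∑ j, (lineTransport ρ ρ' i x j - x j) ^ 2) * ENNReal.ofReal (ρ x) ≤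
      ENNReal.ofReal (16 * (K * C / c) ^ 2 / c) *
        ∫⁻ x, ENNReal.ofReal ((ρ x - ρ' x) ^ 2 / ω x) := by
  rw [← lintegral_const_mul _ (by fun_prop)]
  refine lintegral_le_of_line_le i (by fun_prop) (by fun_prop) fun x => ?_
  have hl := measurable_line i x
  rw [lintegral_const_mul' _ _ ENNReal.ofReal_ne_top]
  simp only [sum_sq_lineTransport, lineMeasure_update, Function.update_self]
  exact lintegral_sq_rearrangement_sub_le hc hC hK (hρ.comp hl) (hρ'.comp hl)
    (fun s => hω0 _) (hωfin x) (fun s => hcρ _) (fun s => hρC _) (fun s => hcρ' _)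
    (fun s => hρC' _) (heq x) (hcheeger x)

end Lines

section Average

variable {w h : ℝ → ℝ} {K η : ℝ}

/-- The multiple of `w` on `[-1, 1]` with the same integral as `h`. -/
noncomputable def cubeAverage (w h : ℝ → ℝ) (s : ℝ) : ℝ :=
  (Set.Icc (-1) 1).indicator w s * ((∫ t, h t) / ∫ t in Set.Icc (-1) 1, w t)

theorem setIntegral_Icc_pos (hw : Integrable w) (hw0 : ∀ s, 0 < w s) :
    0 < ∫ t in Set.Icc (-1) 1, w t := by
  rw [setIntegral_pos_iff_support_of_nonneg_ae (ae_of_all _ fun s => (hw0 s).le) hw.integrableOn]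
  rw [show Function.support w = Set.univ from Set.eq_univ_of_forall fun s => (hw0 s).ne',
    Set.univ_inter, Real.volume_Icc]
  simp

theorem integrable_cubeAverage (hw : Integrable w) : Integrable (cubeAverage w h) :=
  (hw.indicator measurableSet_Icc).mul_const _

theorem integral_cubeAverage (hw : Integrable w) (hw0 : ∀ s, 0 < w s) :
    ∫ s, cubeAverage w h s = ∫ s, h s := by
  simp only [cubeAverage]
  rw [integral_mul_const, integral_indicator measurableSet_Icc,
    mul_div_cancel₀ _ (setIntegral_Icc_pos hw hw0).ne']

theorem abs_integral_div_le (hw : Integrable w) (hw0 : ∀ s, 0 < w s) (hη : 0 ≤ η)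
    (hK : ∫ s, w s ≤ K * ∫ s in Set.Icc (-1) 1, w s) (hh : ∀ s, |h s| ≤ η * w s) :
    |(∫ t, h t) / ∫ t in Set.Icc (-1) 1, w t| ≤ η * K := by
  have hd := setIntegral_Icc_pos hw hw0
  rw [abs_div, abs_of_pos hd, div_le_iff₀ hd]
  calc |∫ t, h t| = ‖∫ t, h t‖ := (Real.norm_eq_abs _).symm
    _ ≤ ∫ t, η * w t := norm_integral_le_of_norm_le (hw.const_mul η) (ae_of_all _ hh)
    _ = η * ∫ t, w t := integral_const_mul _ _
    _ ≤ _ := by rw [mul_assoc]; gcongr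

theorem lintegral_sq_cubeAverage_le (hwm : Measurable w) (hhm : Measurable h)
    (hw : Integrable w) (hw0 : ∀ s, 0 < w s) (hK0 : 0 ≤ K)
    (hK : ∫ s, w s ≤ K * ∫ s in Set.Icc (-1) 1, w s) :
    ∫⁻ s, ENNReal.ofReal (cubeAverage w h s ^ 2 / w s) ≤
      ENNReal.ofReal K * ∫⁻ s, ENNReal.ofReal (h s ^ 2 / w s) := by
  have hd := setIntegral_Icc_pos hw hw0
  set d := ∫ t in Set.Icc (-1) 1, w t with hd'
  have h1 : ∀ s, ENNReal.ofReal (cubeAverage w h s ^ 2 / w s) =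
      ENNReal.ofReal (((∫ t, h t) / d) ^ 2) *
        (Set.Icc (-1) 1).indicator (fun s => ENNReal.ofReal (w s)) s := by
    intro s
    by_cases hs : s ∈ Set.Icc (-1 : ℝ) 1
    · rw [cubeAverage, Set.indicator_of_mem hs, Set.indicator_of_mem hs,
        ← ENNReal.ofReal_mul (by positivity), ← hd']
      congr 1
      have := hw0 s
      field_simp
    · rw [cubeAverage, Set.indicator_of_notMem hs, Set.indicator_of_notMem hs]
      simp
  have h2 : ENNReal.ofReal (|∫ t, h t| ^ 2) ≤
      (∫⁻ s, ENNReal.ofReal (h s ^ 2 / w s)) * ENNReal.ofReal (K * d) := by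
    have e1 : ENNReal.ofReal |∫ t, h t| ≤ ∫⁻ t, ENNReal.ofReal (|h t| / √(w t)) *
        ENNReal.ofReal (√(w t)) := by
      rw [← Real.norm_eq_abs, ofReal_norm]
      refine (enorm_integral_le_lintegral_enorm _).trans (lintegral_mono fun t => ?_)
      rw [← ENNReal.ofReal_mul (by positivity),
        div_mul_cancel₀ _ (Real.sqrt_pos.2 (hw0 t)).ne', ← Real.norm_eq_abs, ofReal_norm]
    have e2 := lintegral_mul_sq_le (α := volume) (f := fun t => ENNReal.ofReal (|h t| / √(w t)))
      (g := fun t => ENNReal.ofReal (√(w t))) (by fun_prop) (by fun_prop)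
    rw [ENNReal.ofReal_pow (abs_nonneg _)]
    refine (pow_le_pow_left' e1 2).trans (e2.trans ?_)
    refine mul_le_mul' (lintegral_mono fun t => ?_) ?_
    · rw [← ENNReal.ofReal_pow (by positivity), div_pow, sq_abs, Real.sq_sqrt (hw0 t).le]
    · rw [lintegral_congr fun t => by rw [← ENNReal.ofReal_pow (by positivity),
        Real.sq_sqrt (hw0 t).le], ← ofReal_integral_eq_lintegral_ofReal hw
          (ae_of_all _ fun s => (hw0 s).le)]
      exact ENNReal.ofReal_le_ofReal hK
  simp_rw [h1]
  rw [lintegral_const_mul' _ _ ENNReal.ofReal_ne_top, lintegral_indicator measurableSet_Icc,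
    ← ofReal_integral_eq_lintegral_ofReal hw.integrableOn (ae_of_all _ fun s => (hw0 s).le)]
  calc ENNReal.ofReal (((∫ t, h t) / d) ^ 2) * ENNReal.ofReal d
      = ENNReal.ofReal (|∫ t, h t| ^ 2) * ENNReal.ofReal (1 / d) := by
        rw [← ENNReal.ofReal_mul (by positivity), ← ENNReal.ofReal_mul (by positivity), sq_abs]
        congr 1
        field_simp
    _ ≤ (∫⁻ s, ENNReal.ofReal (h s ^ 2 / w s)) * ENNReal.ofReal (K * d) *
          ENNReal.ofReal (1 / d) := by gcongr
    _ = _ := by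
        rw [mul_assoc, ← ENNReal.ofReal_mul (by positivity), mul_comm]
        congr 2
        field_simp

end Average

/-- Regularity of a weight on `ℝⁿ` along all lines parallel to the axes. -/
structure IsLineWeight {n : ℕ} (ω : (Fin n → ℝ) → ℝ) (K B : ℝ) : Prop where
  measurable : Measurable ω
  pos : ∀ x, 0 < ω x
  le : ∀ x, ω x ≤ B
  eq_one : ∀ x, (∀ j, |x j| ≤ 1) → ω x = 1
  one_le : 1 ≤ K
  cheeger : ∀ i x t, min (∫⁻ s in Set.Iic t, ENNReal.ofReal (ω (Function.update x i s)))
    (∫⁻ s in Set.Ici t, ENNReal.ofReal (ω (Function.update x i s))) ≤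
      ENNReal.ofReal (K * ω (Function.update x i t))
  lintegral_le : ∀ i x, ∫⁻ s, ENNReal.ofReal (ω (Function.update x i s)) ≤
    ENNReal.ofReal K * ∫⁻ s in Set.Icc (-1) 1, ENNReal.ofReal (ω (Function.update x i s))

section LineAverage

variable {n : ℕ} {ω h : (Fin n → ℝ) → ℝ} {K B η : ℝ}

theorem IsLineWeight.integrable (hω : IsLineWeight ω K B) (i : Fin n) (x : Fin n → ℝ) :
    Integrable fun s => ω (Function.update x i s) := by
  refine ⟨(hω.measurable.comp (measurable_line i x)).aestronglyMeasurable, ?_⟩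
  rw [hasFiniteIntegral_iff_ofReal (ae_of_all _ fun s => (hω.pos _).le)]
  refine (hω.lintegral_le i x).trans_lt (ENNReal.mul_lt_top ENNReal.ofReal_lt_top ?_)
  calc _ ≤ ∫⁻ s in Set.Icc (-1 : ℝ) 1, ENNReal.ofReal B :=
        lintegral_mono fun s => ENNReal.ofReal_le_ofReal (hω.le _)
    _ < ∞ := by
        rw [setLIntegral_const, Real.volume_Icc]
        exact ENNReal.mul_lt_top ENNReal.ofReal_lt_top ENNReal.ofReal_lt_top

theorem IsLineWeight.integral_le (hω : IsLineWeight ω K B) (i : Fin n) (x : Fin n → ℝ) :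
    ∫ s, ω (Function.update x i s) ≤ K * ∫ s in Set.Icc (-1) 1, ω (Function.update x i s) := by
  have hi := hω.integrable i x
  have h0 : ∀ s, 0 ≤ ω (Function.update x i s) := fun s => (hω.pos _).le
  have hK := zero_le_one.trans hω.one_le
  have := hω.lintegral_le i x
  rw [← ofReal_integral_eq_lintegral_ofReal hi (ae_of_all _ h0),
    ← ofReal_integral_eq_lintegral_ofReal hi.integrableOn (ae_of_all _ h0),
    ← ENNReal.ofReal_mul hK] at this
  exact (ENNReal.ofReal_le_ofReal_iff (mul_nonneg hK (integral_nonneg h0))).1 this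

/-- Concentrate `h` on the slab `|x i| ≤ 1`, preserving all line integrals in direction `i`. -/
noncomputable def lineAverage (ω : (Fin n → ℝ) → ℝ) (i : Fin n) (h : (Fin n → ℝ) → ℝ)
    (x : Fin n → ℝ) : ℝ :=
  cubeAverage (fun s => ω (Function.update x i s)) (fun s => h (Function.update x i s)) (x i)

theorem lineAverage_update (i : Fin n) (x : Fin n → ℝ) (s : ℝ) :
    lineAverage ω i h (Function.update x i s) =
      cubeAverage (fun s => ω (Function.update x i s)) (fun s => h (Function.update x i s)) s := by
  simp [lineAverage]

theorem measurable_lineAverage (hω : Measurable ω) (hh : Measurable h) (i : Fin n) :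
    Measurable (lineAverage ω i h) := by
  have h1 : Measurable fun x : Fin n → ℝ => ∫ s, h (Function.update x i s) :=
    (StronglyMeasurable.integral_prod_right' (f := fun z : (Fin n → ℝ) × ℝ =>
      h (Function.update z.1 i z.2))
      (hh.comp (measurable_update_prod i)).stronglyMeasurable).measurable
  have h2 : Measurable fun x : Fin n → ℝ => ∫ s in Set.Icc (-1) 1, ω (Function.update x i s) :=
    (StronglyMeasurable.integral_prod_right' (f := fun z : (Fin n → ℝ) × ℝ =>
      ω (Function.update z.1 i z.2))
      (hω.comp (measurable_update_prod i)).stronglyMeasurable).measurable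
  refine Measurable.mul ?_ (h1.div h2)
  have : (fun x : Fin n → ℝ => (Set.Icc (-1) 1).indicator (fun s => ω (Function.update x i s))
      (x i)) = {x : Fin n → ℝ | x i ∈ Set.Icc (-1) 1}.indicator ω := by
    ext x
    simp [Set.indicator_apply]
  rw [this]
  exact hω.indicator (measurableSet_Icc.preimage (measurable_pi_apply i))

theorem IsLineWeight.abs_lineAverage_le (hω : IsLineWeight ω K B) (hη : 0 ≤ η)
    (hh : ∀ x, |h x| ≤ η * ω x) (i : Fin n) (x : Fin n → ℝ) :
    |lineAverage ω i h x| ≤ η * K * ω x := by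
  have h1 := abs_integral_div_le (hω.integrable i x) (fun s => hω.pos _) hη (hω.integral_le i x)
    (fun s => hh (Function.update x i s))
  rw [lineAverage, cubeAverage, abs_mul, mul_comm]
  refine mul_le_mul h1 ?_ (abs_nonneg _) ((abs_nonneg _).trans h1)
  rw [Set.indicator_apply]
  split_ifs
  · simp [abs_of_pos (hω.pos x)]
  · simp [(hω.pos x).le]

theorem IsLineWeight.lintegral_sq_lineAverage_le (hω : IsLineWeight ω K B) (hh : Measurable h)
    (i : Fin n) : ∫⁻ x, ENNReal.ofReal (lineAverage ω i h x ^ 2 / ω x) ≤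
      ENNReal.ofReal K * ∫⁻ x, ENNReal.ofReal (h x ^ 2 / ω x) := by
  have hωm := hω.measurable
  have hm := measurable_lineAverage hωm hh i
  rw [← lintegral_const_mul' _ _ ENNReal.ofReal_ne_top]
  refine lintegral_le_of_line_le i (by fun_prop) (by fun_prop) fun x => ?_
  rw [lintegral_const_mul' _ _ ENNReal.ofReal_ne_top]
  simp only [lineAverage_update]
  exact lintegral_sq_cubeAverage_le (hωm.comp (measurable_line i x)) (hh.comp (measurable_line i x))
    (hω.integrable i x) (fun s => hω.pos _) (zero_le_one.trans hω.one_le) (hω.integral_le i x)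

theorem IsLineWeight.lintegral_line_add_lineAverage (hω : IsLineWeight ω K B) {m : (Fin n → ℝ) → ℝ}
    {C : ℝ} (hm : Measurable m) (hmC : ∀ x, |m x| ≤ C * ω x) (hh : Measurable h)
    (hhη : ∀ x, |h x| ≤ η * ω x) (i : Fin n)
    (h0 : ∀ x, 0 ≤ m x + h x) (h0' : ∀ x, 0 ≤ m x + lineAverage ω i h x) (x : Fin n → ℝ) :
    ∫⁻ s, ENNReal.ofReal (m (Function.update x i s) + h (Function.update x i s)) =
      ∫⁻ s, ENNReal.ofReal (m (Function.update x i s) +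
        lineAverage ω i h (Function.update x i s)) := by
  have hl := measurable_line i x
  have hi := hω.integrable i x
  have him : Integrable fun s => m (Function.update x i s) :=
    (hi.const_mul C).mono' (hm.comp hl).aestronglyMeasurable (ae_of_all _ fun s => hmC _)
  have hih : Integrable fun s => h (Function.update x i s) :=
    (hi.const_mul η).mono' (hh.comp hl).aestronglyMeasurable (ae_of_all _ fun s => hhη _)
  have hia : Integrable fun s => lineAverage ω i h (Function.update x i s) := by
    simp only [lineAverage_update]
    exact integrable_cubeAverage hi
  have e1 := ofReal_integral_eq_lintegral_ofReal (him.add hih) (ae_of_all _ fun s => h0 _)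
  have e2 := ofReal_integral_eq_lintegral_ofReal (him.add hia) (ae_of_all _ fun s => h0' _)
  simp only [Pi.add_apply] at e1 e2
  rw [← e1, ← e2]
  congr 1
  rw [integral_add him hih, integral_add him hia]
  simp only [lineAverage_update]
  rw [integral_cubeAverage hi fun s => hω.pos _]

end LineAverage

section Iterate

variable {n : ℕ} {ω m : (Fin n → ℝ) → ℝ} {K B : ℝ}

theorem IsLineWeight.exists_transport_foldl (hω : IsLineWeight ω K B) {c C : ℝ} (hc : 0 < c)
    (hm : Measurable m) (hcm : ∀ x, c * ω x ≤ m x) (hmC : ∀ x, m x ≤ C * ω x)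
    (l : List (Fin n)) :
    ∃ ε : ℝ, 0 < ε ∧ ∃ A : ℝ≥0, ∀ h : (Fin n → ℝ) → ℝ, Measurable h →
      (∀ x, |h x| ≤ ε * ω x) → ∃ S : (Fin n → ℝ) → Fin n → ℝ, Measurable S ∧
        (volume.withDensity fun x => ENNReal.ofReal (m x + h x)).map S =
          (volume.withDensity fun x =>
            ENNReal.ofReal (m x + l.foldl (fun h i => lineAverage ω i h) h x)) ∧
        ∫⁻ x, ENNReal.ofReal (∑ j, (S x j - x j) ^ 2) * ENNReal.ofReal (m x + h x) ≤
          A * ∫⁻ x, ENNReal.ofReal (h x ^ 2 / ω x) := by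
  have hωm := hω.measurable
  have hK : 0 < K := zero_lt_one.trans_le hω.one_le
  induction l with
  | nil => exact ⟨1, one_pos, 0, fun h _ _ => ⟨id, measurable_id, by simp, by simp⟩⟩
  | cons i l ih =>
    obtain ⟨ε', hε', A', ih⟩ := ih
    set D : ℝ≥0∞ := ENNReal.ofReal (16 * (K * (|C| + c) / (c / 2)) ^ 2 / (c / 2))
    refine ⟨min ε' (c / 2) / K, by positivity,
      (2 * (A' * ENNReal.ofReal K) + 2 * (D * (2 * (1 + ENNReal.ofReal K)))).toNNReal,
      fun h hh hhε => ?_⟩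
    rw [ENNReal.coe_toNNReal (by finiteness)]
    set h' := lineAverage ω i h with hh'def
    have hh' : Measurable h' := measurable_lineAverage hωm hh i
    have hhε' : ∀ x, |h' x| ≤ min ε' (c / 2) * ω x := fun x => by
      refine (hω.abs_lineAverage_le (by positivity) hhε i x).trans_eq ?_
      field_simp
    have hhc : ∀ x, |h x| ≤ c / 2 * ω x := fun x => by
      have hx := hω.pos x
      refine (hhε x).trans (mul_le_mul_of_nonneg_right ?_ hx.le)
      exact (div_le_self (by positivity) hω.one_le).trans (min_le_right _ _)
    have hhc' : ∀ x, |h' x| ≤ c / 2 * ω x := fun x => by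
      have hx := hω.pos x
      refine (hhε' x).trans ?_
      gcongr
      exact min_le_right _ _
    have hρ : Measurable fun x => m x + h x := hm.add hh
    have hρ' : Measurable fun x => m x + h' x := hm.add hh'
    have low : ∀ {g : (Fin n → ℝ) → ℝ}, (∀ x, |g x| ≤ c / 2 * ω x) →
        ∀ x, c / 2 * ω x ≤ m x + g x := fun hg x => by
      linarith [(abs_le.1 (hg x)).1, hcm x]
    have upp : ∀ {g : (Fin n → ℝ) → ℝ}, (∀ x, |g x| ≤ c / 2 * ω x) →
        ∀ x, m x + g x ≤ (|C| + c) * ω x := fun hg x => by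
      have hx := hω.pos x
      nlinarith [(abs_le.1 (hg x)).2, hmC x, mul_le_mul_of_nonneg_right (le_abs_self C) hx.le,
        mul_pos hc hx]
    have pos : ∀ {g : (Fin n → ℝ) → ℝ}, (∀ x, |g x| ≤ c / 2 * ω x) →
        ∀ x, 0 < m x + g x := fun hg x =>
      (mul_pos (by positivity) (hω.pos x)).trans_le (low hg x)
    have hmabs : ∀ x, |m x| ≤ |C| * ω x := fun x => by
      have hx := hω.pos x
      rw [abs_of_pos ((mul_pos hc hx).trans_le (hcm x))]
      exact (hmC x).trans (mul_le_mul_of_nonneg_right (le_abs_self C) hx.le)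
    have heq := hω.lintegral_line_add_lineAverage hm hmabs hh hhc i (fun x => (pos hhc x).le)
      (fun x => (pos hhc' x).le)
    have hfin : ∀ x, ∫⁻ s, ENNReal.ofReal (m (Function.update x i s) + h (Function.update x i s))
        ≠ ∞ := fun x => by
      refine ((lintegral_mono fun s => ENNReal.ofReal_le_ofReal (upp hhc _)).trans_lt ?_).ne
      exact (((hω.integrable i x).const_mul _).lintegral_lt_top)
    have hωfin : ∀ x, ∫⁻ s, ENNReal.ofReal (ω (Function.update x i s)) ≠ ∞ := fun x =>
      (hω.integrable i x).lintegral_lt_top.ne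
    set T := lineTransport (fun x => m x + h x) (fun x => m x + h' x) i with hTdef
    have hT : Measurable T := measurable_lineTransport hρ hρ' (pos hhc) (pos hhc')
      hfin heq
    have hTmap : (volume.withDensity fun x => ENNReal.ofReal (m x + h x)).map T =
        volume.withDensity fun x => ENNReal.ofReal (m x + h' x) :=
      map_lineTransport hρ hρ' (pos hhc) (pos hhc') hfin heq
    have hTcost := lintegral_sq_lineTransport_le (c := c / 2) (C := |C| + c) (by positivity)
      (by positivity) hK hρ hρ' hωm hω.pos hωfin (low hhc) (upp hhc) (low hhc')
      (upp hhc') heq hT (hω.cheeger i)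
    obtain ⟨S, hS, hSmap, hScost⟩ := ih h' hh' fun x => (hhε' x).trans (by
      have hx := hω.pos x
      gcongr
      exact min_le_left _ _)
    have hl2 := hω.lintegral_sq_lineAverage_le hh i
    refine ⟨S ∘ T, hS.comp hT, ?_, ?_⟩
    · rw [← Measure.map_map hS hT, List.foldl_cons, ← hSmap]
      rw [hTmap]
    have hpt : ∀ x, ENNReal.ofReal (∑ j, ((S ∘ T) x j - x j) ^ 2) ≤
        2 * ENNReal.ofReal (∑ j, (S (T x) j - T x j) ^ 2) +
          2 * ENNReal.ofReal (∑ j, (T x j - x j) ^ 2) := fun x => by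
      rw [show (2 : ℝ≥0∞) = ENNReal.ofReal 2 by simp, ← ENNReal.ofReal_mul (by positivity),
        ← ENNReal.ofReal_mul (by positivity), ← ENNReal.ofReal_add (by positivity) (by positivity)]
      refine ENNReal.ofReal_le_ofReal ?_
      rw [Finset.mul_sum, Finset.mul_sum, ← Finset.sum_add_distrib]
      refine Finset.sum_le_sum fun j _ => ?_
      simp only [Function.comp_apply]
      nlinarith [sq_nonneg (S (T x) j - T x j - (T x j - x j))]
    have hcomp : ∫⁻ x, ENNReal.ofReal (∑ j, (S (T x) j - T x j) ^ 2) *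
        ENNReal.ofReal (m x + h x) =
        ∫⁻ x, ENNReal.ofReal (∑ j, (S x j - x j) ^ 2) * ENNReal.ofReal (m x + h' x) := by
      have hG : Measurable fun x => ENNReal.ofReal (∑ j, (S x j - x j) ^ 2) := by fun_prop
      have hGT : Measurable fun x => ENNReal.ofReal (∑ j, (S (T x) j - T x j) ^ 2) := hG.comp hT
      have e1 := lintegral_map (μ := volume.withDensity fun x => ENNReal.ofReal (m x + h x)) hG hT
      have e2 := lintegral_withDensity_eq_lintegral_mul volume hρ.ennreal_ofReal hGT
      have e3 := lintegral_withDensity_eq_lintegral_mul volume hρ'.ennreal_ofReal hG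
      simp only [Pi.mul_apply] at e2 e3
      simp_rw [mul_comm (ENNReal.ofReal (∑ j, _))]
      rw [← e2, ← e3, ← e1, hTmap]
    have hdiff : ∫⁻ x, ENNReal.ofReal ((m x + h x - (m x + h' x)) ^ 2 / ω x) ≤
        2 * (1 + ENNReal.ofReal K) * ∫⁻ x, ENNReal.ofReal (h x ^ 2 / ω x) := by
      calc _ ≤ ∫⁻ x, (2 * ENNReal.ofReal (h x ^ 2 / ω x) + 2 * ENNReal.ofReal (h' x ^ 2 / ω x)) := by
            refine lintegral_mono fun x => ?_
            have hx := hω.pos x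
            rw [show (2 : ℝ≥0∞) = ENNReal.ofReal 2 by simp, ← ENNReal.ofReal_mul (by positivity),
              ← ENNReal.ofReal_mul (by positivity),
              ← ENNReal.ofReal_add (by positivity) (by positivity)]
            refine ENNReal.ofReal_le_ofReal ?_
            rw [← mul_div_assoc, ← mul_div_assoc, ← add_div]
            gcongr
            nlinarith [sq_nonneg (h x + h' x)]
        _ = 2 * (∫⁻ x, ENNReal.ofReal (h x ^ 2 / ω x)) +
            2 * ∫⁻ x, ENNReal.ofReal (h' x ^ 2 / ω x) := by
            rw [lintegral_add_left (by fun_prop), lintegral_const_mul _ (by fun_prop),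
              lintegral_const_mul _ (by fun_prop)]
        _ ≤ 2 * (∫⁻ x, ENNReal.ofReal (h x ^ 2 / ω x)) +
            2 * (ENNReal.ofReal K * ∫⁻ x, ENNReal.ofReal (h x ^ 2 / ω x)) := by gcongr
        _ = _ := by ring
    calc ∫⁻ x, ENNReal.ofReal (∑ j, ((S ∘ T) x j - x j) ^ 2) * ENNReal.ofReal (m x + h x)
        ≤ ∫⁻ x, (2 * (ENNReal.ofReal (∑ j, (S (T x) j - T x j) ^ 2) * ENNReal.ofReal (m x + h x)) +
          2 * (ENNReal.ofReal (∑ j, (T x j - x j) ^ 2) * ENNReal.ofReal (m x + h x))) := by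
          refine lintegral_mono fun x => (mul_le_mul_left (hpt x) _).trans_eq ?_
          ring
      _ = 2 * (∫⁻ x, ENNReal.ofReal (∑ j, (S x j - x j) ^ 2) * ENNReal.ofReal (m x + h' x)) +
          2 * ∫⁻ x, ENNReal.ofReal (∑ j, (T x j - x j) ^ 2) * ENNReal.ofReal (m x + h x) := by
          rw [lintegral_add_right _ (by fun_prop), lintegral_const_mul' _ _ (by simp),
            lintegral_const_mul' _ _ (by simp), hcomp]
      _ ≤ 2 * (A' * (ENNReal.ofReal K * ∫⁻ x, ENNReal.ofReal (h x ^ 2 / ω x))) +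
          2 * (D * (2 * (1 + ENNReal.ofReal K) * ∫⁻ x, ENNReal.ofReal (h x ^ 2 / ω x))) := by
          gcongr
          · exact hScost.trans (by gcongr)
          · exact hTcost.trans (by gcongr)
      _ = _ := by ring

end Iterate

section Vanish

variable {n : ℕ} {ω m h : (Fin n → ℝ) → ℝ} {K B : ℝ}

theorem lineAverage_eq_zero_self (i : Fin n) {x : Fin n → ℝ} (hx : 1 < |x i|) :
    lineAverage ω i h x = 0 := by
  rw [lineAverage, cubeAverage, Set.indicator_of_notMem, zero_mul]
  exact fun h => hx.not_ge (abs_le.2 h)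

theorem lineAverage_eq_zero (i j : Fin n) (hh : ∀ x : Fin n → ℝ, 1 < |x j| → h x = 0)
    {x : Fin n → ℝ} (hx : 1 < |x j|) : lineAverage ω i h x = 0 := by
  rcases eq_or_ne j i with rfl | hji
  · exact lineAverage_eq_zero_self j hx
  · have : ∀ s, h (Function.update x i s) = 0 := fun s => hh _ (by
      rwa [Function.update_of_ne hji])
    simp [lineAverage, cubeAverage, this]

theorem foldl_lineAverage_eq_zero (l : List (Fin n)) (j : Fin n)
    (hh : j ∈ l ∨ ∀ x : Fin n → ℝ, 1 < |x j| → h x = 0) {x : Fin n → ℝ} (hx : 1 < |x j|) :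
    l.foldl (fun h i => lineAverage ω i h) h x = 0 := by
  induction l generalizing h with
  | nil => exact hh.elim (fun h => absurd h List.not_mem_nil) fun hh => hh x hx
  | cons i l ih =>
    rw [List.foldl_cons]
    apply ih
    rcases hh with hh | hh
    · rcases List.mem_cons.1 hh with rfl | hj
      · exact Or.inr fun x hx => lineAverage_eq_zero_self j hx
      · exact Or.inl hj
    · exact Or.inr fun x hx => lineAverage_eq_zero i j hh hx

theorem IsLineWeight.lineAverage_congr (hω : IsLineWeight ω K B) (J : Set (Fin n)) (i : Fin n)
    (hv : ∀ j, ∀ x : Fin n → ℝ, 1 < |x j| → h x = 0)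
    (hJ : ∀ x y : Fin n → ℝ, (∀ j, |x j| ≤ 1) → (∀ j, |y j| ≤ 1) → (∀ j ∉ J, x j = y j) →
      h x = h y) {x y : Fin n → ℝ} (hx : ∀ j, |x j| ≤ 1) (hy : ∀ j, |y j| ≤ 1)
    (hxy : ∀ j ∉ J, j ≠ i → x j = y j) : lineAverage ω i h x = lineAverage ω i h y := by
  have hup : ∀ {z : Fin n → ℝ}, (∀ j, |z j| ≤ 1) → ∀ {s : ℝ}, |s| ≤ 1 →
      ∀ j, |Function.update z i s j| ≤ 1 := fun hz s hs j => by
    rcases eq_or_ne j i with rfl | hj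
    · simpa using hs
    · simpa [hj] using hz j
  have e1 : (fun s => h (Function.update x i s)) = fun s => h (Function.update y i s) := by
    funext s
    rcases le_or_gt |s| 1 with hs | hs
    · refine hJ _ _ (hup hx hs) (hup hy hs) fun j hj => ?_
      rcases eq_or_ne j i with rfl | hji
      · simp
      · simp [hji, hxy j hj hji]
    · rw [hv i _ (by simpa using hs), hv i _ (by simpa using hs)]
  have e2 : (Set.Icc (-1) 1).indicator (fun s => ω (Function.update x i s)) =
      (Set.Icc (-1) 1).indicator (fun s => ω (Function.update y i s)) := by
    refine Set.indicator_congr fun s hs => ?_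
    rw [hω.eq_one _ (hup hx (abs_le.2 hs)), hω.eq_one _ (hup hy (abs_le.2 hs))]
  have e3 : ∀ z : Fin n → ℝ, (∀ j, |z j| ≤ 1) →
      (Set.Icc (-1) 1).indicator (fun s => ω (Function.update y i s)) (z i) = 1 := fun z hz => by
    rw [Set.indicator_of_mem (Set.mem_Icc.2 (abs_le.1 (hz i))), hω.eq_one _ (hup hy (hz i))]
  rw [lineAverage, lineAverage, cubeAverage, cubeAverage, ← integral_indicator measurableSet_Icc,
    ← integral_indicator measurableSet_Icc, e1, e2, e3 x hx, e3 y hy]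

theorem IsLineWeight.foldl_lineAverage_congr (hω : IsLineWeight ω K B) (l : List (Fin n))
    (J : Set (Fin n)) (hv : ∀ j, ∀ x : Fin n → ℝ, 1 < |x j| → h x = 0)
    (hJ : ∀ x y : Fin n → ℝ, (∀ j, |x j| ≤ 1) → (∀ j, |y j| ≤ 1) → (∀ j ∉ J, x j = y j) →
      h x = h y) {x y : Fin n → ℝ} (hx : ∀ j, |x j| ≤ 1) (hy : ∀ j, |y j| ≤ 1)
    (hxy : ∀ j ∉ J, j ∉ l → x j = y j) :
    l.foldl (fun h i => lineAverage ω i h) h x = l.foldl (fun h i => lineAverage ω i h) h y := by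
  induction l generalizing h J with
  | nil => exact hJ x y hx hy fun j hj => hxy j hj List.not_mem_nil
  | cons i l ih =>
    rw [List.foldl_cons]
    refine ih (insert i J) (fun j x hx => lineAverage_eq_zero i j (hv j) hx)
      (fun x y hx hy hxy => hω.lineAverage_congr J i hv hJ hx hy fun j hj hji =>
        hxy j (by simp [hj, hji])) fun j hj hjl => hxy j ?_ ?_
    · exact fun h => hj (Set.mem_insert_of_mem _ h)
    · rw [List.mem_cons, not_or]
      exact ⟨fun h => hj (h ▸ Set.mem_insert _ _), hjl⟩

theorem IsLineWeight.exists_transport (hω : IsLineWeight ω K B) {c C : ℝ} (hc : 0 < c)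
    (hm : Measurable m) (hcm : ∀ x, c * ω x ≤ m x) (hmC : ∀ x, m x ≤ C * ω x)
    (hmfin : ∫⁻ x, ENNReal.ofReal (m x) ≠ ∞) :
    ∃ ε : ℝ, 0 < ε ∧ ∃ A : ℝ≥0, ∀ h : (Fin n → ℝ) → ℝ, Measurable h →
      (∀ x, |h x| ≤ ε * ω x) →
      ∫⁻ x, ENNReal.ofReal (m x + h x) = ∫⁻ x, ENNReal.ofReal (m x) →
      ∃ S : (Fin n → ℝ) → Fin n → ℝ, Measurable S ∧
        (volume.withDensity fun x => ENNReal.ofReal (m x + h x)).map S =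
          (volume.withDensity fun x => ENNReal.ofReal (m x)) ∧
        ∫⁻ x, ENNReal.ofReal (∑ j, (S x j - x j) ^ 2) * ENNReal.ofReal (m x + h x) ≤
          A * ∫⁻ x, ENNReal.ofReal (h x ^ 2 / ω x) := by
  obtain ⟨ε, hε, A, H⟩ :=
    hω.exists_transport_foldl hc hm hcm hmC (List.finRange n ++ List.finRange n)
  refine ⟨ε, hε, A, fun h hh hhε heq => ?_⟩
  obtain ⟨S, hS, hSmap, hScost⟩ := H h hh hhε
  refine ⟨S, hS, ?_, hScost⟩
  rw [hSmap]
  rw [List.foldl_append] at hSmap ⊢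
  set h₁ := (List.finRange n).foldl (fun h i => lineAverage ω i h) h with hh₁
  set g := (List.finRange n).foldl (fun h i => lineAverage ω i h) h₁ with hg
  have hv₁ : ∀ j, ∀ x : Fin n → ℝ, 1 < |x j| → h₁ x = 0 := fun j x hx =>
    foldl_lineAverage_eq_zero _ j (Or.inl (List.mem_finRange j)) hx
  have hv : ∀ j, ∀ x : Fin n → ℝ, 1 < |x j| → g x = 0 := fun j x hx =>
    foldl_lineAverage_eq_zero _ j (Or.inl (List.mem_finRange j)) hx
  have hconst : ∀ x : Fin n → ℝ, (∀ j, |x j| ≤ 1) → g x = g 0 := fun x hx =>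
    hω.foldl_lineAverage_congr _ ∅ hv₁
      (fun x y _ _ hxy => by rw [show x = y from funext fun j => hxy j (Set.notMem_empty j)]) hx
      (by simp) fun j _ hj => absurd (List.mem_finRange j) hj
  have hg0 : ∀ x, g x = 0 ∨ g x = g 0 := fun x => by
    by_cases hx : ∀ j, |x j| ≤ 1
    · exact Or.inr (hconst x hx)
    · push Not at hx
      obtain ⟨j, hj⟩ := hx
      exact Or.inl (hv j x hj)
  have hmass : ∫⁻ x, ENNReal.ofReal (m x + g x) = ∫⁻ x, ENNReal.ofReal (m x) := by
    have := congrArg (fun μ => μ Set.univ) hSmap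
    rw [Measure.map_apply hS MeasurableSet.univ, Set.preimage_univ,
      withDensity_apply _ MeasurableSet.univ, withDensity_apply _ MeasurableSet.univ,
      setLIntegral_univ, setLIntegral_univ] at this
    rw [← this, heq]
  have hgm : Measurable g := by
    have : ∀ (l : List (Fin n)) (h : (Fin n → ℝ) → ℝ), Measurable h →
        Measurable (l.foldl (fun h i => lineAverage ω i h) h) := fun l => by
      induction l with
      | nil => exact fun h hh => hh
      | cons i l ih => exact fun h hh => ih _ (measurable_lineAverage hω.measurable hh i)
    exact this _ _ (this _ _ hh)
  have hae : (fun x => ENNReal.ofReal (m x + g x)) =ᵐ[volume] fun x => ENNReal.ofReal (m x) := by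
    rcases le_total 0 (g 0) with h0 | h0
    · refine (ae_eq_of_ae_le_of_lintegral_le (ae_of_all _ fun x => ?_) hmfin (by fun_prop)
        hmass.le).symm
      refine ENNReal.ofReal_le_ofReal ?_
      rcases hg0 x with h | h <;> rw [h] <;> linarith
    · refine ae_eq_of_ae_le_of_lintegral_le (ae_of_all _ fun x => ?_) (hmass ▸ hmfin) (by fun_prop)
        hmass.ge
      refine ENNReal.ofReal_le_ofReal ?_
      rcases hg0 x with h | h <;> rw [h] <;> linarith
  exact withDensity_congr_ae hae

end Vanish

section EvenWeight

theorem setLIntegral_Ici_eq (F : ℝ → ℝ≥0∞) (t : ℝ) :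
    ∫⁻ s in Set.Ici t, F s = ∫⁻ s in Set.Ici 0, F (t + s) := by
  rw [← lintegral_indicator measurableSet_Ici, ← lintegral_indicator measurableSet_Ici,
    ← lintegral_add_left_eq_self _ t]
  refine lintegral_congr fun s => ?_
  simp [Set.indicator_apply]

theorem setLIntegral_Iic_eq (F : ℝ → ℝ≥0∞) (t : ℝ) :
    ∫⁻ s in Set.Iic t, F s = ∫⁻ s in Set.Ici (-t), F (-s) := by
  rw [← lintegral_indicator measurableSet_Ici, ← lintegral_indicator measurableSet_Iic,
    ← lintegral_neg_eq_self]
  refine lintegral_congr fun s => ?_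
  simp [Set.indicator_apply, neg_le]

variable {w k : ℝ → ℝ} {κ : ℝ}

theorem setLIntegral_Ici_le_of_le_mul (hw0 : ∀ s, 0 < w s)
    (hwk : ∀ t s, 0 ≤ t → 0 ≤ s → w (t + s) ≤ w t * k s) (hκ0 : 0 ≤ κ)
    (hκ : ∫⁻ s in Set.Ici 0, ENNReal.ofReal (k s) ≤ ENNReal.ofReal κ) {t : ℝ} (ht : 0 ≤ t) :
    ∫⁻ s in Set.Ici t, ENNReal.ofReal (w s) ≤ ENNReal.ofReal (κ * w t) := by
  rw [setLIntegral_Ici_eq]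
  calc _ ≤ ∫⁻ s in Set.Ici 0, ENNReal.ofReal (w t) * ENNReal.ofReal (k s) := by
        refine setLIntegral_mono' measurableSet_Ici fun s hs => ?_
        rw [← ENNReal.ofReal_mul (hw0 t).le]
        exact ENNReal.ofReal_le_ofReal (hwk t s ht hs)
    _ = ENNReal.ofReal (w t) * ∫⁻ s in Set.Ici 0, ENNReal.ofReal (k s) :=
        lintegral_const_mul' _ _ ENNReal.ofReal_ne_top
    _ ≤ ENNReal.ofReal (w t) * ENNReal.ofReal κ := by gcongr
    _ = _ := by rw [mul_comm, ENNReal.ofReal_mul hκ0]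

theorem setLIntegral_Iic_le_of_le_mul (hw0 : ∀ s, 0 < w s) (heven : ∀ s, w (-s) = w s)
    (hwk : ∀ t s, 0 ≤ t → 0 ≤ s → w (t + s) ≤ w t * k s) (hκ0 : 0 ≤ κ)
    (hκ : ∫⁻ s in Set.Ici 0, ENNReal.ofReal (k s) ≤ ENNReal.ofReal κ) {t : ℝ} (ht : t ≤ 0) :
    ∫⁻ s in Set.Iic t, ENNReal.ofReal (w s) ≤ ENNReal.ofReal (κ * w t) := by
  rw [setLIntegral_Iic_eq]
  simp_rw [heven]
  rw [← heven t]
  exact setLIntegral_Ici_le_of_le_mul hw0 hwk hκ0 hκ (neg_nonneg.2 ht)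

theorem lintegral_le_of_le_mul {L : ℝ} (hw0 : ∀ s, 0 < w s) (heven : ∀ s, w (-s) = w s)
    (hwk : ∀ t s, 0 ≤ t → 0 ≤ s → w (t + s) ≤ w t * k s) (hκ0 : 0 ≤ κ)
    (hκ : ∫⁻ s in Set.Ici 0, ENNReal.ofReal (k s) ≤ ENNReal.ofReal κ) (hL : 0 ≤ L)
    (hkL : ∀ s, 0 ≤ s → k s ≤ L) :
    ∫⁻ s, ENNReal.ofReal (w s) ≤
      ENNReal.ofReal (1 + 2 * κ * L) * ∫⁻ s in Set.Icc (-1) 1, ENNReal.ofReal (w s) := by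
  have h1 : ENNReal.ofReal (w 1) ≤
      ENNReal.ofReal L * ∫⁻ s in Set.Icc (-1) 1, ENNReal.ofReal (w s) := by
    calc ENNReal.ofReal (w 1) = ∫⁻ s in Set.Icc (0 : ℝ) 1, ENNReal.ofReal (w 1) := by
          rw [setLIntegral_const, Real.volume_Icc]; simp
      _ ≤ ∫⁻ s in Set.Icc (0 : ℝ) 1, ENNReal.ofReal L * ENNReal.ofReal (w s) := by
          refine setLIntegral_mono' measurableSet_Icc fun s hs => ?_
          rw [← ENNReal.ofReal_mul hL]
          refine ENNReal.ofReal_le_ofReal ?_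
          have h := hwk s (1 - s) hs.1 (sub_nonneg.2 hs.2)
          rw [add_sub_cancel] at h
          refine h.trans ?_
          rw [mul_comm]
          exact mul_le_mul_of_nonneg_right (hkL _ (sub_nonneg.2 hs.2)) (hw0 s).le
      _ = ENNReal.ofReal L * ∫⁻ s in Set.Icc (0 : ℝ) 1, ENNReal.ofReal (w s) :=
          lintegral_const_mul' _ _ ENNReal.ofReal_ne_top
      _ ≤ _ := by
          gcongr
          norm_num
  have h2 := setLIntegral_Ici_le_of_le_mul hw0 hwk hκ0 hκ zero_le_one
  have h3 := setLIntegral_Iic_le_of_le_mul (t := -1) hw0 heven hwk hκ0 hκ (by norm_num)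
  rw [heven] at h3
  calc ∫⁻ s, ENNReal.ofReal (w s)
      = ∫⁻ s in Set.Icc (-1) 1 ∪ (Set.Ici 1 ∪ Set.Iic (-1)), ENNReal.ofReal (w s) := by
        rw [← setLIntegral_univ]
        congr 2
        refine (Set.eq_univ_of_forall fun s => ?_).symm
        rcases le_total s (-1) with h | h
        · exact Or.inr (Or.inr h)
        · rcases le_total s 1 with h' | h'
          · exact Or.inl ⟨h, h'⟩
          · exact Or.inr (Or.inl h')
    _ ≤ (∫⁻ s in Set.Icc (-1) 1, ENNReal.ofReal (w s)) +
        (ENNReal.ofReal (κ * w 1) + ENNReal.ofReal (κ * w 1)) :=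
        (lintegral_union_le _ _ _).trans (add_le_add le_rfl
          ((lintegral_union_le _ _ _).trans (add_le_add h2 h3)))
    _ ≤ (∫⁻ s in Set.Icc (-1) 1, ENNReal.ofReal (w s)) + 2 * (ENNReal.ofReal κ *
        (ENNReal.ofReal L * ∫⁻ s in Set.Icc (-1) 1, ENNReal.ofReal (w s))) := by
        rw [← two_mul, ENNReal.ofReal_mul hκ0]
        gcongr
    _ = _ := by
        rw [ENNReal.ofReal_add (by norm_num) (by positivity), ENNReal.ofReal_mul (by positivity),
          ENNReal.ofReal_mul (by norm_num), ENNReal.ofReal_one, ENNReal.ofReal_ofNat]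
        ring

end EvenWeight

section CubeWeight

variable {n : ℕ} {a θ : ℝ}

/-- The weight `exp (-a |x|^θ)`, replaced by `1` on the unit cube. -/
noncomputable def cubeWeight (a θ : ℝ) (x : Fin n → ℝ) : ℝ :=
  if ∀ j, |x j| ≤ 1 then 1 else Real.exp (-(a * (∑ j, x j ^ 2) ^ (θ / 2)))

theorem exp_le_cubeWeight (ha : 0 ≤ a) (x : Fin n → ℝ) :
    Real.exp (-(a * (∑ j, x j ^ 2) ^ (θ / 2))) ≤ cubeWeight a θ x := by
  rw [cubeWeight]
  split_ifs
  · rw [Real.exp_le_one_iff, neg_nonpos]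
    positivity
  · exact le_rfl

theorem cubeWeight_le_one (ha : 0 ≤ a) (x : Fin n → ℝ) : cubeWeight a θ x ≤ 1 := by
  rw [cubeWeight]
  split_ifs
  · exact le_rfl
  · rw [Real.exp_le_one_iff, neg_nonpos]
    positivity

theorem cubeWeight_pos (x : Fin n → ℝ) : 0 < cubeWeight a θ x := by
  rw [cubeWeight]
  split_ifs
  · exact one_pos
  · positivity

theorem cubeWeight_le (ha : 0 ≤ a) (hθ : 0 ≤ θ) (x : Fin n → ℝ) :
    cubeWeight a θ x ≤ Real.exp (a * (n : ℝ) ^ (θ / 2)) *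
      Real.exp (-(a * (∑ j, x j ^ 2) ^ (θ / 2))) := by
  rw [cubeWeight, ← Real.exp_add]
  split_ifs with h
  · rw [Real.one_le_exp_iff, ← sub_eq_add_neg, sub_nonneg]
    gcongr
    calc ∑ j, x j ^ 2 ≤ ∑ _j : Fin n, (1 : ℝ) :=
          Finset.sum_le_sum fun j _ => (sq_le_one_iff_abs_le_one _).2 (h j)
      _ = n := by simp
  · rw [Real.exp_le_exp]
    have : 0 ≤ a * (n : ℝ) ^ (θ / 2) := by positivity
    linarith

theorem measurable_cubeWeight : Measurable (cubeWeight (n := n) a θ) := by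
  refine Measurable.ite ?_ measurable_const (by fun_prop)
  have : {x : Fin n → ℝ | ∀ j, |x j| ≤ 1} = ⋂ j, {x | |x j| ≤ 1} := by ext; simp
  rw [this]
  exact MeasurableSet.iInter fun j => measurableSet_le (by fun_prop) (by fun_prop)

theorem sum_sq_update (i : Fin n) (x : Fin n → ℝ) (s : ℝ) :
    ∑ j, Function.update x i s j ^ 2 = ∑ j ∈ Finset.univ.erase i, x j ^ 2 + s ^ 2 := by
  rw [← Finset.sum_erase_add _ _ (Finset.mem_univ i), Function.update_self]
  congr 1
  exact Finset.sum_congr rfl fun j hj => by rw [Function.update_of_ne (Finset.ne_of_mem_erase hj)]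

theorem forall_abs_update_le (i : Fin n) (x : Fin n → ℝ) (s : ℝ) :
    (∀ j, |Function.update x i s j| ≤ 1) ↔ (∀ j, j ≠ i → |x j| ≤ 1) ∧ |s| ≤ 1 := by
  constructor
  · intro h
    exact ⟨fun j hj => by simpa [hj] using h j, by simpa using h i⟩
  · rintro ⟨h, hs⟩ j
    rcases eq_or_ne j i with rfl | hj
    · simpa using hs
    · simpa [hj] using h j hj

theorem cubeWeight_update_neg (i : Fin n) (x : Fin n → ℝ) (s : ℝ) :
    cubeWeight a θ (Function.update x i (-s)) = cubeWeight a θ (Function.update x i s) := by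
  simp only [cubeWeight, forall_abs_update_le, sum_sq_update, abs_neg, neg_sq]

theorem cubeWeight_update_add_le (ha : 0 ≤ a) (hθ : 2 ≤ θ) (i : Fin n) (x : Fin n → ℝ) {t s : ℝ}
    (ht : 0 ≤ t) (hs : 0 ≤ s) :
    cubeWeight a θ (Function.update x i (t + s)) ≤ cubeWeight a θ (Function.update x i t) *
      (Real.exp a * Real.exp (-a * s ^ θ)) := by
  simp only [cubeWeight, forall_abs_update_le, sum_sq_update]
  set r := ∑ j ∈ Finset.univ.erase i, x j ^ 2
  have hr : 0 ≤ r := Finset.sum_nonneg fun j _ => sq_nonneg _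
  have hs2 : (s ^ 2) ^ (θ / 2) = s ^ θ := by
    rw [← Real.rpow_natCast_mul hs]
    congr 1
    push_cast
    ring
  have hadd : (r + t ^ 2) ^ (θ / 2) + s ^ θ ≤ (r + (t + s) ^ 2) ^ (θ / 2) := by
    rw [← hs2]
    refine (Real.add_rpow_le_rpow_add (by positivity) (by positivity) (by linarith)).trans ?_
    refine Real.rpow_le_rpow (by positivity) ?_ (by linarith)
    nlinarith [mul_nonneg ht hs]
  have hsθ : 0 ≤ s ^ θ := by positivity
  by_cases h1 : (∀ j, j ≠ i → |x j| ≤ 1) ∧ |t + s| ≤ 1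
  · have h2 : |t + s| ≤ 1 := h1.2
    rw [abs_of_nonneg (by positivity)] at h2
    rw [if_pos h1, if_pos ⟨h1.1, by rw [abs_of_nonneg ht]; linarith⟩, one_mul, ← Real.exp_add,
      Real.one_le_exp_iff]
    have := Real.rpow_le_one hs (by linarith) (by linarith : 0 ≤ θ)
    nlinarith
  · rw [if_neg h1]
    split_ifs
    · rw [one_mul, ← Real.exp_add, Real.exp_le_exp]
      have : 0 ≤ (r + t ^ 2) ^ (θ / 2) := by positivity
      nlinarith
    · rw [← Real.exp_add, ← Real.exp_add, Real.exp_le_exp]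
      nlinarith

theorem isLineWeight_cubeWeight (ha : 0 < a) (hθ : 2 ≤ θ) :
    ∃ K, IsLineWeight (cubeWeight (n := n) a θ) K 1 := by
  set k : ℝ → ℝ := fun s => Real.exp a * Real.exp (-a * s ^ θ) with hk
  set κ := (∫⁻ s in Set.Ici 0, ENNReal.ofReal (k s)).toReal with hκ
  have hkfin : ∫⁻ s in Set.Ici 0, ENNReal.ofReal (k s) ≠ ∞ := by
    have h := integrableOn_rpow_mul_exp_neg_mul_rpow (s := 0) (p := θ) (b := a) (by norm_num)
      (by linarith) ha
    simp only [Real.rpow_zero, one_mul] at h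
    rw [setLIntegral_congr Ioi_ae_eq_Ici.symm]
    exact (h.const_mul (Real.exp a)).lintegral_lt_top.ne
  have hκ0 : 0 ≤ κ := ENNReal.toReal_nonneg
  have hκle : ∫⁻ s in Set.Ici 0, ENNReal.ofReal (k s) ≤ ENNReal.ofReal κ := by
    rw [hκ, ENNReal.ofReal_toReal hkfin]
  have hL : 1 ≤ Real.exp a := Real.one_le_exp ha.le
  have hle : κ ≤ 1 + 2 * κ * Real.exp a := by nlinarith
  refine ⟨1 + 2 * κ * Real.exp a, measurable_cubeWeight, cubeWeight_pos, cubeWeight_le_one ha.le,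
    fun x hx => if_pos hx, ?_, fun i x t => ?_, fun i x => ?_⟩
  · have : 0 ≤ 2 * κ * Real.exp a := by positivity
    linarith
  · have hx := cubeWeight_pos (a := a) (θ := θ) (Function.update x i t)
    refine le_trans ?_ (ENNReal.ofReal_le_ofReal (mul_le_mul_of_nonneg_right hle hx.le))
    rcases le_total 0 t with ht | ht
    · exact (min_le_right _ _).trans (setLIntegral_Ici_le_of_le_mul (fun s => cubeWeight_pos _)
        (fun t s ht hs => cubeWeight_update_add_le ha.le hθ i x ht hs) hκ0 hκle ht)
    · exact (min_le_left _ _).trans (setLIntegral_Iic_le_of_le_mul (fun s => cubeWeight_pos _)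
        (cubeWeight_update_neg i x)
        (fun t s ht hs => cubeWeight_update_add_le ha.le hθ i x ht hs) hκ0 hκle ht)
  · refine lintegral_le_of_le_mul (fun s => cubeWeight_pos _) (cubeWeight_update_neg i x)
      (fun t s ht hs => cubeWeight_update_add_le ha.le hθ i x ht hs) hκ0 hκle (by positivity)
      fun s hs => ?_
    refine mul_le_of_le_one_right (by positivity) (Real.exp_le_one_iff.2 ?_)
    have : 0 ≤ s ^ θ := by positivity
    nlinarith

end CubeWeight

theorem exists_transport_density {n : ℕ} {a θ c C : ℝ} (ha : 0 < a) (hθ : 2 ≤ θ) (hc : 0 < c)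
    {m : EuclideanSpace ℝ (Fin n) → ℝ} (hm : Measurable m)
    (hcm : ∀ x, c * Real.exp (-(a * ‖x‖ ^ θ)) ≤ m x)
    (hmC : ∀ x, m x ≤ C * Real.exp (-(a * ‖x‖ ^ θ)))
    {μ : Measure (EuclideanSpace ℝ (Fin n))} (hμ : μ = volume.withDensity fun x => ENNReal.ofReal (m x))
    (hμfin : μ Set.univ ≠ ∞) :
    ∃ ε : ℝ, 0 < ε ∧ ∃ A : ℝ≥0, ∀ u : EuclideanSpace ℝ (Fin n) → ℝ, Measurable u →
      (∀ x, |u x| ≤ ε) → ∫⁻ x, ENNReal.ofReal (1 + u x) ∂μ = μ Set.univ →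
      ∃ S : EuclideanSpace ℝ (Fin n) → EuclideanSpace ℝ (Fin n), Measurable S ∧
        (μ.withDensity fun x => ENNReal.ofReal (1 + u x)).map S = μ ∧
        ∫⁻ x, ENNReal.ofReal (‖S x - x‖ ^ 2) * ENNReal.ofReal (1 + u x) ∂μ ≤
          A * ∫⁻ x, ENNReal.ofReal (u x ^ 2) ∂μ := by
  obtain ⟨K, hω⟩ := isLineWeight_cubeWeight (n := n) ha hθ
  set ω := cubeWeight (n := n) a θ
  have hC : 0 < C := by
    have := (hcm 0).trans (hmC 0)
    exact hc.trans_le (le_of_mul_le_mul_right this (Real.exp_pos _))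
  have hvol := PiLp.volume_preserving_toLp (Fin n)
  have hnorm : ∀ x : Fin n → ℝ, ‖WithLp.toLp 2 x‖ ^ θ = (∑ j, x j ^ 2) ^ (θ / 2) := fun x => by
    rw [← EuclideanSpace.real_norm_sq_eq, ← Real.rpow_natCast_mul (norm_nonneg _)]
    congr 1
    push_cast
    ring
  have hm0 : ∀ x, 0 < m x := fun x => (by positivity : (0 : ℝ) < _).trans_le (hcm x)
  set m' : (Fin n → ℝ) → ℝ := fun x => m (WithLp.toLp 2 x) with hm'def
  have htoLp : Measurable (WithLp.toLp 2 : (Fin n → ℝ) → EuclideanSpace ℝ (Fin n)) := by fun_prop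
  have hofLp : Measurable (WithLp.ofLp : EuclideanSpace ℝ (Fin n) → Fin n → ℝ) := by fun_prop
  have hm' : Measurable m' := hm.comp htoLp
  have hm'C : ∀ x, m' x ≤ C * ω x := fun x => by
    refine (hmC _).trans (mul_le_mul_of_nonneg_left ?_ hC.le)
    rw [hnorm]
    exact exp_le_cubeWeight ha.le x
  have hcm' : ∀ x, c / Real.exp (a * (n : ℝ) ^ (θ / 2)) * ω x ≤ m' x := fun x => by
    refine le_trans ?_ (hcm _)
    rw [hnorm, div_mul_eq_mul_div, div_le_iff₀ (Real.exp_pos _), mul_assoc, mul_comm (Real.exp _)]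
    gcongr
    exact cubeWeight_le ha.le (by linarith) x
  have hlint : ∀ F : EuclideanSpace ℝ (Fin n) → ℝ≥0∞, Measurable F →
      ∫⁻ x, F x ∂μ = ∫⁻ x : Fin n → ℝ, F (WithLp.toLp 2 x) * ENNReal.ofReal (m' x) := fun F hF => by
    rw [hμ, lintegral_withDensity_eq_lintegral_mul _ hm.ennreal_ofReal hF,
      ← hvol.lintegral_comp (hm.ennreal_ofReal.mul hF)]
    refine lintegral_congr fun x => ?_
    rw [Pi.mul_apply, mul_comm]
  have hmass : μ Set.univ = ∫⁻ x, ENNReal.ofReal (m' x) := by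
    rw [← lintegral_one, hlint _ measurable_const]
    simp
  obtain ⟨ε, hε, A, H⟩ := hω.exists_transport (by positivity) hm' hcm' hm'C (hmass ▸ hμfin)
  refine ⟨min (ε / C) 1, by positivity, A * C.toNNReal, fun u hu huε hmassu => ?_⟩
  have hu1 : ∀ x, 0 ≤ 1 + u x := fun x => by
    linarith [(abs_le.1 ((huε x).trans (min_le_right _ _))).1]
  have hu' : Measurable fun x : Fin n → ℝ => u (WithLp.toLp 2 x) := hu.comp htoLp
  have hdens : ∀ x : Fin n → ℝ, ENNReal.ofReal (m' x + u (WithLp.toLp 2 x) * m' x) =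
      ENNReal.ofReal (1 + u (WithLp.toLp 2 x)) * ENNReal.ofReal (m' x) := fun x => by
    rw [← ENNReal.ofReal_mul (hu1 _)]
    congr 1
    ring
  obtain ⟨S, hS, hSmap, hScost⟩ := H (fun x => u (WithLp.toLp 2 x) * m' x) (hu'.mul hm')
    (fun x => by
      rw [abs_mul, abs_of_pos (hm0 _ : 0 < m' x)]
      calc |u (WithLp.toLp 2 x)| * m' x ≤ ε / C * (C * ω x) :=
            mul_le_mul ((huε _).trans (min_le_left _ _)) (hm'C x) (hm0 _).le (by positivity)
        _ = ε * ω x := by field_simp)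
    (by
      rw [← hmass, ← hmassu, hlint _ (by fun_prop)]
      exact lintegral_congr hdens)
  have hSE : Measurable fun x : EuclideanSpace ℝ (Fin n) => WithLp.toLp 2 (S (WithLp.ofLp x)) :=
    htoLp.comp (hS.comp hofLp)
  refine ⟨fun x => WithLp.toLp 2 (S (WithLp.ofLp x)), hSE, ?_, ?_⟩
  · refine Measure.ext_of_lintegral _ fun G hG => ?_
    have hG' : Measurable fun x : Fin n → ℝ => G (WithLp.toLp 2 x) := hG.comp htoLp
    have hGS : Measurable fun x => G (WithLp.toLp 2 (S x)) := hG'.comp hS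
    have hGSE : Measurable fun x : EuclideanSpace ℝ (Fin n) =>
      G (WithLp.toLp 2 (S (WithLp.ofLp x))) := hG.comp hSE
    rw [lintegral_map hG hSE, lintegral_withDensity_eq_lintegral_mul _
      (hu.const_add 1).ennreal_ofReal hGSE, hlint _ (by fun_prop), hlint _ hG]
    have hmu : Measurable fun x => m' x + u (WithLp.toLp 2 x) * m' x := hm'.add (hu'.mul hm')
    have e1 := lintegral_map (μ := volume.withDensity fun x =>
      ENNReal.ofReal (m' x + u (WithLp.toLp 2 x) * m' x)) hG' hS
    rw [hSmap, lintegral_withDensity_eq_lintegral_mul _ hm'.ennreal_ofReal hG',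
      lintegral_withDensity_eq_lintegral_mul _ hmu.ennreal_ofReal hGS] at e1
    simp only [Pi.mul_apply, hdens] at e1 ⊢
    calc _ = ∫⁻ x, ENNReal.ofReal (1 + u (WithLp.toLp 2 x)) * ENNReal.ofReal (m' x) *
          G (WithLp.toLp 2 (S x)) := lintegral_congr fun x => by ring
      _ = _ := e1.symm
      _ = _ := lintegral_congr fun x => mul_comm _ _
  · rw [hlint _ (by fun_prop), hlint _ (by fun_prop)]
    calc _ = ∫⁻ x, ENNReal.ofReal (∑ j, (S x j - x j) ^ 2) *
          ENNReal.ofReal (m' x + u (WithLp.toLp 2 x) * m' x) := by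
          refine lintegral_congr fun x => ?_
          rw [hdens, mul_assoc, EuclideanSpace.real_norm_sq_eq]
          rfl
      _ ≤ _ := hScost
      _ ≤ A * ∫⁻ x, ENNReal.ofReal C * (ENNReal.ofReal (u (WithLp.toLp 2 x) ^ 2) *
            ENNReal.ofReal (m' x)) := by
          gcongr with x
          have hx := hω.pos x
          have hmx : 0 < m' x := hm0 _
          rw [← ENNReal.ofReal_mul (by positivity), ← ENNReal.ofReal_mul (by positivity)]
          refine ENNReal.ofReal_le_ofReal ?_
          rw [div_le_iff₀ hx]
          calc (u (WithLp.toLp 2 x) * m' x) ^ 2 = u (WithLp.toLp 2 x) ^ 2 * m' x * m' x := by ring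
            _ ≤ u (WithLp.toLp 2 x) ^ 2 * m' x * (C * ω x) := by gcongr; exact hm'C x
            _ = _ := by ring
      _ = _ := by
          rw [lintegral_const_mul' _ _ ENNReal.ofReal_ne_top, ← mul_assoc]
          simp [ENNReal.ofReal]

/-- Keep the common part `η`, send the excess `σ` to `τ` independently, then apply `S`. -/
theorem exists_isCoupling_add {n : ℕ} {η σ τ : Measure (EuclideanSpace ℝ (Fin n))}
    [IsFiniteMeasure η] [IsFiniteMeasure σ] [IsFiniteMeasure τ]
    (hστ : σ Set.univ = τ Set.univ)
    {S : EuclideanSpace ℝ (Fin n) → EuclideanSpace ℝ (Fin n)} (hS : Measurable S) :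
    ∃ π, IsCoupling π (η + σ) ((η + τ).map S) ∧
      ∫⁻ q, edist q.1 q.2 ^ (2 : ℝ) ∂π ≤ 2 * ∫⁻ x, edist x (S x) ^ (2 : ℝ) ∂(η + τ) +
        4 * (∫⁻ x, ‖x‖ₑ ^ (2 : ℝ) ∂σ + ∫⁻ x, ‖x‖ₑ ^ (2 : ℝ) ∂τ) := by
  have hgraph : Measurable fun x : EuclideanSpace ℝ (Fin n) => (x, S x) := by fun_prop
  have hpS : Measurable fun q : EuclideanSpace ℝ (Fin n) × EuclideanSpace ℝ (Fin n) =>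
    (q.1, S q.2) := by fun_prop
  have hcost : Measurable fun q : EuclideanSpace ℝ (Fin n) × EuclideanSpace ℝ (Fin n) =>
    edist q.1 q.2 ^ (2 : ℝ) := by fun_prop
  by_cases hσ : σ Set.univ = 0
  · have hτ : τ = 0 := Measure.measure_univ_eq_zero.1 (hστ ▸ hσ)
    have hσ := Measure.measure_univ_eq_zero.1 hσ
    refine ⟨η.map fun x => (x, S x), ⟨?_, ?_⟩, ?_⟩
    · rw [Measure.map_map measurable_fst hgraph, hσ, add_zero]
      exact Measure.map_id
    · rw [Measure.map_map measurable_snd hgraph, hτ, add_zero]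
      rfl
    · rw [lintegral_map hcost hgraph, hτ, add_zero, two_mul, add_assoc]
      exact le_self_add
  have hσtop : σ Set.univ ≠ ∞ := measure_ne_top _ _
  refine ⟨η.map (fun x => (x, S x)) + (σ Set.univ)⁻¹ • (σ.prod τ).map (fun q => (q.1, S q.2)),
    ⟨?_, ?_⟩, ?_⟩
  · rw [Measure.map_add _ _ measurable_fst, Measure.map_smul, Measure.map_map measurable_fst hgraph,
      Measure.map_map measurable_fst hpS]
    have : (σ.prod τ).map Prod.fst = σ Set.univ • σ := by rw [Measure.map_fst_prod, hστ]
    change η.map id + (σ Set.univ)⁻¹ • (σ.prod τ).map Prod.fst = _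
    rw [this, smul_smul, ENNReal.inv_mul_cancel hσ hσtop, one_smul, Measure.map_id]
  · rw [Measure.map_add _ _ measurable_snd, Measure.map_smul, Measure.map_map measurable_snd hgraph,
      Measure.map_map measurable_snd hpS, Measure.map_add _ _ hS]
    change η.map S + (σ Set.univ)⁻¹ • (σ.prod τ).map (S ∘ Prod.snd) = _
    rw [← Measure.map_map hS measurable_snd, Measure.map_snd_prod, Measure.map_smul, smul_smul,
      ENNReal.inv_mul_cancel hσ hσtop, one_smul]
  · have key : ∫⁻ q, edist q.1 (S q.2) ^ (2 : ℝ) ∂(σ.prod τ) ≤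
        σ Set.univ * (4 * (∫⁻ x, ‖x‖ₑ ^ (2 : ℝ) ∂σ + ∫⁻ x, ‖x‖ₑ ^ (2 : ℝ) ∂τ) +
          2 * ∫⁻ x, edist x (S x) ^ (2 : ℝ) ∂τ) := by
      calc _ ≤ ∫⁻ q, (4 * ‖q.1‖ₑ ^ (2 : ℝ) + (4 * ‖q.2‖ₑ ^ (2 : ℝ) +
              2 * edist q.2 (S q.2) ^ (2 : ℝ))) ∂(σ.prod τ) := by
            gcongr with q
            simp only [ENNReal.rpow_two]
            calc edist q.1 (S q.2) ^ 2 ≤ (edist q.1 q.2 + edist q.2 (S q.2)) ^ 2 := by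
                  gcongr; exact edist_triangle _ _ _
              _ ≤ 2 * (edist q.1 q.2 ^ 2 + edist q.2 (S q.2) ^ 2) := ENNReal_add_sq_le _ _
              _ ≤ 2 * ((‖q.1‖ₑ + ‖q.2‖ₑ) ^ 2 + edist q.2 (S q.2) ^ 2) := by
                  gcongr
                  rw [edist_eq_enorm_sub]
                  exact enorm_sub_le
              _ ≤ 2 * (2 * (‖q.1‖ₑ ^ 2 + ‖q.2‖ₑ ^ 2) + edist q.2 (S q.2) ^ 2) := by
                  gcongr
                  exact ENNReal_add_sq_le _ _
              _ = _ := by ring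
        _ = 4 * (σ Set.univ * ∫⁻ x, ‖x‖ₑ ^ (2 : ℝ) ∂σ) + (4 * (σ Set.univ *
              ∫⁻ x, ‖x‖ₑ ^ (2 : ℝ) ∂τ) + 2 * (σ Set.univ *
              ∫⁻ x, edist x (S x) ^ (2 : ℝ) ∂τ)) := by
            have h1 : Measurable fun x : EuclideanSpace ℝ (Fin n) => ‖x‖ₑ ^ (2 : ℝ) := by fun_prop
            have h2 : Measurable fun x : EuclideanSpace ℝ (Fin n) => edist x (S x) ^ (2 : ℝ) := by
              fun_prop
            rw [lintegral_add_left (by fun_prop), lintegral_add_left (by fun_prop),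
              lintegral_const_mul _ (by fun_prop), lintegral_const_mul _ (by fun_prop),
              lintegral_const_mul _ (by fun_prop)]
            rw [lintegral_prod _ (by fun_prop), lintegral_prod _ (by fun_prop),
              lintegral_prod _ (by fun_prop)]
            simp only [lintegral_const]
            rw [lintegral_mul_const _ h1, ← hστ]
            ring
        _ = _ := by ring
    rw [lintegral_add_measure, lintegral_smul_measure, lintegral_map hcost hgraph,
      lintegral_map hcost hpS, lintegral_add_measure]
    calc _ ≤ ∫⁻ x, edist x (S x) ^ (2 : ℝ) ∂η + (σ Set.univ)⁻¹ * (σ Set.univ *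
          (4 * (∫⁻ x, ‖x‖ₑ ^ (2 : ℝ) ∂σ + ∫⁻ x, ‖x‖ₑ ^ (2 : ℝ) ∂τ) +
          2 * ∫⁻ x, edist x (S x) ^ (2 : ℝ) ∂τ)) := by
          rw [smul_eq_mul]
          gcongr
      _ ≤ 2 * ∫⁻ x, edist x (S x) ^ (2 : ℝ) ∂η + (4 * (∫⁻ x, ‖x‖ₑ ^ (2 : ℝ) ∂σ +
            ∫⁻ x, ‖x‖ₑ ^ (2 : ℝ) ∂τ) + 2 * ∫⁻ x, edist x (S x) ^ (2 : ℝ) ∂τ) := by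
          rw [← mul_assoc, ENNReal.inv_mul_cancel hσ hσtop, one_mul]
          gcongr
          exact le_mul_of_one_le_left' one_le_two
      _ = _ := by ring

theorem exists_isCoupling_withDensity {n : ℕ} {μ : Measure (EuclideanSpace ℝ (Fin n))}
    {p q : EuclideanSpace ℝ (Fin n) → ℝ≥0∞} (hp : Measurable p) (hq : Measurable q)
    (hpq : ∫⁻ x, p x ∂μ = ∫⁻ x, q x ∂μ) (hfin : ∫⁻ x, p x ∂μ ≠ ∞)
    {S : EuclideanSpace ℝ (Fin n) → EuclideanSpace ℝ (Fin n)} (hS : Measurable S) :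
    ∃ π, IsCoupling π (μ.withDensity p) ((μ.withDensity q).map S) ∧
      ∫⁻ z, edist z.1 z.2 ^ (2 : ℝ) ∂π ≤ 2 * ∫⁻ x, edist x (S x) ^ (2 : ℝ) * q x ∂μ +
        4 * ∫⁻ x, ‖x‖ₑ ^ (2 : ℝ) * ((p x - q x) + (q x - p x)) ∂μ := by
  have hmin : Measurable fun x => min (p x) (q x) := hp.min hq
  have hd1 : Measurable fun x => p x - q x := hp.sub hq
  have hd2 : Measurable fun x => q x - p x := hq.sub hp
  have hfinp : ∀ r : EuclideanSpace ℝ (Fin n) → ℝ≥0∞, (∀ x, r x ≤ p x) →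
      IsFiniteMeasure (μ.withDensity r) := fun r hr =>
    isFiniteMeasure_withDensity ((lintegral_mono hr).trans_lt hfin.lt_top).ne
  have hfinq : IsFiniteMeasure (μ.withDensity fun x => q x - p x) :=
    isFiniteMeasure_withDensity
      ((lintegral_mono fun x => tsub_le_self).trans_lt (hpq ▸ hfin.lt_top)).ne
  have hfin1 := hfinp (fun x => min (p x) (q x)) fun x => min_le_left _ _
  have hfin2 := hfinp (fun x => p x - q x) fun x => tsub_le_self
  have ep : (μ.withDensity fun x => min (p x) (q x)) + (μ.withDensity fun x => p x - q x) =
      μ.withDensity p := by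
    rw [← withDensity_add_left hmin]
    congr 1
    funext x
    rcases le_total (p x) (q x) with h | h <;> simp [h, add_tsub_cancel_of_le, tsub_eq_zero_of_le]
  have eq : (μ.withDensity fun x => min (p x) (q x)) + (μ.withDensity fun x => q x - p x) =
      μ.withDensity q := by
    rw [← withDensity_add_left hmin]
    congr 1
    funext x
    rcases le_total (p x) (q x) with h | h <;> simp [h, add_tsub_cancel_of_le, tsub_eq_zero_of_le]
  have hmass : (μ.withDensity fun x => p x - q x) Set.univ =
      (μ.withDensity fun x => q x - p x) Set.univ := by
    have h1 := congrArg (fun m => m Set.univ) ep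
    have h2 := congrArg (fun m => m Set.univ) eq
    simp only [Measure.add_apply, withDensity_apply _ MeasurableSet.univ,
      Measure.restrict_univ] at h1 h2 ⊢
    refine (ENNReal.add_right_inj ?_).1 (h1.trans (hpq.trans h2.symm))
    exact ((lintegral_mono fun x => min_le_left _ _).trans_lt hfin.lt_top).ne
  obtain ⟨π, hπ, hcost⟩ := exists_isCoupling_add (η := μ.withDensity fun x => min (p x) (q x))
    hmass hS
  rw [ep, eq] at hπ
  refine ⟨π, hπ, hcost.trans_eq ?_⟩
  rw [eq]
  have h1 : Measurable fun x : EuclideanSpace ℝ (Fin n) => ‖x‖ₑ ^ (2 : ℝ) := by fun_prop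
  have h2 : Measurable fun x : EuclideanSpace ℝ (Fin n) => edist x (S x) ^ (2 : ℝ) := by
    fun_prop
  rw [lintegral_withDensity_eq_lintegral_mul _ hq h2,
    lintegral_withDensity_eq_lintegral_mul _ hd1 h1,
    lintegral_withDensity_eq_lintegral_mul _ hd2 h1, ← lintegral_add_left (hd1.mul h1)]
  congr 2
  · exact lintegral_congr fun x => mul_comm _ _
  · refine lintegral_congr fun x => ?_
    simp only [Pi.mul_apply]
    ring

theorem abs_sq_sub_clamp_le {e g : ℝ} (he : 0 < e) (he1 : e ≤ 1) (hg : 0 ≤ g) :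
    |g ^ 2 - 1 - max (-e) (min (g ^ 2 - 1) e)| ≤ 9 / e * (g - 1) ^ 2 := by
  by_cases h : |g ^ 2 - 1| ≤ e
  · rw [abs_le] at h
    rw [min_eq_left h.2, max_eq_right h.1, sub_self, abs_zero]
    positivity
  push Not at h
  have h1 : |g ^ 2 - 1 - max (-e) (min (g ^ 2 - 1) e)| ≤ |g ^ 2 - 1| := by
    rcases lt_abs.1 h with h | h
    · rw [min_eq_right h.le, max_eq_right (by linarith), abs_of_pos (by linarith),
        abs_of_pos (by linarith)]
      linarith
    · rw [min_eq_left (by linarith), max_eq_left (by linarith), abs_of_neg (by linarith),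
        abs_of_neg (by linarith)]
      linarith
  have h2 : |g ^ 2 - 1| = |g - 1| * (g + 1) := by
    rw [show g ^ 2 - 1 = (g - 1) * (g + 1) by ring, abs_mul, abs_of_nonneg (by linarith : 0 ≤ g + 1)]
  have h3 : g + 1 ≤ 9 / e * |g - 1| := by
    rw [div_mul_eq_mul_div, le_div_iff₀ he]
    rcases le_total g 2 with hg2 | hg2
    · rw [h2] at h
      have : |g - 1| * (g + 1) ≤ |g - 1| * 3 := by gcongr; linarith
      nlinarith
    · rw [abs_of_nonneg (by linarith)]
      nlinarith
  calc _ ≤ |g - 1| * (g + 1) := h1.trans_eq h2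
    _ ≤ |g - 1| * (9 / e * |g - 1|) := by gcongr
    _ = 9 / e * |g - 1| ^ 2 := by ring
    _ = _ := by rw [sq_abs]

theorem clamp_sq_le {e g : ℝ} (he : 0 < e) (he1 : e ≤ 1) (hg : 0 ≤ g) :
    max (-e) (min (g ^ 2 - 1) e) ^ 2 ≤ 9 * (g - 1) ^ 2 := by
  rw [show 9 * (g - 1) ^ 2 = (3 * (g - 1)) ^ 2 by ring]
  refine sq_le_sq.2 ?_
  rw [abs_mul, abs_of_pos (by norm_num : (0 : ℝ) < 3)]
  rcases le_total g 2 with hg2 | hg2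
  · rcases le_total 1 g with h | h
    · have : 0 ≤ g ^ 2 - 1 := by nlinarith
      rw [max_eq_right (by linarith [le_min this he.le]), abs_of_nonneg (le_min this he.le),
        abs_of_nonneg (by linarith)]
      exact (min_le_left _ _).trans (by nlinarith)
    · have : g ^ 2 - 1 ≤ 0 := by nlinarith
      rw [min_eq_left (by linarith), abs_of_nonpos (max_le (by linarith) this),
        abs_of_nonpos (by linarith)]
      have := le_max_right (-e) (g ^ 2 - 1)
      nlinarith
  · have : |max (-e) (min (g ^ 2 - 1) e)| ≤ e :=
      abs_le.2 ⟨le_max_left _ _, max_le (by linarith) (min_le_right _ _)⟩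
    rw [abs_of_nonneg (by linarith : 0 ≤ g - 1)]
    linarith

/-- If small perturbations of `μ` can be transported at quadratic cost, then an arbitrary
`g² μ` can be coupled with `μ` at a cost controlled by `g - 1`. -/
theorem exists_isCoupling_cost_le {n : ℕ} {μ : Measure (EuclideanSpace ℝ (Fin n))}
    [IsProbabilityMeasure μ] (hmom : ∫⁻ x, ‖x‖ₑ ^ (2 : ℝ) ∂μ ≠ ∞) {ε : ℝ} (hε : 0 < ε) {A : ℝ≥0}
    (H : ∀ u : EuclideanSpace ℝ (Fin n) → ℝ, Measurable u →
      (∀ x, |u x| ≤ ε) → ∫⁻ x, ENNReal.ofReal (1 + u x) ∂μ = μ Set.univ →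
      ∃ S : EuclideanSpace ℝ (Fin n) → EuclideanSpace ℝ (Fin n), Measurable S ∧
        (μ.withDensity fun x => ENNReal.ofReal (1 + u x)).map S = μ ∧
        ∫⁻ x, ENNReal.ofReal (‖S x - x‖ ^ 2) * ENNReal.ofReal (1 + u x) ∂μ ≤
          A * ∫⁻ x, ENNReal.ofReal (u x ^ 2) ∂μ) :
    ∃ C : ℝ≥0, ∀ g : EuclideanSpace ℝ (Fin n) → ℝ, Measurable g → (∀ x, 0 ≤ g x) →
      ∫⁻ x, ENNReal.ofReal (g x ^ 2) ∂μ = 1 →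
      ∃ π, IsCoupling π (μ.withDensity fun x => ENNReal.ofReal (g x ^ 2)) μ ∧
        ∫⁻ q, edist q.1 q.2 ^ (2 : ℝ) ∂π ≤
          C * ∫⁻ x, ENNReal.ofReal ((1 + ‖x‖ ^ 2) * (g x - 1) ^ 2) ∂μ := by
  set e : ℝ := min (ε / 2) (1 / 2) with hedef
  have he : 0 < e := by positivity
  have he2 : e ≤ 1 / 2 := min_le_right _ _
  have he1 : e ≤ 1 := by linarith
  have heε : e ≤ ε / 2 := min_le_left _ _
  set K : ℝ := 9 / e with hK
  have hK0 : 0 < K := by positivity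
  set M := ∫⁻ x, ‖x‖ₑ ^ (2 : ℝ) ∂μ with hM
  refine ⟨2 * A * (18 + 2 * K.toNNReal) + 4 * (K.toNNReal + M.toNNReal * K.toNNReal),
    fun g hg hg0 hmass => ?_⟩
  set D := ∫⁻ x, ENNReal.ofReal ((1 + ‖x‖ ^ 2) * (g x - 1) ^ 2) ∂μ with hD
  set v : EuclideanSpace ℝ (Fin n) → ℝ := fun x => max (-e) (min (g x ^ 2 - 1) e) with hv
  have hvm : Measurable v := by fun_prop
  have hve : ∀ x, |v x| ≤ e := fun x =>
    abs_le.2 ⟨le_max_left _ _, max_le (by linarith) (min_le_right _ _)⟩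
  have hvint : Integrable v μ := Integrable.of_bound hvm.aestronglyMeasurable e
    (Filter.Eventually.of_forall hve)
  have hgint : Integrable (fun x => g x ^ 2) μ := by
    refine ⟨by fun_prop, ?_⟩
    rw [hasFiniteIntegral_iff_ofReal (Filter.Eventually.of_forall fun x => by positivity), hmass]
    exact ENNReal.one_lt_top
  have hg1 : ∫ x, g x ^ 2 ∂μ = 1 := by
    rw [integral_eq_lintegral_of_nonneg_ae (Filter.Eventually.of_forall fun x => by positivity)
      (by fun_prop), hmass]
    rfl
  set b := ∫ x, v x ∂μ with hb
  have hbe : |b| ≤ e := by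
    simpa using norm_integral_le_of_norm_le_const (μ := μ) (f := v) (C := e)
      (Filter.Eventually.of_forall hve)
  have hD1 : ∫⁻ x, ENNReal.ofReal ((g x - 1) ^ 2) ∂μ ≤ D := lintegral_mono fun x =>
    ENNReal.ofReal_le_ofReal (le_mul_of_one_le_left (by positivity) (by
      linarith [sq_nonneg ‖x‖]))
  have hbD : ENNReal.ofReal |b| ≤ ENNReal.ofReal K * D := by
    have e1 : -b = ∫ x, (g x ^ 2 - 1 - v x) ∂μ := by
      rw [integral_sub (f := fun x => g x ^ 2 - 1) (hgint.sub (integrable_const _)) hvint,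
        integral_sub hgint (integrable_const _), hg1]
      simp [hb]
    calc ENNReal.ofReal |b| = ‖-b‖ₑ := by rw [enorm_neg, ← ofReal_norm, Real.norm_eq_abs]
      _ ≤ ∫⁻ x, ‖g x ^ 2 - 1 - v x‖ₑ ∂μ := by rw [e1]; exact enorm_integral_le_lintegral_enorm _
      _ ≤ ∫⁻ x, ENNReal.ofReal K * ENNReal.ofReal ((g x - 1) ^ 2) ∂μ := by
          gcongr with x
          rw [← ofReal_norm, ← ENNReal.ofReal_mul hK0.le]
          exact ENNReal.ofReal_le_ofReal (abs_sq_sub_clamp_le he he1 (hg0 x))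
      _ = ENNReal.ofReal K * ∫⁻ x, ENNReal.ofReal ((g x - 1) ^ 2) ∂μ :=
          lintegral_const_mul' _ _ ENNReal.ofReal_ne_top
      _ ≤ _ := by gcongr
  have hu1 : ∀ x, |v x - b| ≤ ε := fun x => by
    have := abs_sub (v x) b
    linarith [hve x]
  have hu : Measurable fun x => v x - b := hvm.sub_const b
  have hub : ∀ x, 0 ≤ 1 + (v x - b) := fun x => by
    linarith [(abs_le.1 (hve x)).1, (abs_le.1 hbe).2]
  have hmass' : ∫⁻ x, ENNReal.ofReal (1 + (v x - b)) ∂μ = 1 := by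
    have hint : Integrable (fun x => v x - b) μ := hvint.sub (integrable_const _)
    have hint1 : Integrable (fun x => 1 + (v x - b)) μ := (integrable_const _).add hint
    rw [← ofReal_integral_eq_lintegral_ofReal hint1 (Filter.Eventually.of_forall hub),
      integral_add (integrable_const _) hint, integral_sub hvint (integrable_const _)]
    simp [hb]
  obtain ⟨S, hS, hSmap, hScost⟩ := H (fun x => v x - b) hu hu1 (by rw [hmass', measure_univ])
  have hq : Measurable fun x => ENNReal.ofReal (1 + (v x - b)) := (hu.const_add 1).ennreal_ofReal
  obtain ⟨π, hπ, hcost⟩ := exists_isCoupling_withDensity (μ := μ) (p := fun x =>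
    ENNReal.ofReal (g x ^ 2)) (by fun_prop) hq (by rw [hmass, hmass'])
    (by rw [hmass]; exact ENNReal.one_ne_top) hS
  rw [hSmap] at hπ
  refine ⟨π, hπ, hcost.trans ?_⟩
  have c1 : ∫⁻ x, edist x (S x) ^ (2 : ℝ) * ENNReal.ofReal (1 + (v x - b)) ∂μ ≤
      A * ((18 + 2 * ENNReal.ofReal K) * D) := by
    calc _ = ∫⁻ x, ENNReal.ofReal (‖S x - x‖ ^ 2) * ENNReal.ofReal (1 + (v x - b)) ∂μ := by
          refine lintegral_congr fun x => ?_
          rw [edist_comm, edist_eq_enorm_sub, ← ofReal_norm, ENNReal.rpow_two,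
            ENNReal.ofReal_pow (norm_nonneg _)]
      _ ≤ A * ∫⁻ x, ENNReal.ofReal ((v x - b) ^ 2) ∂μ := hScost
      _ ≤ A * ∫⁻ x, (18 * ENNReal.ofReal ((g x - 1) ^ 2) + 2 * ENNReal.ofReal |b|) ∂μ := by
          gcongr with x
          rw [show (18 : ℝ≥0∞) = ENNReal.ofReal 18 by simp,
            show (2 : ℝ≥0∞) = ENNReal.ofReal 2 by simp, ← ENNReal.ofReal_mul (by norm_num),
            ← ENNReal.ofReal_mul (by norm_num), ← ENNReal.ofReal_add (by positivity)
            (by positivity)]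
          refine ENNReal.ofReal_le_ofReal ?_
          have h1 : v x ^ 2 ≤ 9 * (g x - 1) ^ 2 := clamp_sq_le he he1 (hg0 x)
          have h2 : b ^ 2 ≤ |b| := by
            rw [← sq_abs]
            nlinarith [abs_nonneg b]
          nlinarith [sq_nonneg (v x + b)]
      _ = A * (18 * ∫⁻ x, ENNReal.ofReal ((g x - 1) ^ 2) ∂μ + 2 * ENNReal.ofReal |b|) := by
          rw [lintegral_add_right _ measurable_const, lintegral_const_mul _ (by fun_prop)]
          simp
      _ ≤ A * (18 * D + 2 * (ENNReal.ofReal K * D)) := by gcongr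
      _ = _ := by ring
  have c2 : ∫⁻ x, ‖x‖ₑ ^ (2 : ℝ) * ((ENNReal.ofReal (g x ^ 2) - ENNReal.ofReal (1 + (v x - b))) +
      (ENNReal.ofReal (1 + (v x - b)) - ENNReal.ofReal (g x ^ 2))) ∂μ ≤
      (ENNReal.ofReal K + M * ENNReal.ofReal K) * D := by
    calc _ ≤ ∫⁻ x, (ENNReal.ofReal K * ENNReal.ofReal ((1 + ‖x‖ ^ 2) * (g x - 1) ^ 2) +
          ‖x‖ₑ ^ (2 : ℝ) * ENNReal.ofReal |b|) ∂μ := by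
          gcongr with x
          have e1 : (ENNReal.ofReal (g x ^ 2) - ENNReal.ofReal (1 + (v x - b))) +
              (ENNReal.ofReal (1 + (v x - b)) - ENNReal.ofReal (g x ^ 2)) =
              ENNReal.ofReal |g x ^ 2 - (1 + (v x - b))| := by
            rw [← ENNReal.ofReal_sub _ (hub x), ← ENNReal.ofReal_sub _ (by positivity)]
            rcases le_total (g x ^ 2) (1 + (v x - b)) with h | h
            · rw [ENNReal.ofReal_of_nonpos (sub_nonpos.2 h), zero_add,
                abs_of_nonpos (sub_nonpos.2 h), neg_sub]
            · rw [ENNReal.ofReal_of_nonpos (sub_nonpos.2 h), add_zero,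
                abs_of_nonneg (sub_nonneg.2 h)]
          have e2 : |g x ^ 2 - (1 + (v x - b))| ≤ K * (g x - 1) ^ 2 + |b| := by
            calc _ = |(g x ^ 2 - 1 - v x) + b| := by congr 1; ring
              _ ≤ _ := abs_add_le _ _
              _ ≤ _ := by gcongr; exact abs_sq_sub_clamp_le he he1 (hg0 x)
          have e3 : ‖x‖ₑ ^ (2 : ℝ) = ENNReal.ofReal (‖x‖ ^ 2) := by
            rw [← ofReal_norm, ENNReal.rpow_two, ENNReal.ofReal_pow (norm_nonneg _)]
          rw [e1, e3, ← ENNReal.ofReal_mul (by positivity), ← ENNReal.ofReal_mul hK0.le,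
            ← ENNReal.ofReal_mul (by positivity), ← ENNReal.ofReal_add (by positivity)
            (by positivity)]
          refine ENNReal.ofReal_le_ofReal ?_
          have : 0 ≤ K * (g x - 1) ^ 2 := by positivity
          nlinarith [mul_le_mul_of_nonneg_left e2 (sq_nonneg ‖x‖)]
      _ = ENNReal.ofReal K * D + M * ENNReal.ofReal |b| := by
          rw [lintegral_add_left (by fun_prop), lintegral_const_mul _ (by fun_prop),
            lintegral_mul_const _ (by fun_prop)]
      _ ≤ ENNReal.ofReal K * D + M * (ENNReal.ofReal K * D) := by gcongr
      _ = _ := by ring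
  calc _ ≤ 2 * (A * ((18 + 2 * ENNReal.ofReal K) * D)) +
        4 * ((ENNReal.ofReal K + M * ENNReal.ofReal K) * D) := by gcongr
    _ = _ := by
        push_cast
        rw [ENNReal.coe_toNNReal hmom]
        simp only [ENNReal.ofReal]
        ring

theorem exists_le_radial_weight {a θ N : ℝ} (ha : 0 < a) (hθ : 2 ≤ θ) :
    ∃ s > 0, ∃ c₁ > 0, ∃ c₂ ≥ 0, ∀ r : ℝ, 0 ≤ r → c₁ * r ^ (2 * (θ - 1)) ≤ c₂ +
      a * θ * ((1 + r ^ 2) ^ ((θ - 2) / 2) * r ^ θ) - N * (1 + r ^ 2) ^ ((θ - 2) / 2) -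
        s * (r ^ 2 * ((1 + r ^ 2) ^ ((θ - 2) / 2)) ^ 2) := by
  set κ : ℝ := 2 ^ ((θ - 2) / 2) with hκ
  have hκ0 : 0 < κ := by positivity
  have haθ : 0 < a * θ := by positivity
  set s := a * θ / (2 * κ) with hs
  have hs0 : 0 < s := by positivity
  set F : ℝ → ℝ := fun r => a * θ * ((1 + r ^ 2) ^ ((θ - 2) / 2) * r ^ θ) -
    N * (1 + r ^ 2) ^ ((θ - 2) / 2) - s * (r ^ 2 * ((1 + r ^ 2) ^ ((θ - 2) / 2)) ^ 2) -
      a * θ / 4 * r ^ (2 * (θ - 1)) with hF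
  have hFc : Continuous F := by
    have h1 : Continuous fun r : ℝ => (1 + r ^ 2) ^ ((θ - 2) / 2) :=
      (by fun_prop : Continuous fun r : ℝ => 1 + r ^ 2).rpow_const fun r => Or.inr (by linarith)
    have h2 : Continuous fun r : ℝ => r ^ θ := Real.continuous_rpow_const (by linarith)
    have h3 : Continuous fun r : ℝ => r ^ (2 * (θ - 1)) := Real.continuous_rpow_const (by linarith)
    fun_prop
  set R : ℝ := max 1 (4 * |N| / (a * θ)) with hR
  obtain ⟨r₀, -, hr₀⟩ := (isCompact_Icc (a := (0 : ℝ)) (b := R)).exists_isMinOn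
    ⟨0, by simp [hR]⟩ hFc.continuousOn
  refine ⟨s, hs0, a * θ / 4, by positivity, |F r₀|, abs_nonneg _, fun r hr => ?_⟩
  suffices 0 ≤ |F r₀| + F r by simp only [hF] at this ⊢; linarith
  rcases le_total r R with h | h
  · have : F r₀ ≤ F r := hr₀ ⟨hr, h⟩
    linarith [neg_abs_le (F r₀)]
  · suffices 0 ≤ F r by positivity
    have hr1 : 1 ≤ r := (le_max_left _ _).trans h
    have hr0 : 0 < r := by linarith
    set D := (1 + r ^ 2) ^ ((θ - 2) / 2) with hD
    have hD0 : 0 < D := by positivity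
    have hrD : r ^ (θ - 2) = (r ^ 2) ^ ((θ - 2) / 2) := by
      rw [← Real.rpow_natCast_mul hr]
      congr 1
      push_cast
      ring
    have h1 : r ^ (θ - 2) ≤ D := by
      rw [hrD]
      exact Real.rpow_le_rpow (by positivity) (by linarith) (by linarith)
    have h2 : D ≤ κ * r ^ (θ - 2) := by
      rw [hrD, hκ, ← Real.mul_rpow (by norm_num) (by positivity)]
      exact Real.rpow_le_rpow (by positivity) (by nlinarith) (by linarith)
    have e1 : r ^ 2 * r ^ (θ - 2) = r ^ θ := by
      rw [← Real.rpow_natCast r 2, ← Real.rpow_add hr0]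
      congr 1
      push_cast
      ring
    have e2 : r ^ (2 * (θ - 1)) = r ^ (θ - 2) * r ^ θ := by
      rw [← Real.rpow_add hr0]
      congr 1
      ring
    have h3 : N ≤ a * θ / 4 * r ^ θ := by
      have h4 : r ≤ r ^ θ := by
        conv_lhs => rw [← Real.rpow_one r]
        exact Real.rpow_le_rpow_of_exponent_le hr1 (by linarith)
      have h5 : 4 * |N| / (a * θ) ≤ r ^ θ := ((le_max_right _ _).trans h).trans h4
      rw [div_le_iff₀ haθ] at h5
      linarith [le_abs_self N]
    have h6 : s * (r ^ 2 * D ^ 2) ≤ a * θ / 2 * (D * r ^ θ) := by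
      calc s * (r ^ 2 * D ^ 2) = s * r ^ 2 * D * D := by ring
        _ ≤ s * r ^ 2 * D * (κ * r ^ (θ - 2)) := by gcongr
        _ = s * κ * D * (r ^ 2 * r ^ (θ - 2)) := by ring
        _ = s * κ * (D * r ^ θ) := by rw [e1]; ring
        _ = _ := by
          congr 1
          rw [hs]
          field_simp
    have h7 : a * θ / 4 * r ^ (2 * (θ - 1)) ≤ a * θ / 4 * (D * r ^ θ) := by
      rw [e2]
      gcongr
    have h8 : N * D ≤ a * θ / 4 * (D * r ^ θ) := by
      calc N * D ≤ a * θ / 4 * r ^ θ * D := by gcongr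
        _ = _ := by ring
    simp only [hF]
    linarith

theorem hasFDerivAt_coord_mul_radial {n : ℕ} {a θ : ℝ} (hθ : 2 ≤ θ) (i : Fin n)
    (x : EuclideanSpace ℝ (Fin n)) :
    ∃ L : EuclideanSpace ℝ (Fin n) →L[ℝ] ℝ, HasFDerivAt (fun x : EuclideanSpace ℝ (Fin n) =>
        x i * (1 + ‖x‖ ^ 2) ^ ((θ - 2) / 2) * Real.exp (-(a * ‖x‖ ^ θ))) L x ∧
      L (EuclideanSpace.single i 1) = ((1 + ‖x‖ ^ 2) ^ ((θ - 2) / 2) +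
        (θ - 2) * x i ^ 2 * (1 + ‖x‖ ^ 2) ^ ((θ - 2) / 2 - 1) -
        a * θ * x i ^ 2 * ‖x‖ ^ (θ - 2) * (1 + ‖x‖ ^ 2) ^ ((θ - 2) / 2)) *
          Real.exp (-(a * ‖x‖ ^ θ)) := by
  have h1 : HasFDerivAt (fun x : EuclideanSpace ℝ (Fin n) => x i)
    (EuclideanSpace.proj i : EuclideanSpace ℝ (Fin n) →L[ℝ] ℝ) x :=
      (EuclideanSpace.proj i : EuclideanSpace ℝ (Fin n) →L[ℝ] ℝ).hasFDerivAt
  have h2 : HasFDerivAt (fun x : EuclideanSpace ℝ (Fin n) => 1 + ‖x‖ ^ 2) _ x :=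
    (hasStrictFDerivAt_norm_sq x).hasFDerivAt.const_add 1
  have h3 := h2.rpow_const (p := (θ - 2) / 2) (Or.inl (by positivity))
  have h4 := (((hasFDerivAt_norm_rpow x (by linarith : 1 < θ)).const_mul a).neg).exp
  refine ⟨_, (h1.mul h3).mul h4, ?_⟩
  have hin : inner ℝ x (EuclideanSpace.single i (1 : ℝ)) = x i := by
    simp [EuclideanSpace.inner_single_right]
  simp [hin]
  ring

theorem norm_rpow_eq_sum {n : ℕ} {θ : ℝ} (hθ : 2 ≤ θ) (x : EuclideanSpace ℝ (Fin n)) :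
    ‖x‖ ^ θ = ∑ i, x i ^ 2 * ‖x‖ ^ (θ - 2) := by
  rw [← Finset.sum_mul, ← EuclideanSpace.real_norm_sq_eq, ← Real.rpow_natCast,
    ← Real.rpow_add_of_nonneg (norm_nonneg _) (by norm_num) (by linarith)]
  congr 1
  push_cast
  ring

/-- Lyapunov inequality for the weight `exp (-a ‖x‖ ^ θ)` and compactly supported functions. -/
theorem exists_integral_norm_rpow_mul_sq_le (n : ℕ) {a θ : ℝ} (ha : 0 < a) (hθ : 2 ≤ θ) :
    ∃ c₁ > 0, ∃ c₂ ≥ 0, ∃ K ≥ 0, ∀ w : EuclideanSpace ℝ (Fin n) → ℝ, Differentiable ℝ w →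
      HasCompactSupport w →
      Integrable (fun x => ‖fderiv ℝ w x‖ ^ 2 * Real.exp (-(a * ‖x‖ ^ θ))) →
      c₁ * ∫ x, ‖x‖ ^ (2 * (θ - 1)) * w x ^ 2 * Real.exp (-(a * ‖x‖ ^ θ)) ≤
        c₂ * (∫ x, w x ^ 2 * Real.exp (-(a * ‖x‖ ^ θ))) +
          K * ∫ x, ‖fderiv ℝ w x‖ ^ 2 * Real.exp (-(a * ‖x‖ ^ θ)) := by
  obtain ⟨s, hs, c₁, hc₁, c₂, hc₂, H⟩ := exists_le_radial_weight (N := n * (θ - 1)) ha hθ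
  refine ⟨c₁, hc₁, c₂, hc₂, n / s, by positivity, fun w hw hwc hint => ?_⟩
  have hwcont := hw.continuous
  set ρ : EuclideanSpace ℝ (Fin n) → ℝ := fun x => Real.exp (-(a * ‖x‖ ^ θ)) with hρ
  set D : EuclideanSpace ℝ (Fin n) → ℝ := fun x => (1 + ‖x‖ ^ 2) ^ ((θ - 2) / 2) with hD
  have hρ0 : ∀ x, 0 < ρ x := fun x => Real.exp_pos _
  have hD0 : ∀ x, 0 < D x := fun x => by positivity
  have hnθ : Continuous fun x : EuclideanSpace ℝ (Fin n) => ‖x‖ ^ θ :=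
    continuous_norm.rpow_const fun x => Or.inr (by linarith)
  have hn2θ : Continuous fun x : EuclideanSpace ℝ (Fin n) => ‖x‖ ^ (2 * (θ - 1)) :=
    continuous_norm.rpow_const fun x => Or.inr (by linarith)
  have hnθ2 : Continuous fun x : EuclideanSpace ℝ (Fin n) => ‖x‖ ^ (θ - 2) :=
    continuous_norm.rpow_const fun x => Or.inr (by linarith)
  have hρc : Continuous ρ := by fun_prop
  have hDc : ∀ t : ℝ, Continuous fun x : EuclideanSpace ℝ (Fin n) => (1 + ‖x‖ ^ 2) ^ t := fun t =>
    (by fun_prop : Continuous fun x : EuclideanSpace ℝ (Fin n) => 1 + ‖x‖ ^ 2).rpow_const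
      fun x => Or.inl (by positivity)
  have hDc' : Continuous D := hDc _
  have hw2c : HasCompactSupport fun x => w x ^ 2 := by
    simp only [sq]
    exact hwc.mul_left
  have hcs : ∀ h : EuclideanSpace ℝ (Fin n) → ℝ, Continuous h →
      Integrable fun x => w x ^ 2 * h x := fun h hh =>
    ((hwcont.pow 2).mul hh).integrable_of_hasCompactSupport (hw2c.mul_right)
  have hfd : Measurable (fderiv ℝ w) := measurable_fderiv ℝ w
  have hwfd : ∀ i x, fderiv ℝ (fun y => w y ^ 2) x (EuclideanSpace.single i 1) =
      2 * w x * fderiv ℝ w x (EuclideanSpace.single i 1) := fun i x => by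
    rw [((hw x).hasFDerivAt.pow 2).fderiv]
    simp
  have hfdle : ∀ (i : Fin n) x, |fderiv ℝ w x (EuclideanSpace.single i 1)| ≤ ‖fderiv ℝ w x‖ :=
    fun i x => by
      simpa using (fderiv ℝ w x).le_opNorm (EuclideanSpace.single i 1)
  set G : Fin n → EuclideanSpace ℝ (Fin n) → ℝ := fun i x => x i * D x * ρ x with hG
  have hGc : ∀ i, Continuous (G i) := fun i => by fun_prop
  have hGd : ∀ i, Differentiable ℝ (G i) := fun i x =>
    (hasFDerivAt_coord_mul_radial hθ i x).choose_spec.1.differentiableAt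
  have hGf : ∀ i x, fderiv ℝ (G i) x (EuclideanSpace.single i 1) = (D x +
        (θ - 2) * x i ^ 2 * (1 + ‖x‖ ^ 2) ^ ((θ - 2) / 2 - 1) -
        a * θ * x i ^ 2 * ‖x‖ ^ (θ - 2) * D x) * ρ x := fun i x => by
    obtain ⟨L, hL, hLe⟩ := hasFDerivAt_coord_mul_radial (a := a) hθ i x
    rw [hL.fderiv, hLe]
  have hamgm : ∀ i x, |2 * w x * fderiv ℝ w x (EuclideanSpace.single i 1) * G i x| ≤
      s * (x i ^ 2 * D x ^ 2) * (w x ^ 2 * ρ x) + 1 / s * (‖fderiv ℝ w x‖ ^ 2 * ρ x) := fun i x => by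
    have h1 := sq_nonneg (s * |x i * D x * w x| - ‖fderiv ℝ w x‖)
    have e : (x i * D x * w x) ^ 2 = x i ^ 2 * D x ^ 2 * w x ^ 2 := by ring
    calc _ = 2 * |x i * D x * w x| * |fderiv ℝ w x (EuclideanSpace.single i 1)| * ρ x := by
          simp only [hG, abs_mul, abs_of_pos (hρ0 x), abs_two]
          ring
      _ ≤ 2 * |x i * D x * w x| * ‖fderiv ℝ w x‖ * ρ x := by
          have := hρ0 x
          gcongr
          exact hfdle i x
      _ ≤ (s * (x i * D x * w x) ^ 2 + 1 / s * ‖fderiv ℝ w x‖ ^ 2) * ρ x := by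
          refine mul_le_mul_of_nonneg_right ?_ (hρ0 x).le
          rw [← sq_abs (x i * D x * w x), ← sub_nonneg]
          have : s * |x i * D x * w x| ^ 2 + 1 / s * ‖fderiv ℝ w x‖ ^ 2 -
            2 * |x i * D x * w x| * ‖fderiv ℝ w x‖ =
            1 / s * (s * |x i * D x * w x| - ‖fderiv ℝ w x‖) ^ 2 := by
            field_simp
            ring
          rw [this]
          positivity
      _ = _ := by rw [e]; ring
  have hI1 : ∀ i, Integrable fun x => w x ^ 2 * fderiv ℝ (G i) x (EuclideanSpace.single i 1) :=
    fun i => by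
      simp only [hGf]
      refine hcs _ ?_
      have := hDc ((θ - 2) / 2 - 1)
      fun_prop
  have hI2 : ∀ i, Integrable fun x => fderiv ℝ (fun y => w y ^ 2) x (EuclideanSpace.single i 1) *
      G i x := fun i => by
    simp only [hwfd]
    refine Integrable.mono' (g := fun x => s * (x i ^ 2 * D x ^ 2) * (w x ^ 2 * ρ x) +
      1 / s * (‖fderiv ℝ w x‖ ^ 2 * ρ x)) ?_ ?_ (Filter.Eventually.of_forall (hamgm i))
    · refine Integrable.add ?_ (hint.const_mul _)
      refine (hcs (fun x => s * (x i ^ 2 * D x ^ 2) * ρ x) (by fun_prop)).congr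
        (Filter.Eventually.of_forall fun x => ?_)
      simp only
      ring
    · have h1 : Measurable fun x => fderiv ℝ w x (EuclideanSpace.single i 1) :=
        measurable_fderiv_apply_const ℝ w _
      have h2 : Measurable (G i) := (hGc i).measurable
      have h3 := hwcont.measurable
      exact (((h3.const_mul 2).mul h1).mul h2).aestronglyMeasurable
  have hparts : ∀ i, ∫ x, (w x ^ 2 * fderiv ℝ (G i) x (EuclideanSpace.single i 1) +
      fderiv ℝ (fun y => w y ^ 2) x (EuclideanSpace.single i 1) * G i x) = 0 := fun i => by
    rw [integral_add (hI1 i) (hI2 i), integral_mul_fderiv_eq_neg_fderiv_mul_of_integrable (hI2 i)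
      (hI1 i) (hcs _ (hGc i)) (fun x _ => (hw x).pow 2) (fun x _ => hGd i x), neg_add_cancel]
  have hI3 : ∀ i, Integrable fun x =>
      w x ^ 2 * fderiv ℝ (G i) x (EuclideanSpace.single i 1) +
        fderiv ℝ (fun y => w y ^ 2) x (EuclideanSpace.single i 1) * G i x :=
    fun i => (hI1 i).add (hI2 i)
  have hsum : ∫ x, ∑ i, (w x ^ 2 * fderiv ℝ (G i) x (EuclideanSpace.single i 1) +
      fderiv ℝ (fun y => w y ^ 2) x (EuclideanSpace.single i 1) * G i x) = 0 := by
    rw [integral_finsetSum _ fun i _ => hI3 i]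
    simp [hparts]
  have hpt : ∀ x, ∑ i, (w x ^ 2 * fderiv ℝ (G i) x (EuclideanSpace.single i 1) +
      fderiv ℝ (fun y => w y ^ 2) x (EuclideanSpace.single i 1) * G i x) ≤
      c₂ * (w x ^ 2 * ρ x) + n / s * (‖fderiv ℝ w x‖ ^ 2 * ρ x) -
        c₁ * (‖x‖ ^ (2 * (θ - 1)) * w x ^ 2 * ρ x) := fun x => by
    have h1 : ∀ i, w x ^ 2 * fderiv ℝ (G i) x (EuclideanSpace.single i 1) +
        fderiv ℝ (fun y => w y ^ 2) x (EuclideanSpace.single i 1) * G i x ≤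
        ((θ - 1) * D x) * (w x ^ 2 * ρ x) - a * θ * D x * (w x ^ 2 * ρ x) * (x i ^ 2 * ‖x‖ ^ (θ - 2))
          + s * D x ^ 2 * (w x ^ 2 * ρ x) * x i ^ 2 + 1 / s * (‖fderiv ℝ w x‖ ^ 2 * ρ x) :=
        fun i => by
      have h2 := (le_abs_self _).trans (hamgm i x)
      have h3 : x i ^ 2 * (1 + ‖x‖ ^ 2) ^ ((θ - 2) / 2 - 1) ≤ D x := by
        rw [Real.rpow_sub (by positivity), Real.rpow_one, mul_div_assoc', div_le_iff₀ (by positivity),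
          mul_comm]
        refine mul_le_mul_of_nonneg_left ?_ (hD0 x).le
        have : x i ^ 2 ≤ ‖x‖ ^ 2 := by
          rw [EuclideanSpace.real_norm_sq_eq]
          exact Finset.single_le_sum (f := fun i => x i ^ 2) (fun j _ => sq_nonneg _)
            (Finset.mem_univ i)
        linarith
      have h4 : 0 ≤ w x ^ 2 * ρ x := mul_nonneg (sq_nonneg _) (hρ0 x).le
      have h5 := mul_le_mul_of_nonneg_right (mul_le_mul_of_nonneg_left h3
        (by linarith : 0 ≤ θ - 2)) h4
      rw [hwfd, hGf]
      nlinarith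
    have h6 := mul_le_mul_of_nonneg_right (H ‖x‖ (norm_nonneg x))
      (mul_nonneg (sq_nonneg (w x)) (hρ0 x).le)
    have h7 : ∑ i, x i ^ 2 = ‖x‖ ^ 2 := (EuclideanSpace.real_norm_sq_eq x).symm
    have h8 := norm_rpow_eq_sum hθ x
    refine (Finset.sum_le_sum fun i _ => h1 i).trans ?_
    rw [Finset.sum_add_distrib, Finset.sum_add_distrib, Finset.sum_sub_distrib,
      ← Finset.mul_sum Finset.univ fun i => x i ^ 2 * ‖x‖ ^ (θ - 2),
      ← Finset.mul_sum Finset.univ fun i => x i ^ 2, h7, ← h8]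
    simp only [Finset.sum_const, Finset.card_univ, Fintype.card_fin, nsmul_eq_mul]
    have e : (n : ℝ) / s = n * (1 / s) := by ring
    rw [e]
    simp only [hD]
    linarith
  have hJ0 : Integrable fun x => w x ^ 2 * ρ x := hcs _ hρc
  have hJ1 : Integrable fun x => ‖x‖ ^ (2 * (θ - 1)) * w x ^ 2 * ρ x :=
    (hcs (fun x => ‖x‖ ^ (2 * (θ - 1)) * ρ x) (by fun_prop)).congr
      (Filter.Eventually.of_forall fun x => by simp only; ring)
  have hJ2 : Integrable fun x => c₂ * (w x ^ 2 * ρ x) + n / s * (‖fderiv ℝ w x‖ ^ 2 * ρ x) :=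
    (hJ0.const_mul c₂).add (hint.const_mul (n / s))
  have hle := integral_mono (integrable_finsetSum _ fun i _ => hI3 i)
    (hJ2.sub (hJ1.const_mul c₁)) hpt
  rw [hsum, integral_sub' hJ2 (hJ1.const_mul c₁), integral_add (hJ0.const_mul c₂)
    (hint.const_mul (n / s)), integral_const_mul, integral_const_mul, integral_const_mul] at hle
  linarith

theorem exists_cutoff (n : ℕ) : ∃ L : ℝ, 0 ≤ L ∧ ∀ k : ℕ,
    ∃ χ : EuclideanSpace ℝ (Fin n) → ℝ, Differentiable ℝ χ ∧ HasCompactSupport χ ∧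
      (∀ x, 0 ≤ χ x) ∧ (∀ x, χ x ≤ 1) ∧ (∀ x, ‖x‖ ≤ k → χ x = 1) ∧ ∀ x, ‖fderiv ℝ χ x‖ ≤ L := by
  let f : ContDiffBump (0 : EuclideanSpace ℝ (Fin n)) := ⟨1, 2, by norm_num, by norm_num⟩
  have hf : ContDiff ℝ 1 f := f.contDiff
  have hfd : Differentiable ℝ f := hf.differentiable (by norm_num)
  obtain ⟨L, hL⟩ := (hf.continuous_fderiv (by norm_num)).bounded_above_of_compact_support
    (f.hasCompactSupport.fderiv (𝕜 := ℝ))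
  refine ⟨L, (norm_nonneg _).trans (hL 0), fun k => ?_⟩
  set t : ℝ := ((k : ℝ) + 1)⁻¹ with ht
  have ht0 : 0 < t := by positivity
  have ht1 : t ≤ 1 := inv_le_one_of_one_le₀ (by linarith [(Nat.cast_nonneg k : (0 : ℝ) ≤ k)])
  have hd : ∀ x, HasFDerivAt (fun x : EuclideanSpace ℝ (Fin n) => f (t • x))
      ((fderiv ℝ f (t • x)).comp (t • ContinuousLinearMap.id ℝ _)) x := fun x =>
    (hfd (t • x)).hasFDerivAt.comp x ((hasFDerivAt_id x).const_smul t)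
  refine ⟨fun x => f (t • x), fun x => (hd x).differentiableAt,
    f.hasCompactSupport.comp_homeomorph (Homeomorph.smulOfNeZero t ht0.ne'), fun x => f.nonneg,
    fun x => f.le_one, fun x hx => f.one_of_mem_closedBall ?_, fun x => ?_⟩
  · rw [mem_closedBall_zero_iff, norm_smul, Real.norm_of_nonneg ht0.le, ht]
    change _ ≤ (1 : ℝ)
    rw [inv_mul_le_iff₀ (by positivity)]
    linarith
  · rw [(hd x).fderiv, ContinuousLinearMap.comp_smul, ContinuousLinearMap.comp_id, norm_smul,
      Real.norm_of_nonneg ht0.le]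
    exact (mul_le_of_le_one_left (norm_nonneg _) ht1).trans (hL _)

theorem lintegral_le_of_forall_closedBall {n : ℕ} {F : EuclideanSpace ℝ (Fin n) → ℝ≥0∞}
    {Q : ℝ≥0∞} (h : ∀ k : ℕ, ∫⁻ x in Metric.closedBall 0 k, F x ≤ Q) : ∫⁻ x, F x ≤ Q := by
  rw [← setLIntegral_univ, ← Metric.iUnion_closedBall_nat (0 : EuclideanSpace ℝ (Fin n)),
    setLIntegral_iUnion_of_directed]
  · exact iSup_le h
  · exact directed_of_isDirected_le fun i j hij =>
      Metric.closedBall_subset_closedBall (by exact_mod_cast hij)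

theorem exists_lintegral_norm_rpow_mul_sq_le_exp (n : ℕ) {a θ : ℝ} (ha : 0 < a) (hθ : 2 ≤ θ) :
    ∃ B : ℝ, 0 ≤ B ∧ ∀ u : EuclideanSpace ℝ (Fin n) → ℝ, Differentiable ℝ u →
      Integrable (fun x => u x ^ 2 * Real.exp (-(a * ‖x‖ ^ θ))) →
      Integrable (fun x => ‖fderiv ℝ u x‖ ^ 2 * Real.exp (-(a * ‖x‖ ^ θ))) →
      ∫⁻ x, ENNReal.ofReal (‖x‖ ^ (2 * (θ - 1)) * u x ^ 2 * Real.exp (-(a * ‖x‖ ^ θ))) ≤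
        ENNReal.ofReal (B * ((∫ x, ‖fderiv ℝ u x‖ ^ 2 * Real.exp (-(a * ‖x‖ ^ θ))) +
          ∫ x, u x ^ 2 * Real.exp (-(a * ‖x‖ ^ θ)))) := by
  obtain ⟨c₁, hc₁, c₂, hc₂, K, hK, H⟩ := exists_integral_norm_rpow_mul_sq_le n ha hθ
  obtain ⟨L, hL, hχ⟩ := exists_cutoff n
  refine ⟨(c₂ + 2 * K + 2 * K * L ^ 2) / c₁, by positivity, fun u hu hu0 hu1 => ?_⟩
  set ρ : EuclideanSpace ℝ (Fin n) → ℝ := fun x => Real.exp (-(a * ‖x‖ ^ θ)) with hρ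
  have hρ0 : ∀ x, 0 < ρ x := fun x => Real.exp_pos _
  have hρc : Continuous ρ := by
    have : Continuous fun x : EuclideanSpace ℝ (Fin n) => ‖x‖ ^ θ :=
      continuous_norm.rpow_const fun x => Or.inr (by linarith)
    fun_prop
  have hn2θ : Continuous fun x : EuclideanSpace ℝ (Fin n) => ‖x‖ ^ (2 * (θ - 1)) :=
    continuous_norm.rpow_const fun x => Or.inr (by linarith)
  refine lintegral_le_of_forall_closedBall fun k => ?_
  obtain ⟨χ, hχd, hχc, hχ0, hχ1, hχk, hχL⟩ := hχ k
  set w : EuclideanSpace ℝ (Fin n) → ℝ := fun x => χ x * u x with hw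
  have hwd : Differentiable ℝ w := hχd.mul hu
  have hwc : HasCompactSupport w := hχc.mul_right
  have hwle : ∀ x, w x ^ 2 ≤ u x ^ 2 := fun x => by
    simp only [hw]
    rw [mul_pow]
    exact mul_le_of_le_one_left (sq_nonneg _) (pow_le_one₀ (hχ0 x) (hχ1 x))
  have hwfd : ∀ x, ‖fderiv ℝ w x‖ ^ 2 ≤ 2 * ‖fderiv ℝ u x‖ ^ 2 + 2 * L ^ 2 * u x ^ 2 := fun x => by
    have h1 : ‖fderiv ℝ w x‖ ≤ ‖fderiv ℝ u x‖ + |u x| * L := by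
      rw [fderiv_fun_mul (hχd x) (hu x)]
      refine (norm_add_le _ _).trans ?_
      rw [norm_smul, norm_smul, Real.norm_eq_abs, Real.norm_eq_abs, abs_of_nonneg (hχ0 x)]
      gcongr
      · exact mul_le_of_le_one_left (norm_nonneg _) (hχ1 x)
      · exact hχL x
    calc _ ≤ (‖fderiv ℝ u x‖ + |u x| * L) ^ 2 := by gcongr
      _ ≤ 2 * ‖fderiv ℝ u x‖ ^ 2 + 2 * (|u x| * L) ^ 2 := by
          nlinarith [sq_nonneg (‖fderiv ℝ u x‖ - |u x| * L)]
      _ = _ := by rw [mul_pow, sq_abs]; ring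
  have hdom : Integrable fun x => 2 * (‖fderiv ℝ u x‖ ^ 2 * ρ x) + 2 * L ^ 2 * (u x ^ 2 * ρ x) :=
    (hu1.const_mul 2).add (hu0.const_mul _)
  have hle1 : ∀ x, ‖fderiv ℝ w x‖ ^ 2 * ρ x ≤
      2 * (‖fderiv ℝ u x‖ ^ 2 * ρ x) + 2 * L ^ 2 * (u x ^ 2 * ρ x) := fun x =>
    (mul_le_mul_of_nonneg_right (hwfd x) (hρ0 x).le).trans_eq (by ring)
  have hmeas : Measurable fun x => ‖fderiv ℝ w x‖ ^ 2 * ρ x :=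
    ((measurable_fderiv ℝ w).norm.pow_const 2).mul hρc.measurable
  have hint : Integrable fun x => ‖fderiv ℝ w x‖ ^ 2 * ρ x :=
    hdom.mono' hmeas.aestronglyMeasurable (Filter.Eventually.of_forall fun x => by
      rw [Real.norm_of_nonneg (mul_nonneg (sq_nonneg _) (hρ0 x).le)]
      exact hle1 x)
  have hwcont := hwd.continuous
  have hint0 : Integrable fun x => w x ^ 2 * ρ x :=
    hu0.mono' (by fun_prop) (Filter.Eventually.of_forall fun x => by
      rw [Real.norm_of_nonneg (mul_nonneg (sq_nonneg _) (hρ0 x).le)]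
      exact mul_le_mul_of_nonneg_right (hwle x) (hρ0 x).le)
  have hint2 : Integrable fun x => ‖x‖ ^ (2 * (θ - 1)) * w x ^ 2 * ρ x := by
    refine ((hn2θ.mul (hwcont.pow 2)).mul hρc).integrable_of_hasCompactSupport ?_
    have : HasCompactSupport fun x => w x ^ 2 := by
      simp only [sq]
      exact hwc.mul_left
    exact this.mul_left.mul_right
  have h1 := H w hwd hwc hint
  have h2 : ∫ x, w x ^ 2 * ρ x ≤ ∫ x, u x ^ 2 * ρ x :=
    integral_mono hint0 hu0 fun x => mul_le_mul_of_nonneg_right (hwle x) (hρ0 x).le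
  have h3 : ∫ x, ‖fderiv ℝ w x‖ ^ 2 * ρ x ≤
      2 * (∫ x, ‖fderiv ℝ u x‖ ^ 2 * ρ x) + 2 * L ^ 2 * ∫ x, u x ^ 2 * ρ x := by
    refine (integral_mono hint hdom hle1).trans_eq ?_
    rw [integral_add (hu1.const_mul 2) (hu0.const_mul _), integral_const_mul, integral_const_mul]
  have h4 : 0 ≤ ∫ x, ‖fderiv ℝ u x‖ ^ 2 * ρ x :=
    integral_nonneg fun x => mul_nonneg (sq_nonneg _) (hρ0 x).le
  have h5 : 0 ≤ ∫ x, u x ^ 2 * ρ x :=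
    integral_nonneg fun x => mul_nonneg (sq_nonneg _) (hρ0 x).le
  calc _ = ∫⁻ x in Metric.closedBall 0 k,
        ENNReal.ofReal (‖x‖ ^ (2 * (θ - 1)) * w x ^ 2 * ρ x) := by
        refine setLIntegral_congr_fun measurableSet_closedBall fun x hx => ?_
        simp only [hw]
        rw [hχk x (by simpa using hx), one_mul]
    _ ≤ ∫⁻ x, ENNReal.ofReal (‖x‖ ^ (2 * (θ - 1)) * w x ^ 2 * ρ x) := setLIntegral_le_lintegral _ _
    _ = ENNReal.ofReal (∫ x, ‖x‖ ^ (2 * (θ - 1)) * w x ^ 2 * ρ x) :=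
        (ofReal_integral_eq_lintegral_ofReal hint2 (Filter.Eventually.of_forall fun x =>
          mul_nonneg (by positivity) (hρ0 x).le)).symm
    _ ≤ _ := by
        refine ENNReal.ofReal_le_ofReal ?_
        rw [div_mul_eq_mul_div, le_div_iff₀ hc₁, mul_comm]
        refine h1.trans ?_
        have h6 := mul_le_mul_of_nonneg_left h2 hc₂
        have h7 := mul_le_mul_of_nonneg_left h3 hK
        have h8 : 0 ≤ K * L ^ 2 * ∫ x, ‖fderiv ℝ u x‖ ^ 2 * ρ x := by positivity
        have h9 := mul_nonneg hK h5
        have h10 := mul_nonneg hc₂ h4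
        simp only [hρ] at *
        linarith

theorem exists_lintegral_norm_rpow_mul_sq_le {n : ℕ} {a θ c C : ℝ} (ha : 0 < a) (hθ : 2 ≤ θ)
    (hc : 0 < c) {m : EuclideanSpace ℝ (Fin n) → ℝ} (hm : Measurable m)
    (hcm : ∀ x, c * Real.exp (-(a * ‖x‖ ^ θ)) ≤ m x)
    (hmC : ∀ x, m x ≤ C * Real.exp (-(a * ‖x‖ ^ θ)))
    {μ : Measure (EuclideanSpace ℝ (Fin n))}
    (hμ : μ = volume.withDensity fun x => ENNReal.ofReal (m x)) :
    ∃ B : ℝ≥0, ∀ u : EuclideanSpace ℝ (Fin n) → ℝ, Differentiable ℝ u →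
      ∫⁻ x, ENNReal.ofReal (‖x‖ ^ (2 * (θ - 1)) * u x ^ 2) ∂μ ≤
        B * (∫⁻ x, ENNReal.ofReal (‖fderiv ℝ u x‖ ^ 2) ∂μ + ∫⁻ x, ENNReal.ofReal (u x ^ 2) ∂μ) := by
  have hC : 0 < C := by
    have := (hcm 0).trans (hmC 0)
    exact hc.trans_le (le_of_mul_le_mul_right this (Real.exp_pos _))
  obtain ⟨B, hB, H⟩ := exists_lintegral_norm_rpow_mul_sq_le_exp n ha hθ
  have hlint : ∀ F : EuclideanSpace ℝ (Fin n) → ℝ, (∀ x, 0 ≤ F x) → Measurable F →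
      ∫⁻ x, ENNReal.ofReal (F x) ∂μ = ∫⁻ x, ENNReal.ofReal (F x * m x) := fun F hF0 hF => by
    rw [hμ, lintegral_withDensity_eq_lintegral_mul _ hm.ennreal_ofReal hF.ennreal_ofReal]
    refine lintegral_congr fun x => ?_
    rw [Pi.mul_apply, mul_comm, ENNReal.ofReal_mul (hF0 x)]
  have hnθ : Continuous fun x : EuclideanSpace ℝ (Fin n) => ‖x‖ ^ θ :=
    continuous_norm.rpow_const fun x => Or.inr (by linarith)
  have hn2θ : Continuous fun x : EuclideanSpace ℝ (Fin n) => ‖x‖ ^ (2 * (θ - 1)) :=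
    continuous_norm.rpow_const fun x => Or.inr (by linarith)
  have hlow : ∀ F : EuclideanSpace ℝ (Fin n) → ℝ, (∀ x, 0 ≤ F x) → Measurable F →
      ∫⁻ x, ENNReal.ofReal (F x * Real.exp (-(a * ‖x‖ ^ θ))) ≤
        ENNReal.ofReal c⁻¹ * ∫⁻ x, ENNReal.ofReal (F x) ∂μ := fun F hF0 hF => by
    rw [hlint F hF0 hF, ← lintegral_const_mul' _ _ ENNReal.ofReal_ne_top]
    refine lintegral_mono fun x => ?_
    rw [← ENNReal.ofReal_mul (by positivity)]
    refine ENNReal.ofReal_le_ofReal ?_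
    rw [le_inv_mul_iff₀ hc, mul_left_comm]
    exact mul_le_mul_of_nonneg_left (hcm x) (hF0 x)
  refine ⟨(C * B * c⁻¹).toNNReal + 1, fun u hu => ?_⟩
  set I₁ := ∫⁻ x, ENNReal.ofReal (‖fderiv ℝ u x‖ ^ 2) ∂μ with hI₁
  set I₀ := ∫⁻ x, ENNReal.ofReal (u x ^ 2) ∂μ with hI₀
  by_cases htop : I₁ + I₀ = ∞
  · rw [htop, ENNReal.mul_top (by positivity)]
    exact le_top
  rw [← Ne, ENNReal.add_ne_top] at htop
  have hucont := hu.continuous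
  have hfd : Measurable fun x => ‖fderiv ℝ u x‖ ^ 2 := (measurable_fderiv ℝ u).norm.pow_const 2
  have hint : ∀ F : EuclideanSpace ℝ (Fin n) → ℝ, (∀ x, 0 ≤ F x) → Measurable F →
      ∫⁻ x, ENNReal.ofReal (F x) ∂μ ≠ ∞ →
      Integrable fun x => F x * Real.exp (-(a * ‖x‖ ^ θ)) := fun F hF0 hF hfin => by
    refine ⟨by fun_prop, ?_⟩
    rw [hasFiniteIntegral_iff_ofReal (Filter.Eventually.of_forall fun x =>
      mul_nonneg (hF0 x) (Real.exp_pos _).le)]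
    exact (hlow F hF0 hF).trans_lt (ENNReal.mul_lt_top ENNReal.ofReal_lt_top hfin.lt_top)
  have hval : ∀ F : EuclideanSpace ℝ (Fin n) → ℝ, (∀ x, 0 ≤ F x) → Measurable F →
      ∫⁻ x, ENNReal.ofReal (F x) ∂μ ≠ ∞ →
      ENNReal.ofReal (∫ x, F x * Real.exp (-(a * ‖x‖ ^ θ))) ≤
        ENNReal.ofReal c⁻¹ * ∫⁻ x, ENNReal.ofReal (F x) ∂μ := fun F hF0 hF hfin => by
    rw [ofReal_integral_eq_lintegral_ofReal (hint F hF0 hF hfin)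
      (Filter.Eventually.of_forall fun x => mul_nonneg (hF0 x) (Real.exp_pos _).le)]
    exact hlow F hF0 hF
  have h1 := H u hu (hint (fun x => u x ^ 2) (fun x => sq_nonneg _) (by fun_prop) htop.2)
    (hint (fun x => ‖fderiv ℝ u x‖ ^ 2) (fun x => sq_nonneg _) hfd htop.1)
  have h2 := hval (fun x => u x ^ 2) (fun x => sq_nonneg _) (by fun_prop) htop.2
  have h3 := hval (fun x => ‖fderiv ℝ u x‖ ^ 2) (fun x => sq_nonneg _) hfd htop.1
  calc _ = ∫⁻ x, ENNReal.ofReal (‖x‖ ^ (2 * (θ - 1)) * u x ^ 2 * m x) :=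
        hlint (fun x => ‖x‖ ^ (2 * (θ - 1)) * u x ^ 2) (fun x => by positivity) (by fun_prop)
    _ ≤ ∫⁻ x, ENNReal.ofReal C * ENNReal.ofReal (‖x‖ ^ (2 * (θ - 1)) * u x ^ 2 *
          Real.exp (-(a * ‖x‖ ^ θ))) := by
        refine lintegral_mono fun x => ?_
        rw [← ENNReal.ofReal_mul hC.le, mul_left_comm]
        exact ENNReal.ofReal_le_ofReal (mul_le_mul_of_nonneg_left (hmC x) (by positivity))
    _ ≤ ENNReal.ofReal C * (ENNReal.ofReal B * (ENNReal.ofReal c⁻¹ * I₁ +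
          ENNReal.ofReal c⁻¹ * I₀)) := by
        rw [lintegral_const_mul' _ _ ENNReal.ofReal_ne_top]
        refine mul_le_mul_right (h1.trans ?_) _
        rw [ENNReal.ofReal_mul hB, ENNReal.ofReal_add (integral_nonneg fun x => by positivity)
          (integral_nonneg fun x => by positivity)]
        exact mul_le_mul_right (add_le_add h3 h2) _
    _ = ENNReal.ofReal (C * B * c⁻¹) * (I₁ + I₀) := by
        rw [ENNReal.ofReal_mul (by positivity), ENNReal.ofReal_mul hC.le]
        ring
    _ ≤ _ := by
        gcongr
        rw [ENNReal.coe_add]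
        exact le_self_add

theorem enorm_sub_sq_le_lintegral_deriv {γ γ' : ℝ → ℝ} (hγ : ∀ t, HasDerivAt γ (γ' t) t)
    (hm : Measurable γ') :
    ‖γ 1 - γ 0‖ₑ ^ 2 ≤ ∫⁻ t in Set.Ioc (0 : ℝ) 1, ‖γ' t‖ₑ ^ 2 := by
  have h1 : ‖γ 1 - γ 0‖ₑ ≤ ∫⁻ t in Set.Ioc (0 : ℝ) 1, ‖γ' t‖ₑ := by
    by_cases hfin : ∫⁻ t in Set.Ioc (0 : ℝ) 1, ‖γ' t‖ₑ = ∞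
    · rw [hfin]
      exact le_top
    have hint : IntervalIntegrable γ' volume 0 1 := by
      rw [intervalIntegrable_iff_integrableOn_Ioc_of_le zero_le_one]
      exact ⟨hm.aestronglyMeasurable, Ne.lt_top hfin⟩
    rw [← intervalIntegral.integral_eq_sub_of_hasDerivAt (fun t _ => hγ t) hint,
      intervalIntegral.integral_of_le zero_le_one]
    exact enorm_integral_le_lintegral_enorm _
  calc _ ≤ (∫⁻ t in Set.Ioc (0 : ℝ) 1, ‖γ' t‖ₑ * 1) ^ 2 := by
        simp only [mul_one]
        gcongr
    _ ≤ (∫⁻ t in Set.Ioc (0 : ℝ) 1, ‖γ' t‖ₑ ^ 2) * ∫⁻ t in Set.Ioc (0 : ℝ) 1, 1 ^ 2 :=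
        lintegral_mul_sq_le hm.enorm measurable_const
    _ = _ := by simp

theorem lintegral_lintegral_lintegral_rotate {α β γ : Type*} [MeasurableSpace α]
    [MeasurableSpace β] [MeasurableSpace γ] {κ : Measure α} {ν : Measure β} {τ : Measure γ}
    [SFinite κ] [SFinite ν] [SFinite τ] {F : α → β → γ → ℝ≥0∞}
    (hF : Measurable fun q : α × β × γ => F q.1 q.2.1 q.2.2) :
    ∫⁻ x, ∫⁻ y, ∫⁻ t, F x y t ∂τ ∂ν ∂κ = ∫⁻ t, ∫⁻ x, ∫⁻ y, F x y t ∂ν ∂κ ∂τ := by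
  have h1 : ∀ x, Measurable (Function.uncurry fun y t => F x y t) := fun x =>
    hF.comp measurable_prodMk_left
  have h2 : Measurable fun q : (α × γ) × β => F q.1.1 q.2 q.1.2 :=
    hF.comp (by fun_prop : Measurable fun q : (α × γ) × β => (q.1.1, q.2, q.1.2))
  calc _ = ∫⁻ x, ∫⁻ t, ∫⁻ y, F x y t ∂ν ∂τ ∂κ :=
        lintegral_congr fun x => lintegral_lintegral_swap (h1 x).aemeasurable
    _ = _ := lintegral_lintegral_swap h2.lintegral_prod_right'.aemeasurable

section Poincare

variable {n : ℕ} {R : ℝ}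

theorem lintegral_closedBall_comp_segment_le {h : EuclideanSpace ℝ (Fin n) → ℝ≥0∞}
    (hh : Measurable h) {s : ℝ} (hs : 1 / 2 ≤ s) (hs1 : s ≤ 1) {x : EuclideanSpace ℝ (Fin n)}
    (hx : x ∈ Metric.closedBall 0 R) :
    ∫⁻ y in Metric.closedBall 0 R, h ((1 - s) • x + s • y) ≤
      2 ^ n * ∫⁻ y in Metric.closedBall 0 R, h y := by
  have hs0 : 0 < s := by linarith
  set H := (Metric.closedBall (0 : EuclideanSpace ℝ (Fin n)) R).indicator h with hH
  have hHm : Measurable H := hh.indicator measurableSet_closedBall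
  have hHt : Measurable fun y => H ((1 - s) • x + y) := hHm.comp (measurable_const_add _)
  calc _ ≤ ∫⁻ y in Metric.closedBall 0 R, H ((1 - s) • x + s • y) := by
        refine setLIntegral_mono' measurableSet_closedBall fun y hy => ?_
        rw [hH, Set.indicator_of_mem]
        exact convex_closedBall _ _ hx hy (by linarith) hs0.le (by ring)
    _ ≤ ∫⁻ y, H ((1 - s) • x + s • y) := setLIntegral_le_lintegral _ _
    _ = ENNReal.ofReal |(s ^ n)⁻¹| * ∫⁻ y, H ((1 - s) • x + y) := by
        rw [← smul_eq_mul, ← lintegral_smul_measure,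
          ← lintegral_map (g := fun y => s • y) hHt (measurable_const_smul s),
          Measure.map_addHaar_smul volume hs0.ne', finrank_euclideanSpace_fin]
    _ ≤ 2 ^ n * ∫⁻ y, H ((1 - s) • x + y) := by
        gcongr
        rw [show (2 : ℝ≥0∞) ^ n = ENNReal.ofReal (2 ^ n) by
          rw [ENNReal.ofReal_pow (by norm_num)]; simp]
        refine ENNReal.ofReal_le_ofReal ?_
        rw [abs_of_pos (by positivity), ← inv_pow]
        gcongr
        rw [inv_le_comm₀ hs0 (by norm_num)]
        linarith
    _ = _ := by rw [lintegral_add_left_eq_self H, lintegral_indicator measurableSet_closedBall]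

theorem lintegral_lintegral_closedBall_segment_le {h : EuclideanSpace ℝ (Fin n) → ℝ≥0∞}
    (hh : Measurable h) {t : ℝ} (ht : t ∈ Set.Ioc (0 : ℝ) 1) :
    ∫⁻ x in Metric.closedBall 0 R, ∫⁻ y in Metric.closedBall 0 R, h (x + t • (y - x)) ≤
      2 ^ n * volume (Metric.closedBall (0 : EuclideanSpace ℝ (Fin n)) R) *
        ∫⁻ y in Metric.closedBall 0 R, h y := by
  have hconst : ∫⁻ _ in Metric.closedBall (0 : EuclideanSpace ℝ (Fin n)) R,
      2 ^ n * ∫⁻ y in Metric.closedBall 0 R, h y =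
      2 ^ n * volume (Metric.closedBall (0 : EuclideanSpace ℝ (Fin n)) R) *
        ∫⁻ y in Metric.closedBall 0 R, h y := by
    rw [setLIntegral_const]
    ring
  rw [← hconst]
  rcases le_total (1 / 2) t with h2 | h2
  · refine setLIntegral_mono' measurableSet_closedBall fun x hx => ?_
    refine le_trans (le_of_eq ?_) (lintegral_closedBall_comp_segment_le hh h2 ht.2 hx)
    refine lintegral_congr fun y => ?_
    congr 1
    module
  · have hm : Measurable fun q : EuclideanSpace ℝ (Fin n) × EuclideanSpace ℝ (Fin n) =>
      h (q.1 + t • (q.2 - q.1)) := hh.comp (by fun_prop)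
    rw [lintegral_lintegral_swap hm.aemeasurable]
    refine setLIntegral_mono' measurableSet_closedBall fun y hy => ?_
    refine le_trans (le_of_eq ?_) (lintegral_closedBall_comp_segment_le hh
      (s := 1 - t) (by linarith) (by linarith [ht.1]) hy)
    refine lintegral_congr fun x => ?_
    congr 1
    module

/-- Poincaré inequality on a ball. -/
theorem lintegral_lintegral_closedBall_sub_sq_le {g : EuclideanSpace ℝ (Fin n) → ℝ}
    (hg : Differentiable ℝ g) :
    ∫⁻ x in Metric.closedBall 0 R, ∫⁻ y in Metric.closedBall 0 R, ‖g y - g x‖ₑ ^ 2 ≤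
      ENNReal.ofReal (2 * R) ^ 2 *
        (2 ^ n * volume (Metric.closedBall (0 : EuclideanSpace ℝ (Fin n)) R) *
        ∫⁻ y in Metric.closedBall 0 R, ‖fderiv ℝ g y‖ₑ ^ 2) := by
  have hfd : Measurable (fderiv ℝ g) := measurable_fderiv ℝ g
  have hh : Measurable fun y => ‖fderiv ℝ g y‖ₑ ^ 2 := hfd.enorm.pow_const 2
  have hseg : ∀ x ∈ Metric.closedBall (0 : EuclideanSpace ℝ (Fin n)) R,
      ∀ y ∈ Metric.closedBall (0 : EuclideanSpace ℝ (Fin n)) R,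
      ‖g y - g x‖ₑ ^ 2 ≤ ENNReal.ofReal (2 * R) ^ 2 *
        ∫⁻ t in Set.Ioc (0 : ℝ) 1, ‖fderiv ℝ g (x + t • (y - x))‖ₑ ^ 2 := fun x hx y hy => by
    have hγ : ∀ t : ℝ, HasDerivAt (fun t : ℝ => g (x + t • (y - x)))
        (fderiv ℝ g (x + t • (y - x)) (y - x)) t := fun t => by
      have h1 : HasDerivAt (fun t : ℝ => x + t • (y - x)) (y - x) t := by
        simpa using ((hasDerivAt_id t).smul_const (y - x)).const_add x
      exact (hg _).hasFDerivAt.comp_hasDerivAt t h1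
    have hline : Measurable fun t : ℝ => x + t • (y - x) := by fun_prop
    have hγm : Measurable fun t : ℝ => fderiv ℝ g (x + t • (y - x)) (y - x) :=
      (measurable_fderiv_apply_const ℝ g (y - x)).comp hline
    have h2 := enorm_sub_sq_le_lintegral_deriv hγ hγm
    simp only [one_smul, zero_smul, add_zero, add_sub_cancel] at h2
    refine h2.trans ?_
    rw [← lintegral_const_mul' _ _ (by finiteness)]
    refine lintegral_mono fun t => ?_
    rw [← mul_pow]
    refine pow_le_pow_left' ?_ 2
    rw [mul_comm]
    refine ((fderiv ℝ g _).le_opENorm _).trans ?_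
    gcongr
    rw [← ofReal_norm]
    refine ENNReal.ofReal_le_ofReal ?_
    rw [mem_closedBall_zero_iff] at hx hy
    linarith [norm_sub_le y x]
  have hF : Measurable fun q : EuclideanSpace ℝ (Fin n) × EuclideanSpace ℝ (Fin n) × ℝ =>
      ‖fderiv ℝ g (q.1 + q.2.2 • (q.2.1 - q.1))‖ₑ ^ 2 :=
    hh.comp (by fun_prop : Measurable fun q : EuclideanSpace ℝ (Fin n) ×
      EuclideanSpace ℝ (Fin n) × ℝ => q.1 + q.2.2 • (q.2.1 - q.1))
  calc _ ≤ ∫⁻ x in Metric.closedBall 0 R, ∫⁻ y in Metric.closedBall 0 R,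
        ENNReal.ofReal (2 * R) ^ 2 *
          ∫⁻ t in Set.Ioc (0 : ℝ) 1, ‖fderiv ℝ g (x + t • (y - x))‖ₑ ^ 2 :=
        setLIntegral_mono' measurableSet_closedBall fun x hx =>
          setLIntegral_mono' measurableSet_closedBall fun y hy => hseg x hx y hy
    _ = ENNReal.ofReal (2 * R) ^ 2 * ∫⁻ x in Metric.closedBall 0 R,
          ∫⁻ y in Metric.closedBall 0 R,
          ∫⁻ t in Set.Ioc (0 : ℝ) 1, ‖fderiv ℝ g (x + t • (y - x))‖ₑ ^ 2 := by
        rw [← lintegral_const_mul' _ _ (by finiteness)]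
        refine lintegral_congr fun x => ?_
        rw [lintegral_const_mul' _ _ (by finiteness)]
    _ = ENNReal.ofReal (2 * R) ^ 2 * ∫⁻ t in Set.Ioc (0 : ℝ) 1,
          ∫⁻ x in Metric.closedBall 0 R, ∫⁻ y in Metric.closedBall 0 R,
            ‖fderiv ℝ g (x + t • (y - x))‖ₑ ^ 2 := by
        congr 1
        exact lintegral_lintegral_lintegral_rotate hF
    _ ≤ ENNReal.ofReal (2 * R) ^ 2 * ∫⁻ t in Set.Ioc (0 : ℝ) 1,
          2 ^ n * volume (Metric.closedBall (0 : EuclideanSpace ℝ (Fin n)) R) *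
            ∫⁻ y in Metric.closedBall 0 R, ‖fderiv ℝ g y‖ₑ ^ 2 := by
        refine mul_le_mul_right (setLIntegral_mono' measurableSet_Ioc fun t ht => ?_) _
        exact lintegral_lintegral_closedBall_segment_le hh ht
    _ = _ := by simp

theorem exists_lintegral_closedBall_sub_sq_le (hR : 0 < R) {g : EuclideanSpace ℝ (Fin n) → ℝ}
    (hg : Differentiable ℝ g) :
    ∃ x₀, ∫⁻ y in Metric.closedBall 0 R, ‖g y - g x₀‖ₑ ^ 2 ≤
      ENNReal.ofReal (2 * R) ^ 2 * (2 ^ n * ∫⁻ y in Metric.closedBall 0 R, ‖fderiv ℝ g y‖ₑ ^ 2) := by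
  have hpos : volume (Metric.closedBall (0 : EuclideanSpace ℝ (Fin n)) R) ≠ 0 :=
    (Metric.measure_closedBall_pos volume _ hR).ne'
  have hfin : volume (Metric.closedBall (0 : EuclideanSpace ℝ (Fin n)) R) ≠ ∞ :=
    measure_closedBall_lt_top.ne
  have hgc := hg.continuous
  have hm : Measurable fun q : EuclideanSpace ℝ (Fin n) × EuclideanSpace ℝ (Fin n) =>
    ‖g q.2 - g q.1‖ₑ ^ 2 := by fun_prop
  obtain ⟨x₀, -, hx₀⟩ := exists_le_setLAverage (s := Metric.closedBall 0 R) (μ := volume)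
    (f := fun x => ∫⁻ y in Metric.closedBall 0 R, ‖g y - g x‖ₑ ^ 2) hpos hfin
    hm.lintegral_prod_right'.aemeasurable
  refine ⟨x₀, hx₀.trans ?_⟩
  rw [setLAverage_eq]
  refine ENNReal.div_le_of_le_mul ((lintegral_lintegral_closedBall_sub_sq_le hg).trans_eq ?_)
  ring

end Poincare

theorem exists_lintegral_sub_const_sq_le {n : ℕ} {a θ c C : ℝ} (ha : 0 < a) (hθ : 2 ≤ θ)
    (hc : 0 < c) {m : EuclideanSpace ℝ (Fin n) → ℝ} (hm : Measurable m)
    (hcm : ∀ x, c * Real.exp (-(a * ‖x‖ ^ θ)) ≤ m x)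
    (hmC : ∀ x, m x ≤ C * Real.exp (-(a * ‖x‖ ^ θ)))
    {μ : Measure (EuclideanSpace ℝ (Fin n))} [IsFiniteMeasure μ]
    (hμ : μ = volume.withDensity fun x => ENNReal.ofReal (m x)) :
    ∃ P : ℝ≥0, ∀ g : EuclideanSpace ℝ (Fin n) → ℝ, Differentiable ℝ g →
      ∫⁻ x, ENNReal.ofReal (g x ^ 2) ∂μ ≠ ∞ →
      ∃ x₀, ∫⁻ x, ENNReal.ofReal ((g x - g x₀) ^ 2) ∂μ ≤
        P * ∫⁻ x, ENNReal.ofReal (‖fderiv ℝ g x‖ ^ 2) ∂μ := by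
  obtain ⟨B, hB⟩ := exists_lintegral_norm_rpow_mul_sq_le ha hθ hc hm hcm hmC hμ
  have hC : 0 < C := by
    have := (hcm 0).trans (hmC 0)
    exact hc.trans_le (le_of_mul_le_mul_right this (Real.exp_pos _))
  set R : ℝ := max 1 (2 * B) with hR
  have hR1 : 1 ≤ R := le_max_left _ _
  have hR0 : 0 < R := by linarith
  set b : ℝ := c * Real.exp (-(a * R ^ θ)) with hb
  have hb0 : 0 < b := by positivity
  set Q : ℝ≥0∞ := ENNReal.ofReal C * (ENNReal.ofReal (2 * R) ^ 2 * (2 ^ n * ENNReal.ofReal b⁻¹))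
    with hQ
  have hQtop : Q ≠ ∞ := by finiteness
  refine ⟨2 * Q.toNNReal + 1, fun g hg hgfin => ?_⟩
  have hgc := hg.continuous
  obtain ⟨x₀, hx₀⟩ := exists_lintegral_closedBall_sub_sq_le hR0 hg
  refine ⟨x₀, ?_⟩
  set J := ∫⁻ x, ENNReal.ofReal (‖fderiv ℝ g x‖ ^ 2) ∂μ with hJ
  set I := ∫⁻ x, ENNReal.ofReal ((g x - g x₀) ^ 2) ∂μ with hI
  have hfd : Measurable fun x => ‖fderiv ℝ g x‖ ^ 2 := (measurable_fderiv ℝ g).norm.pow_const 2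
  have henorm : ∀ r : ℝ, ENNReal.ofReal (r ^ 2) = ‖r‖ₑ ^ 2 := fun r => by
    rw [← ofReal_norm, ← ENNReal.ofReal_pow (norm_nonneg _), Real.norm_eq_abs, sq_abs]
  have hIfin : I ≠ ∞ := by
    refine ne_top_of_le_ne_top (b := 2 * (∫⁻ x, ENNReal.ofReal (g x ^ 2) ∂μ) +
      2 * ENNReal.ofReal (g x₀ ^ 2) * μ Set.univ) (by finiteness) ?_
    rw [← lintegral_const, ← lintegral_const_mul' _ _ (by finiteness),
      ← lintegral_add_right _ measurable_const]
    refine lintegral_mono fun x => ?_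
    rw [show (2 : ℝ≥0∞) = ENNReal.ofReal 2 by simp, ← ENNReal.ofReal_mul (by norm_num),
      ← ENNReal.ofReal_mul (by norm_num), ← ENNReal.ofReal_add (by positivity) (by positivity)]
    exact ENNReal.ofReal_le_ofReal (by nlinarith [sq_nonneg (g x + g x₀)])
  have hin : ∫⁻ x in Metric.closedBall 0 R, ENNReal.ofReal ((g x - g x₀) ^ 2) ∂μ ≤ Q * J := by
    calc _ = ∫⁻ x in Metric.closedBall 0 R,
          ENNReal.ofReal (m x) * ENNReal.ofReal ((g x - g x₀) ^ 2) := by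
          rw [hμ, setLIntegral_withDensity_eq_setLIntegral_mul _ hm.ennreal_ofReal (by fun_prop)
            measurableSet_closedBall]
          rfl
      _ ≤ ∫⁻ x in Metric.closedBall 0 R, ENNReal.ofReal C * ‖g x - g x₀‖ₑ ^ 2 := by
          refine lintegral_mono fun x => ?_
          rw [← henorm]
          refine mul_le_mul_left (ENNReal.ofReal_le_ofReal ((hmC x).trans ?_)) _
          refine mul_le_of_le_one_right hC.le (Real.exp_le_one_iff.2 ?_)
          have : 0 ≤ a * ‖x‖ ^ θ := by positivity
          linarith
      _ ≤ ENNReal.ofReal C * (ENNReal.ofReal (2 * R) ^ 2 * (2 ^ n *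
            ∫⁻ y in Metric.closedBall 0 R, ‖fderiv ℝ g y‖ₑ ^ 2)) := by
          rw [lintegral_const_mul' _ _ ENNReal.ofReal_ne_top]
          gcongr
      _ ≤ ENNReal.ofReal C * (ENNReal.ofReal (2 * R) ^ 2 * (2 ^ n *
            (ENNReal.ofReal b⁻¹ * J))) := by
          gcongr
          calc _ ≤ ∫⁻ y in Metric.closedBall 0 R, ENNReal.ofReal b⁻¹ *
                (ENNReal.ofReal (m y) * ENNReal.ofReal (‖fderiv ℝ g y‖ ^ 2)) := by
                refine setLIntegral_mono' measurableSet_closedBall fun y hy => ?_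
                rw [← mul_assoc, ← ENNReal.ofReal_mul (by positivity), henorm, enorm_norm]
                refine le_mul_of_one_le_left' (ENNReal.one_le_ofReal.2 ?_)
                rw [one_le_inv_mul₀ hb0]
                refine le_trans ?_ (hcm y)
                rw [mem_closedBall_zero_iff] at hy
                rw [hb]
                gcongr
            _ = ENNReal.ofReal b⁻¹ * ∫⁻ y in Metric.closedBall 0 R,
                  ENNReal.ofReal (‖fderiv ℝ g y‖ ^ 2) ∂μ := by
                rw [lintegral_const_mul' _ _ ENNReal.ofReal_ne_top, hμ,
                  setLIntegral_withDensity_eq_setLIntegral_mul _ hm.ennreal_ofReal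
                    hfd.ennreal_ofReal measurableSet_closedBall]
                rfl
            _ ≤ _ := by
                gcongr
                exact setLIntegral_le_lintegral _ _
      _ = Q * J := by rw [hQ]; ring
  have hout : 2 * ∫⁻ x in (Metric.closedBall 0 R)ᶜ, ENNReal.ofReal ((g x - g x₀) ^ 2) ∂μ ≤
      J + I := by
    by_cases hB0 : B = 0
    · have h1 := hB (fun x => g x - g x₀) (hg.sub_const _)
      simp only [fderiv_sub_const, hB0, ENNReal.coe_zero, zero_mul] at h1
      have h2 : ∫⁻ x in (Metric.closedBall 0 R)ᶜ, ENNReal.ofReal ((g x - g x₀) ^ 2) ∂μ ≤ 0 := by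
        refine le_trans ?_ h1
        refine le_trans (setLIntegral_mono' measurableSet_closedBall.compl fun x hx => ?_)
          (setLIntegral_le_lintegral _ _)
        rw [Set.mem_compl_iff, mem_closedBall_zero_iff, not_le] at hx
        refine ENNReal.ofReal_le_ofReal (le_mul_of_one_le_left (sq_nonneg _) ?_)
        exact Real.one_le_rpow (by linarith) (by linarith)
      rw [nonpos_iff_eq_zero.1 h2, mul_zero]
      exact zero_le
    have hB0' : (B : ℝ≥0∞) ≠ 0 := by exact_mod_cast hB0
    refine (ENNReal.mul_le_mul_iff_right hB0' ENNReal.coe_ne_top).1 ?_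
    have h1 := hB (fun x => g x - g x₀) (hg.sub_const _)
    simp only [fderiv_sub_const] at h1
    refine le_trans ?_ h1
    rw [← mul_assoc, ← lintegral_const_mul' _ _ (by finiteness)]
    refine le_trans (setLIntegral_mono' measurableSet_closedBall.compl fun x hx => ?_)
      (setLIntegral_le_lintegral _ _)
    rw [Set.mem_compl_iff, mem_closedBall_zero_iff, not_le] at hx
    rw [show (B : ℝ≥0∞) * 2 = ENNReal.ofReal (2 * B) by
      rw [ENNReal.ofReal_mul (by norm_num), ENNReal.ofReal_coe_nnreal, mul_comm]; simp,
      ← ENNReal.ofReal_mul (by positivity)]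
    refine ENNReal.ofReal_le_ofReal (mul_le_mul_of_nonneg_right ?_ (sq_nonneg _))
    calc 2 * (B : ℝ) ≤ ‖x‖ := (le_max_right _ _).trans hx.le
      _ = ‖x‖ ^ (1 : ℝ) := (Real.rpow_one _).symm
      _ ≤ _ := Real.rpow_le_rpow_of_exponent_le (by linarith) (by linarith)
  have hsplit : I = (∫⁻ x in Metric.closedBall 0 R, ENNReal.ofReal ((g x - g x₀) ^ 2) ∂μ) +
      ∫⁻ x in (Metric.closedBall 0 R)ᶜ, ENNReal.ofReal ((g x - g x₀) ^ 2) ∂μ :=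
    (lintegral_add_compl _ measurableSet_closedBall).symm
  have h2I : I + I ≤ (2 * Q * J + J) + I := by
    calc I + I = 2 * I := (two_mul _).symm
      _ ≤ 2 * (Q * J) + (J + I) := by
          conv_lhs => rw [hsplit]
          rw [mul_add]
          gcongr
      _ = _ := by ring
  have := (ENNReal.add_le_add_iff_right hIfin).1 h2I
  refine this.trans_eq ?_
  push_cast
  rw [ENNReal.coe_toNNReal hQtop]
  ring

theorem lintegral_sub_one_sq_le {α : Type*} [MeasurableSpace α] {μ : Measure α}
    [IsProbabilityMeasure μ] {g : α → ℝ} (hg : Measurable g) (hg0 : ∀ x, 0 ≤ g x)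
    (hg1 : ∫⁻ x, ENNReal.ofReal (g x ^ 2) ∂μ = 1) {c : ℝ} :
    ∫⁻ x, ENNReal.ofReal ((g x - 1) ^ 2) ∂μ ≤
      2 * ∫⁻ x, ENNReal.ofReal ((g x - c) ^ 2) ∂μ := by
  have hi2 : Integrable (fun x => g x ^ 2) μ := by
    refine ⟨by fun_prop, ?_⟩
    rw [hasFiniteIntegral_iff_ofReal (Filter.Eventually.of_forall fun x => by positivity), hg1]
    exact ENNReal.one_lt_top
  have hi1 : Integrable g μ := by
    refine (hi2.add (integrable_const 1)).mono' (by fun_prop)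
      (Filter.Eventually.of_forall fun x => ?_)
    rw [Real.norm_of_nonneg (hg0 x)]
    simp only [Pi.add_apply]
    nlinarith [sq_nonneg (g x - 1)]
  have h1 : ∫ x, g x ^ 2 ∂μ = 1 := by
    rw [integral_eq_lintegral_of_nonneg_ae (Filter.Eventually.of_forall fun x => by positivity)
      (by fun_prop), hg1]
    rfl
  have key : ∀ s : ℝ, Integrable (fun x => (g x - s) ^ 2) μ ∧
      ∫ x, (g x - s) ^ 2 ∂μ = 1 - 2 * s * ∫ x, g x ∂μ + s ^ 2 := fun s => by
    have e : (fun x => (g x - s) ^ 2) = fun x => g x ^ 2 - 2 * s * g x + s ^ 2 := by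
      funext x
      ring
    have hi3 : Integrable (fun x => g x ^ 2 - 2 * s * g x) μ := hi2.sub (hi1.const_mul _)
    rw [e]
    refine ⟨hi3.add (integrable_const _), ?_⟩
    rw [integral_add hi3 (integrable_const _), integral_sub hi2 (hi1.const_mul _), h1,
      integral_const_mul]
    simp
  have hA0 : 0 ≤ ∫ x, g x ∂μ := integral_nonneg hg0
  have hA1 := (key 1).2
  have hA2 : 0 ≤ ∫ x, (g x - 1) ^ 2 ∂μ := integral_nonneg fun x => sq_nonneg _
  rw [← ofReal_integral_eq_lintegral_ofReal (key 1).1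
    (Filter.Eventually.of_forall fun x => sq_nonneg _),
    ← ofReal_integral_eq_lintegral_ofReal (key c).1
    (Filter.Eventually.of_forall fun x => sq_nonneg _),
    show (2 : ℝ≥0∞) = ENNReal.ofReal 2 by simp, ← ENNReal.ofReal_mul (by norm_num)]
  refine ENNReal.ofReal_le_ofReal ?_
  rw [(key c).2]
  set A := ∫ x, g x ∂μ
  have hA3 : A ≤ 1 := by linarith
  nlinarith [sq_nonneg (c - A), mul_nonneg hA0 (sub_nonneg.2 hA3)]

theorem lintegral_enorm_sq_rpow_le {n : ℕ} (ν : Measure (EuclideanSpace ℝ (Fin n)))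
    [IsProbabilityMeasure ν] {q : ℝ} (hq : 1 ≤ q) :
    (∫⁻ x, ‖x‖ₑ ^ (2 : ℝ) ∂ν) ^ q ≤ ∫⁻ x, ENNReal.ofReal (‖x‖ ^ (2 * q)) ∂ν := by
  have h := eLpNorm'_le_eLpNorm'_of_exponent_le (p := 2) (q := 2 * q) (by norm_num)
    (by linarith) ν (f := fun x : EuclideanSpace ℝ (Fin n) => x) (by fun_prop)
  simp only [eLpNorm'] at h
  have h2 := ENNReal.rpow_le_rpow h (show 0 ≤ 2 * q by linarith)
  rw [← ENNReal.rpow_mul, ← ENNReal.rpow_mul] at h2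
  have e1 : 1 / 2 * (2 * q) = q := by ring
  have e2 : 1 / (2 * q) * (2 * q) = 1 := by field_simp
  rw [e1, e2, ENNReal.rpow_one] at h2
  refine h2.trans (lintegral_mono fun x => ?_)
  rw [← ofReal_norm, ENNReal.ofReal_rpow_of_nonneg (norm_nonneg _) (by linarith)]

theorem wassersteinDist_two_rpow_le_of_isCoupling {n : ℕ}
    {ν μ : Measure (EuclideanSpace ℝ (Fin n))}
    {π : Measure (EuclideanSpace ℝ (Fin n) × EuclideanSpace ℝ (Fin n))}
    (hπ : IsCoupling π ν μ) {q : ℝ} (hq : 0 ≤ q) :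
    wassersteinDist 2 ν μ ^ (2 * q) ≤ (∫⁻ q, edist q.1 q.2 ^ (2 : ℝ) ∂π) ^ q := by
  rw [wassersteinDist, ← ENNReal.rpow_mul, show 1 / 2 * (2 * q) = q by ring]
  exact ENNReal.rpow_le_rpow (iInf₂_le π hπ) hq

theorem wassersteinDist_two_rpow_le_moment {n : ℕ}
    (ν μ : Measure (EuclideanSpace ℝ (Fin n))) [IsProbabilityMeasure ν] [IsProbabilityMeasure μ]
    {q : ℝ} (hq : 1 ≤ q) :
    wassersteinDist 2 ν μ ^ (2 * q) ≤ 8 ^ q *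
      (∫⁻ x, ENNReal.ofReal (‖x‖ ^ (2 * q)) ∂ν + ∫⁻ x, ENNReal.ofReal (‖x‖ ^ (2 * q)) ∂μ) := by
  obtain ⟨π, hπ, hπc⟩ := exists_isCoupling_add (η := 0) (σ := ν) (τ := μ) (by simp) measurable_id
  simp only [zero_add, id, edist_self] at hπ hπc
  rw [ENNReal.zero_rpow_of_pos two_pos, lintegral_zero, mul_zero, zero_add] at hπc
  have hπ : IsCoupling π ν μ := by simpa [IsCoupling] using hπ
  have hq0 : 0 ≤ q := by linarith
  refine (wassersteinDist_two_rpow_le_of_isCoupling hπ hq0).trans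
    ((ENNReal.rpow_le_rpow hπc hq0).trans ?_)
  rw [ENNReal.mul_rpow_of_nonneg _ _ hq0]
  calc _ ≤ (4 : ℝ≥0∞) ^ q * (2 ^ q * ((∫⁻ x, ‖x‖ₑ ^ (2 : ℝ) ∂ν) ^ q +
        (∫⁻ x, ‖x‖ₑ ^ (2 : ℝ) ∂μ) ^ q)) := by
        gcongr
        refine (ENNReal.rpow_add_le_mul_rpow_add_rpow _ _ hq).trans ?_
        gcongr
        · norm_num
        · linarith
    _ = 8 ^ q * ((∫⁻ x, ‖x‖ₑ ^ (2 : ℝ) ∂ν) ^ q + (∫⁻ x, ‖x‖ₑ ^ (2 : ℝ) ∂μ) ^ q) := by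
        rw [← mul_assoc, ← ENNReal.mul_rpow_of_nonneg _ _ hq0]
        norm_num
    _ ≤ _ := by
        gcongr <;> exact lintegral_enorm_sq_rpow_le _ hq

theorem exists_wassersteinDist_two_rpow_le {n : ℕ} {a θ c C : ℝ} (ha : 0 < a) (hθ : 2 ≤ θ)
    (hc : 0 < c) {m : EuclideanSpace ℝ (Fin n) → ℝ} (hm : Measurable m)
    (hcm : ∀ x, c * Real.exp (-(a * ‖x‖ ^ θ)) ≤ m x)
    (hmC : ∀ x, m x ≤ C * Real.exp (-(a * ‖x‖ ^ θ)))
    {μ : Measure (EuclideanSpace ℝ (Fin n))} [IsProbabilityMeasure μ]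
    (hμ : μ = volume.withDensity fun x => ENNReal.ofReal (m x)) :
    ∃ K : ℝ≥0, ∀ g : EuclideanSpace ℝ (Fin n) → ℝ, Differentiable ℝ g → (∀ x, 0 ≤ g x) →
      ∫⁻ x, ENNReal.ofReal (g x ^ 2) ∂μ = 1 →
      wassersteinDist 2 (μ.withDensity fun x => ENNReal.ofReal (g x ^ 2)) μ ^ (2 * (θ - 1)) ≤
        K * ∫⁻ x, ENNReal.ofReal (‖fderiv ℝ g x‖ ^ 2) ∂μ := by
  obtain ⟨B, hB⟩ := exists_lintegral_norm_rpow_mul_sq_le ha hθ hc hm hcm hmC hμ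
  obtain ⟨P, hP⟩ := exists_lintegral_sub_const_sq_le ha hθ hc hm hcm hmC hμ
  obtain ⟨ε, hε, A, hA⟩ := exists_transport_density ha hθ hc hm hcm hmC hμ (by simp)
  have hq : 1 ≤ θ - 1 := by linarith
  have hq0 : 0 ≤ θ - 1 := by linarith
  have hpow : ∀ x : EuclideanSpace ℝ (Fin n), ‖x‖ ^ 2 ≤ 1 + ‖x‖ ^ (2 * (θ - 1)) := fun x => by
    rcases le_total ‖x‖ 1 with h | h
    · have : ‖x‖ ^ 2 ≤ 1 := pow_le_one₀ (norm_nonneg _) h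
      have : 0 ≤ ‖x‖ ^ (2 * (θ - 1)) := by positivity
      linarith
    · have : ‖x‖ ^ (2 : ℝ) ≤ ‖x‖ ^ (2 * (θ - 1)) :=
        Real.rpow_le_rpow_of_exponent_le h (by linarith)
      rw [Real.rpow_two] at this
      linarith
  have hmomμ : ∫⁻ x, ENNReal.ofReal (‖x‖ ^ (2 * (θ - 1))) ∂μ ≤ B := by
    simpa using hB (fun _ => 1) (by fun_prop)
  have hmom : ∫⁻ x, ‖x‖ₑ ^ (2 : ℝ) ∂μ ≠ ∞ := by
    refine ne_top_of_le_ne_top (b := 1 + (B : ℝ≥0∞)) (by finiteness) ?_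
    calc _ ≤ ∫⁻ x, (1 + ENNReal.ofReal (‖x‖ ^ (2 * (θ - 1)))) ∂μ := by
          refine lintegral_mono fun x => ?_
          rw [← ofReal_norm, ENNReal.ofReal_rpow_of_nonneg (norm_nonneg _) (by norm_num),
            Real.rpow_two, ← ENNReal.ofReal_one, ← ENNReal.ofReal_add zero_le_one (by positivity)]
          exact ENNReal.ofReal_le_ofReal (hpow x)
      _ ≤ 1 + B := by
          rw [lintegral_add_left measurable_const]
          simpa using add_le_add_right hmomμ 1
  obtain ⟨C₀, hC₀⟩ := exists_isCoupling_cost_le hmom hε hA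
  set C₁ : ℝ≥0 := C₀ * (4 * P + B * (1 + 2 * P))
  refine ⟨C₁ ^ (θ - 1) + 8 ^ (θ - 1) * (3 * B), fun g hg hg0 hg1 => ?_⟩
  set J := ∫⁻ x, ENNReal.ofReal (‖fderiv ℝ g x‖ ^ 2) ∂μ
  have hgm : Measurable g := hg.continuous.measurable
  rcases le_total J 1 with hJ | hJ
  · obtain ⟨x₀, hx₀⟩ := hP g hg (by simp [hg1])
    have hvar : ∫⁻ x, ENNReal.ofReal ((g x - 1) ^ 2) ∂μ ≤ 2 * P * J :=
      (lintegral_sub_one_sq_le hgm hg0 hg1).trans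
        ((mul_le_mul_right hx₀ 2).trans (mul_assoc _ _ _).ge)
    have hu := hB (fun x => g x - 1) (by fun_prop)
    simp only [fderiv_sub_const] at hu
    obtain ⟨π, hπ, hπc⟩ := hC₀ g hgm hg0 hg1
    have hcost : ∫⁻ q, edist q.1 q.2 ^ (2 : ℝ) ∂π ≤ C₁ * J := by
      refine hπc.trans ?_
      calc _ ≤ C₀ * (2 * ∫⁻ x, ENNReal.ofReal ((g x - 1) ^ 2) ∂μ +
            ∫⁻ x, ENNReal.ofReal (‖x‖ ^ (2 * (θ - 1)) * (g x - 1) ^ 2) ∂μ) := by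
            gcongr
            rw [← lintegral_const_mul _ (by fun_prop), ← lintegral_add_left (by fun_prop)]
            gcongr with x
            have h2 : 2 * ENNReal.ofReal ((g x - 1) ^ 2) = ENNReal.ofReal (2 * (g x - 1) ^ 2) := by
              rw [ENNReal.ofReal_mul two_pos.le, ENNReal.ofReal_ofNat]
            rw [h2, ← ENNReal.ofReal_add (by positivity) (by positivity)]
            refine ENNReal.ofReal_le_ofReal ?_
            nlinarith [mul_le_mul_of_nonneg_right (hpow x) (sq_nonneg (g x - 1))]
        _ ≤ C₀ * (2 * (2 * P * J) + B * (J + 2 * P * J)) := by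
            gcongr
            exact hu.trans (by gcongr)
        _ = C₁ * J := by
            simp only [C₁]
            push_cast
            ring
    refine (wassersteinDist_two_rpow_le_of_isCoupling hπ hq0).trans
      ((ENNReal.rpow_le_rpow hcost hq0).trans ?_)
    rw [ENNReal.mul_rpow_of_nonneg _ _ hq0, ← ENNReal.coe_rpow_of_nonneg _ hq0]
    gcongr
    · exact le_self_add
    · simpa using ENNReal.rpow_le_rpow_of_exponent_ge hJ hq
  · have hν : IsProbabilityMeasure (μ.withDensity fun x => ENNReal.ofReal (g x ^ 2)) :=
      ⟨by simpa using hg1⟩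
    have hmomν : ∫⁻ x, ENNReal.ofReal (‖x‖ ^ (2 * (θ - 1)))
        ∂(μ.withDensity fun x => ENNReal.ofReal (g x ^ 2)) ≤ B * (J + 1) := by
      rw [lintegral_withDensity_eq_lintegral_mul _ (by fun_prop) (by fun_prop), ← hg1]
      refine le_of_eq_of_le (lintegral_congr fun x => ?_) (hB g hg)
      rw [Pi.mul_apply, ← ENNReal.ofReal_mul (by positivity), mul_comm]
    calc _ ≤ (8 : ℝ≥0∞) ^ (θ - 1) * (B * (J + 1) + B) :=
          (wassersteinDist_two_rpow_le_moment _ μ hq).trans (by gcongr)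
      _ ≤ 8 ^ (θ - 1) * (B * (J + J) + B * J) := by
          gcongr
          exact le_mul_of_one_le_right (by simp) hJ
      _ = 8 ^ (θ - 1) * (3 * B) * J := by ring
      _ ≤ _ := by
          gcongr
          push_cast
          rw [ENNReal.coe_rpow_of_nonneg _ hq0, ENNReal.coe_rpow_of_nonneg _ hq0]
          exact le_add_self

/-- **Example 4.3**: if `V − a|x|^θ` is bounded for some `a > 0` and `θ ≥ 2`, then
`μ = e^{−V}dx/Z` satisfies `C · W₂(ν,μ)^{2(θ−1)} ≤ I(ν|μ)` for some `C > 0`. -/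
theorem W2I_power_potential {n : ℕ}
    (V : EuclideanSpace ℝ (Fin n) → ℝ) (hV : Continuous V) (Z : ℝ) (hZ : 0 < Z)
    (μ : Measure (EuclideanSpace ℝ (Fin n)))
    (hμ : μ = volume.withDensity fun x => ENNReal.ofReal (Real.exp (-V x) / Z))
    (hμprob : IsProbabilityMeasure μ)
    (a θ : ℝ) (ha : 0 < a) (hθ : 2 ≤ θ)
    (hbdd : ∃ M : ℝ, ∀ x, |V x - a * ‖x‖ ^ θ| ≤ M) :
    ∃ C : ℝ, 0 < C ∧
      ∀ ν : Measure (EuclideanSpace ℝ (Fin n)), IsProbabilityMeasure ν →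
        ENNReal.ofReal C * wassersteinDist 2 ν μ ^ (2 * (θ - 1)) ≤
          fisherInfo ν μ := by
  obtain ⟨M, hM⟩ := hbdd
  obtain ⟨K, hK⟩ := exists_wassersteinDist_two_rpow_le (c := Real.exp (-M) / Z)
    (C := Real.exp M / Z) ha hθ (by positivity) (m := fun x => Real.exp (-V x) / Z)
    (by fun_prop)
    (fun x => by
      rw [div_mul_eq_mul_div, ← Real.exp_add]
      gcongr
      linarith [(abs_le.1 (hM x)).2])
    (fun x => by
      rw [div_mul_eq_mul_div, ← Real.exp_add]
      gcongr
      linarith [(abs_le.1 (hM x)).1]) hμ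
  refine ⟨((K + 1 : ℝ≥0) : ℝ)⁻¹, by positivity, fun ν hν => ?_⟩
  refine le_iInf fun f => le_iInf fun hf => le_iInf fun hνf => le_iInf fun hfd => ?_
  have hsq : ∀ x, Real.sqrt (f x) ^ 2 = f x := fun x => Real.sq_sqrt (hf x)
  have h1 : ∫⁻ x, ENNReal.ofReal (Real.sqrt (f x) ^ 2) ∂μ = 1 := by
    simp_rw [hsq]
    rw [← setLIntegral_univ, ← withDensity_apply _ MeasurableSet.univ, ← hνf, measure_univ]
  have h := hK _ hfd (fun x => Real.sqrt_nonneg _) h1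
  simp_rw [hsq] at h
  rw [← hνf] at h
  have hgrad : ∫⁻ x, ENNReal.ofReal (‖fderiv ℝ (fun y => Real.sqrt (f y)) x‖ ^ 2) ∂μ =
      ∫⁻ x, (‖gradient (fun y => Real.sqrt (f y)) x‖₊ : ℝ≥0∞) ^ 2 ∂μ := by
    refine lintegral_congr fun x => ?_
    rw [gradient, LinearIsometryEquiv.nnnorm_map, ENNReal.ofReal_pow (norm_nonneg _),
      ofReal_norm, enorm_eq_nnnorm]
  rw [hgrad] at h
  rw [← NNReal.coe_inv, ENNReal.ofReal_coe_nnreal, ENNReal.coe_inv (by positivity), mul_comm,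
    ← div_eq_mul_inv]
  refine ENNReal.div_le_of_le_mul' (h.trans ?_)
  gcongr
  simp
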